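/- arXiv:2012.08685 — 5 statements merged into one kernel-verified Lean document; each statement's English description precedes it below -/
import Mathlib

section
/- Let X be a compact geodesic metric space of finite Hausdorff dimension whose metric has curvature ≥ 0 in the comparison sense, and let F be a nonempty quasi-convex subset of X. Then F has only finitely many connected components. -/
open Metric

/-- Euclidean comparison angle at `p` between `x` and `y`. -/
noncomputable def compAngle₀ {X : Type*} [MetricSpace X] (x p y : X) : ℝ :=
  Real.arccos ((dist p x ^ 2 + dist p y ^ 2 - dist x y ^ 2) / (2 * dist p x * dist p y))

/-- `X` has curvature `≥ 0` in the comparison sense. -/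
def CurvCompGE0 (X : Type*) [MetricSpace X] : Prop :=
  ∀ p a b c : X, a ≠ p → b ≠ p → c ≠ p →
    compAngle₀ a p b + compAngle₀ b p c + compAngle₀ c p a ≤ 2 * Real.pi

/-- `X` is a geodesic space: every two points have a midpoint. -/
def GeodesicSpace (X : Type*) [MetricSpace X] : Prop :=
  ∀ x y : X, ∃ m : X, dist x m = dist x y / 2 ∧ dist m y = dist x y / 2

/-- `F` is a quasi-convex subset of `X` (comparison-angle formulation, curvature `≥ 0`). -/
def IsQuasiConvex {X : Type*} [MetricSpace X] (F : Set X) : Prop :=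
  IsClosed F ∧
    ∀ q p : X, q ∉ F → p ∈ F → dist q p = infDist q F →
      ∀ r ∈ F, dist q r ^ 2 ≤ dist q p ^ 2 + dist p r ^ 2

open Metric Filter Topology

/-- The midpoint inequality in curvature `≥ 0`. -/
lemma midpoint_ineq {X : Type*} [MetricSpace X] (hcurv : CurvCompGE0 X) {x y m : X} (r : X)
    (h1 : dist x m = dist x y / 2) (h2 : dist m y = dist x y / 2) :
    dist x r ^ 2 + dist y r ^ 2 ≤ 2 * dist m r ^ 2 + dist x y ^ 2 / 2 := by
  by_cases hxy : x = y
  · subst hxy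
    have : x = m := by
      rw [← dist_eq_zero, h1]; simp
    subst this
    simp
    linarith
  have hL : 0 < dist x y := dist_pos.2 hxy
  by_cases hr : r = m
  · subst hr
    rw [h1, dist_comm y r, h2]
    nlinarith [sq_nonneg (dist r r)]
  have hM : 0 < dist m r := dist_pos.2 (Ne.symm hr)
  have hxm : x ≠ m := by
    rw [← dist_pos, h1]; linarith
  have hym : y ≠ m := by
    rw [ne_comm, ← dist_pos, h2]; linarith
  have key := hcurv m x y r hxm hym hr
  unfold compAngle₀ at key
  rw [dist_comm m x, h1, h2, dist_comm r x] at key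
  set L := dist x y / 2 with hLdef
  have hL2 : dist x y = 2 * L := by rw [hLdef]; ring
  have hLp : 0 < L := by rw [hLdef]; linarith
  rw [hL2] at key ⊢
  have e1 : (L ^ 2 + L ^ 2 - (2 * L) ^ 2) / (2 * L * L) = -1 := by
    field_simp; ring
  rw [e1, Real.arccos_neg_one] at key
  set M := dist m r
  set u := (L ^ 2 + M ^ 2 - dist y r ^ 2) / (2 * L * M) with hu
  set v := (M ^ 2 + L ^ 2 - dist x r ^ 2) / (2 * M * L) with hv
  have huv : 0 ≤ u + v := by
    have tx1 := dist_triangle x m r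
    have tx2 := dist_triangle_left m r x
    have tx3 := dist_triangle_right x m r
    have ty1 := dist_triangle_left y r m
    have ty2 := dist_triangle_right m r y
    have ty3 := dist_triangle_right m y r
    have bu : u ≤ 1 := by
      rw [hu, div_le_one (by positivity)]
      have := abs_le_of_sq_le_sq' (a := L - M) (b := dist y r)
      have h3 : (L - M) ^ 2 ≤ dist y r ^ 2 := by
        apply sq_le_sq'
        · rw [dist_comm r y] at *
          have := dist_triangle m y r
          show -dist y r ≤ L - dist m r
          linarith
        · have := dist_triangle_right m y r
          show L - dist m r ≤ dist y r
          linarith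
      nlinarith
    have bv : v ≤ 1 := by
      rw [hv, div_le_one (by positivity)]
      have h3 : (L - M) ^ 2 ≤ dist x r ^ 2 := by
        apply sq_le_sq'
        · show -dist x r ≤ L - dist m r
          have := dist_triangle_left m r x
          linarith
        · show L - dist m r ≤ dist x r
          have := dist_triangle_right x m r
          linarith
      nlinarith
    have bv' : -1 ≤ v := by
      rw [hv, le_div_iff₀ (by positivity)]
      have h3 : dist x r ^ 2 ≤ (L + M) ^ 2 := by
        apply pow_le_pow_left₀ dist_nonneg
        show dist x r ≤ L + dist m r
        linarith
      nlinarith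
    have h4 : Real.arccos u ≤ Real.arccos (-v) := by
      rw [Real.arccos_neg]; linarith
    by_contra hneg
    push Not at hneg
    by_cases hu1 : -1 ≤ u
    · have := Real.strictAntiOn_arccos (a := u) (b := -v) ⟨hu1, bu⟩ ⟨by linarith, by linarith⟩
        (by linarith)
      linarith
    · have h3 : dist y r ^ 2 ≤ (L + M) ^ 2 := by
        apply pow_le_pow_left₀ dist_nonneg
        show dist y r ≤ L + dist m r
        linarith
      apply hu1
      rw [hu, le_div_iff₀ (by positivity)]
      nlinarith
  have e2 : u + v = (2 * M ^ 2 + 2 * L ^ 2 - dist x r ^ 2 - dist y r ^ 2) / (2 * L * M) := by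
    rw [hu, hv]; field_simp; ring
  rw [e2] at huv
  have : 0 < 2 * L * M := by positivity
  rw [le_div_iff₀ this] at huv
  nlinarith

/-- Metric analogue of the inner product at `p`. -/
noncomputable def mip {X : Type*} [MetricSpace X] (p x y : X) : ℝ :=
  (dist p x ^ 2 + dist p y ^ 2 - dist x y ^ 2) / 2

lemma mip_comm {X : Type*} [MetricSpace X] (p x y : X) : mip p x y = mip p y x := by
  unfold mip; rw [dist_comm x y]; ring

/-- existence of dyadic contractions. -/
lemma exists_contraction {X : Type*} [MetricSpace X] (hgeo : GeodesicSpace X)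
    (hcurv : CurvCompGE0 X) :
    ∃ c : ℕ → X → X → X, (∀ j z x, dist z (c j z x) = dist z x / 2 ^ j) ∧
      (∀ j z x, dist z (c j z x) + dist (c j z x) x = dist z x) ∧
      (∀ j z x y, mip z (c j z x) y ≤ mip z x y / 2 ^ j) ∧
      (∀ j z x, c 0 z x = x ∧ ∃ y, y = c j z x ∧ dist z (c (j+1) z x) = dist z y / 2 ∧
        dist (c (j+1) z x) y = dist z y / 2) := by
  choose h h1 h2 using hgeo
  refine ⟨fun j z x => (h z)^[j] x, ?_, ?_, ?_, ?_⟩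
  · intro j z x
    induction j with
    | zero => simp
    | succ j ih => 
      simp only [Function.iterate_succ_apply', h1] at ih ⊢
      rw [ih, pow_succ]; field_simp
  · intro j z x
    apply le_antisymm _ (dist_triangle _ _ _)
    induction j with
    | zero => simp
    | succ j ih =>
      simp only [Function.iterate_succ_apply'] at ih ⊢
      have := h1 z ((h z)^[j] x)
      have h3 := h2 z ((h z)^[j] x)
      have := dist_triangle (h z ((h z)^[j] x)) ((h z)^[j] x) x
      linarith
  · intro j z x y
    induction j with
    | zero => simp
    | succ j ih =>
      simp only [Function.iterate_succ_apply'] at ih ⊢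
      set w := (h z)^[j] x
      have h3 := midpoint_ineq hcurv y (h1 z w) (h2 z w)
      have : mip z (h z w) y ≤ mip z w y / 2 := by
        unfold mip
        rw [h1]
        nlinarith
      calc mip z (h z w) y ≤ mip z w y / 2 := this
        _ ≤ (mip z x y / 2 ^ j) / 2 := by linarith
        _ = _ := by rw [pow_succ]; field_simp
  · intro j z x
    refine ⟨rfl, _, rfl, ?_, ?_⟩
    · simp only [Function.iterate_succ_apply', h1]
    · simp only [Function.iterate_succ_apply', h2]

/-- Separation of components in a closed subset. -/
lemma exists_separation {X : Type*} [MetricSpace X] [CompactSpace X] {F : Set X}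
    (hF : IsClosed F) {p x : X} (hp : p ∈ F) (hx : x ∈ F) (hpx : x ∉ connectedComponentIn F p) :
    ∃ A B : Set X, IsClosed A ∧ IsClosed B ∧ A ∪ B = F ∧ Disjoint A B ∧ p ∈ A ∧ x ∈ B := by
  have : CompactSpace F := isCompact_iff_compactSpace.1 hF.isCompact
  rw [connectedComponentIn_eq_image hp] at hpx
  have h1 : (⟨x, hx⟩ : F) ∉ connectedComponent (⟨p, hp⟩ : F) := fun h => hpx ⟨_, h, rfl⟩
  rw [connectedComponent_eq_iInter_isClopen, Set.mem_iInter] at h1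
  push Not at h1
  obtain ⟨⟨U, hU, hpU⟩, hxU⟩ := h1
  refine ⟨Subtype.val '' U, Subtype.val '' Uᶜ, ?_, ?_, ?_, ?_, ⟨_, hpU, rfl⟩, ⟨_, hxU, rfl⟩⟩
  · exact hF.isClosedEmbedding_subtypeVal.isClosedMap _ hU.1
  · exact hF.isClosedEmbedding_subtypeVal.isClosedMap _ hU.compl.1
  · rw [← Set.image_union, Set.union_compl_self]; simp
  · exact (Set.disjoint_image_iff Subtype.val_injective).2 disjoint_compl_right

lemma exists_nearest {X : Type*} [MetricSpace X] [CompactSpace X] 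
    (hgeo : GeodesicSpace X) (hcurv : CurvCompGE0 X) {F : Set X} (hqc : IsQuasiConvex F)
    {p x : X} (hp : p ∈ F) (hx : x ∈ F) (hpx : x ∉ connectedComponentIn F p) :
    ∃ q ∈ F, 0 < dist p q ∧ dist p q ≤ dist p x ∧
      ∀ r ∈ F, dist p r ^ 2 ≤ dist p q ^ 2 + dist q r ^ 2 := by
  obtain ⟨A, B, hA, hB, hAB, hd, hpA, hxB⟩ := exists_separation hqc.1 hp hx hpx
  obtain ⟨q, hqB, hq⟩ := hB.isCompact.exists_infDist_eq_dist ⟨x, hxB⟩ p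
  have hmin : ∀ b ∈ B, dist p q ≤ dist p b := fun b hb => hq ▸ infDist_le_dist_of_mem hb
  have hqF : q ∈ F := hAB ▸ Or.inr hqB
  have hpq : p ≠ q := by
    rintro rfl
    exact Set.disjoint_left.1 hd hpA hqB
  have hD : 0 < dist p q := dist_pos.2 hpq
  refine ⟨q, hqF, hD, hmin x hxB, ?_⟩
  obtain ⟨c, c1, c2, c3, c4⟩ := exists_contraction hgeo hcurv
  -- gap
  have hqA : q ∉ A := fun h => Set.disjoint_left.1 hd h hqB
  have hg : 0 < infDist q A := (hA.notMem_iff_infDist_pos ⟨p, hpA⟩).1 hqA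
  have hgap : ∀ a ∈ A, infDist q A ≤ dist q a := fun a ha => infDist_le_dist_of_mem ha
  obtain ⟨k, hk⟩ : ∃ k : ℕ, dist q p / 2 ^ k < infDist q A / 2 := by
    obtain ⟨k, hk⟩ := exists_pow_lt_of_lt_one (y := (1/2 : ℝ))
      (show 0 < infDist q A / 2 / dist q p by rw [dist_comm q p]; positivity) (by norm_num)
    refine ⟨k, ?_⟩
    rw [lt_div_iff₀ (by rw [dist_comm]; exact hD)] at hk
    rw [one_div, inv_pow] at hk
    rw [div_eq_inv_mul]; exact hk
  intro r hr
  have hP : ∀ j, dist (c j q p) r ^ 2 ≤ dist (c j q p) q ^ 2 + dist q r ^ 2 →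
      dist p r ^ 2 ≤ dist p q ^ 2 + dist q r ^ 2 := by
    intro j
    induction j with
    | zero => rw [(c4 0 q p).1]; exact id
    | succ j ih =>
      intro h
      apply ih
      obtain ⟨y, hy, hy1, hy2⟩ := (c4 j q p).2
      rw [← hy]
      have h3 := midpoint_ineq hcurv r hy1 hy2
      rw [dist_comm _ q, hy1] at h
      rw [dist_comm y q]
      nlinarith
  apply hP k
  set y := c k q p with hy
  have hyq : dist y q = dist q p / 2 ^ k := by rw [dist_comm, c1]
  have hs : 0 < dist y q := by rw [hyq, dist_comm q p]; positivity
  have hle : ∀ b ∈ F, dist y q ≤ dist y b := by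
    intro b hb
    rw [← hAB] at hb
    rcases hb with hb | hb
    · have := hgap b hb
      have := dist_triangle q y b
      rw [dist_comm q y] at this
      linarith
    · have h1 := hmin b hb
      have h2 := c2 k q p
      have h3 := dist_triangle p y b
      rw [← hy, dist_comm q y, dist_comm y p, dist_comm q p] at h2
      linarith
  have hyF : y ∉ F := by
    intro h
    have := hle y h
    simp at this
    rw [this] at hs
    simp at hs
  refine hqc.2 y q hyF hqF ?_ r hr
  apply le_antisymm
  · rw [le_infDist ⟨q, hqF⟩]
    intro b hb; exact hle b hb
  · exact infDist_le_dist_of_mem hqF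

lemma contraction_expand {X : Type*} [MetricSpace X] {c : ℕ → X → X → X}
    (c1 : ∀ j z x, dist z (c j z x) = dist z x / 2 ^ j)
    (c3 : ∀ j z x y, mip z (c j z x) y ≤ mip z x y / 2 ^ j) (j : ℕ) (z x y : X) :
    dist x y / 2 ^ j ≤ dist (c j z x) (c j z y) := by
  have h1 := c3 j z x (c j z y)
  have h2 := c3 j z y x
  rw [mip_comm z (c j z y) x, mip_comm z y x] at h2
  have hpos : (0 : ℝ) < 2 ^ j := by positivity
  have h3 : mip z (c j z x) (c j z y) ≤ mip z x y / 2 ^ j / 2 ^ j :=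
    h1.trans (by gcongr)
  apply le_of_sq_le_sq _ dist_nonneg
  unfold mip at h3
  rw [c1, c1] at h3
  have e : (dist z x ^ 2 + dist z y ^ 2 - dist x y ^ 2) / 2 / 2 ^ j / 2 ^ j =
    ((dist z x / 2 ^ j) ^ 2 + (dist z y / 2 ^ j) ^ 2 - (dist x y / 2 ^ j) ^ 2) / 2 := by
    field_simp
  rw [e] at h3
  linarith

lemma exists_packing {X : Type*} [MetricSpace X] (hgeo : GeodesicSpace X)
    (hcurv : CurvCompGE0 X) {F : Set X} {p : X}
    (h : ∀ ε > 0, ∃ q ∈ F, 0 < dist p q ∧ dist p q ≤ ε ∧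
      ∀ r ∈ F, dist p r ^ 2 ≤ dist p q ^ 2 + dist q r ^ 2) (N : ℕ) :
    ∃ ρ > 0, ∃ P : Fin N → X, (∀ i, dist p (P i) ≤ 2 * ρ) ∧
      ∀ i j, i ≠ j → ρ ≤ dist (P i) (P j) := by
  obtain ⟨c, c1, c2, c3, c4⟩ := exists_contraction hgeo hcurv
  have : Nonempty X := ⟨p⟩
  choose! Q QF Qpos Qle Qr using h
  let q : ℕ → X := fun n => Nat.rec (Q 1) (fun _ y => Q (dist p y / 2)) n
  have q0 : q 0 = Q 1 := rfl
  have qs : ∀ n, q (n + 1) = Q (dist p (q n) / 2) := fun n => rfl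
  have qpos : ∀ n, 0 < dist p (q n) := by
    intro n
    induction n with
    | zero => exact Qpos 1 one_pos
    | succ n ih => rw [qs]; exact Qpos _ (by positivity)
  have qF : ∀ n, q n ∈ F ∧ ∀ r ∈ F, dist p r ^ 2 ≤ dist p (q n) ^ 2 + dist (q n) r ^ 2 := by
    intro n
    cases n with
    | zero => exact ⟨QF 1 one_pos, Qr 1 one_pos⟩
    | succ n =>
      have := qpos n
      rw [qs]; exact ⟨QF _ (by positivity), Qr _ (by positivity)⟩
  have qstep : ∀ n, dist p (q (n + 1)) ≤ dist p (q n) / 2 := by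
    intro n
    have := qpos n
    rw [qs]; exact Qle _ (by positivity)
  have qanti : Antitone (fun n => dist p (q n)) :=
    antitone_nat_of_succ_le fun n => by
      have := qstep n; have := qpos n
      show dist p (q (n+1)) ≤ dist p (q n)
      linarith
  have qlt : ∀ i j, i < j → dist p (q j) ≤ dist p (q i) / 2 := by
    intro i j hij
    exact (qanti (Nat.succ_le_of_lt hij)).trans (qstep i)
  refine ⟨dist p (q N), qpos N, ?_⟩
  set ρ := dist p (q N) with hρ
  have hρ0 : 0 < ρ := qpos N
  have hj : ∀ i : Fin N, ∃ j : ℕ, ρ ≤ dist p (q i) / 2 ^ j ∧ dist p (q i) / 2 ^ j ≤ 2 * ρ := by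
    intro i
    have h1 : ρ ≤ dist p (q i) := qanti i.2.le
    obtain ⟨j, hj1, hj2⟩ := exists_nat_pow_near (x := dist p (q i) / ρ) (y := (2 : ℝ))
      ((one_le_div hρ0).2 h1) (by norm_num)
    refine ⟨j, ?_, ?_⟩
    · rw [le_div_iff₀ hρ0] at hj1
      rw [le_div_iff₀ (by positivity)]; linarith
    · rw [div_lt_iff₀ hρ0, pow_succ] at hj2
      rw [div_le_iff₀ (by positivity)]; linarith
  choose J hJ1 hJ2 using hj
  have main : ∀ i j : Fin N, i < j →
      ρ ≤ dist (c (J i) p (q i)) (c (J j) p (q j)) := by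
    intro i j hij
    have h1 := c3 (J i) p (q i) (c (J j) p (q j))
    have h2 := c3 (J j) p (q j) (q i)
    rw [mip_comm p _ (q i), mip_comm p (q j)] at h2
    have h3 : mip p (q i) (q j) ≤ dist p (q j) ^ 2 := by
      have := (qF j).2 (q i) (qF i).1
      unfold mip
      rw [dist_comm (q i)]; linarith
    have h4 : dist p (q j) ^ 2 ≤ dist p (q i) * dist p (q j) / 2 := by
      have := qlt i j hij
      have := qpos j
      nlinarith
    have h5 : mip p (c (J i) p (q i)) (c (J j) p (q j)) ≤
        (dist p (q i) / 2 ^ J i) * (dist p (q j) / 2 ^ J j) / 2 := by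
      calc _ ≤ _ := h1
        _ ≤ mip p (q i) (q j) / 2 ^ J j / 2 ^ J i := by gcongr
        _ ≤ (dist p (q i) * dist p (q j) / 2) / 2 ^ J j / 2 ^ J i := by
          gcongr; exact h3.trans h4
        _ = _ := by field_simp
    unfold mip at h5
    rw [c1, c1] at h5
    have a1 := hJ1 i
    have a2 := hJ1 j
    set a := dist p (q i) / 2 ^ J i
    set b := dist p (q j) / 2 ^ J j
    apply le_of_sq_le_sq _ dist_nonneg
    nlinarith [sq_nonneg (a - b)]
  refine ⟨fun i => c (J i) p (q i), ?_, ?_⟩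
  · intro i
    rw [c1]; exact hJ2 i
  · intro i j hij
    rcases lt_or_gt_of_ne hij with h | h
    · exact main i j h
    · rw [dist_comm]; exact main j i h

lemma dimH_ge_of_packing {X : Type*} [MetricSpace X] [CompactSpace X] (hgeo : GeodesicSpace X)
    (hcurv : CurvCompGE0 X) {p : X} {m : ℕ} (hm : 0 < m) {ρ : ℝ} (hρ : 0 < ρ)
    (P : Fin (16 ^ m) → X) (hP : ∀ i, dist p (P i) ≤ 2 * ρ)
    (hsep : ∀ i j, i ≠ j → ρ ≤ dist (P i) (P j)) :
    (m : ENNReal) ≤ dimH (Set.univ : Set X) := by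
  obtain ⟨c, c1, c2, c3, c4⟩ := exists_contraction hgeo hcurv
  let z : (ℕ → Fin (16 ^ m)) → ℕ → X := fun ω n =>
    Nat.rec p (fun k y => c (4 * (k + 1)) y (P (ω k))) n
  have z0 : ∀ ω, z ω 0 = p := fun _ => rfl
  have zs : ∀ ω n, z ω (n + 1) = c (4 * (n + 1)) (z ω n) (P (ω n)) := fun _ _ => rfl
  have e16 : ∀ n : ℕ, (2 : ℝ) ^ (4 * n) = 16 ^ n := by
    intro n; rw [pow_mul]; norm_num
  have hstep0 : ∀ ω n, dist (z ω n) (z ω (n + 1)) = dist (z ω n) (P (ω n)) / 16 ^ (n + 1) := by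
    intro ω n
    rw [zs, c1, e16]
  have hbd : ∀ ω n, dist p (z ω n) ≤ ρ * (1 - (1 / 16) ^ n) ∧
      dist (z ω n) (z ω (n + 1)) ≤ (3 * ρ / 16) * (1 / 16) ^ n := by
    intro ω n
    have aux : ∀ n, dist p (z ω n) ≤ ρ * (1 - (1 / 16) ^ n) →
      dist (z ω n) (z ω (n + 1)) ≤ (3 * ρ / 16) * (1 / 16) ^ n := by
      intro n h
      rw [hstep0]
      have h1 : dist (z ω n) (P (ω n)) ≤ 3 * ρ := by
        have := dist_triangle_left (z ω n) (P (ω n)) p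
        have := hP (ω n)
        have : 0 ≤ ρ * (1 / 16) ^ n := by positivity
        linarith
      calc _ ≤ 3 * ρ / 16 ^ (n + 1) := by gcongr
        _ = _ := by rw [pow_succ, one_div, inv_pow]; field_simp
    induction n with
    | zero => exact ⟨by simp [z0], aux 0 (by simp [z0])⟩
    | succ n ih =>
      have h1 : dist p (z ω (n + 1)) ≤ ρ * (1 - (1 / 16) ^ (n + 1)) := by
        have := dist_triangle p (z ω n) (z ω (n + 1))
        have : 0 ≤ ρ * (1 / 16) ^ n := by positivity
        rw [pow_succ]
        linarith [ih.1, ih.2]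
      exact ⟨h1, aux (n + 1) h1⟩
  have hlim : ∀ ω, ∃ g, Tendsto (z ω) atTop (𝓝 g) := fun ω =>
    cauchySeq_tendsto_of_complete
      (cauchySeq_of_le_geometric _ _ (by norm_num) fun n => (hbd ω n).2)
  choose G hG using hlim
  have hGd : ∀ ω n, dist (z ω n) (G ω) ≤ ρ / 5 * (1 / 16) ^ n := by
    intro ω n
    have := dist_le_of_le_geometric_of_tendsto _ _ (by norm_num) (fun n => (hbd ω n).2) (hG ω) n
    refine this.trans (le_of_eq ?_)
    norm_num; ring
  have hsame : ∀ ω ω' n, (∀ i < n, ω i = ω' i) → z ω n = z ω' n := by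
    intro ω ω' n
    induction n with
    | zero => intro _; rfl
    | succ n ih =>
      intro h
      rw [zs, zs, ih (fun i hi => h i (by omega)), h n (by omega)]
  -- Hölder estimate
  have hH : ∀ ω ω', |Real.ofDigits ω - Real.ofDigits ω'| ≤
      (80 / (3 * ρ)) ^ m * dist (G ω) (G ω') ^ m := by
    intro ω ω'
    by_cases heq : ω = ω'
    · subst heq; simp [hm.ne']
    have hex : ∃ n, ω n ≠ ω' n := Function.ne_iff.1 heq
    classical
    let n := Nat.find hex
    have hn : ω n ≠ ω' n := Nat.find_spec hex
    have hlt : ∀ i < n, ω i = ω' i := fun i hi => not_not.1 (Nat.find_min hex hi)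
    have h1 := Real.abs_ofDigits_sub_ofDigits_le hlt
    have h2 : ρ * (1 / 16) ^ (n + 1) ≤ dist (z ω (n + 1)) (z ω' (n + 1)) := by
      rw [zs, zs, hsame ω ω' n hlt]
      refine le_trans ?_ (contraction_expand c1 c3 _ _ _ _)
      rw [e16, one_div, inv_pow, ← div_eq_mul_inv]
      have := hsep _ _ hn
      gcongr
    have h3 := hGd ω (n + 1)
    have h4 := hGd ω' (n + 1)
    have h5 : 3 * ρ / 80 * (1 / 16) ^ n ≤ dist (G ω) (G ω') := by
      have := dist_triangle4 (z ω (n + 1)) (G ω) (G ω') (z ω' (n + 1))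
      rw [dist_comm (G ω') (z ω' (n + 1))] at this
      rw [pow_succ] at *
      linarith
    refine h1.trans ?_
    rw [← mul_pow]
    have h6 : (1 / 16 : ℝ) ^ n ≤ 80 / (3 * ρ) * dist (G ω) (G ω') := by
      calc (1 / 16 : ℝ) ^ n = 80 / (3 * ρ) * (3 * ρ / 80 * (1 / 16) ^ n) := by field_simp
        _ ≤ _ := by gcongr
    calc (((16 ^ m : ℕ) : ℝ) ^ n)⁻¹ = ((1 / 16 : ℝ) ^ n) ^ m := by
          push_cast
          rw [one_div, inv_pow, inv_pow, ← pow_mul, ← pow_mul, mul_comm]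
      _ ≤ _ := by gcongr
  have hb : 1 < 16 ^ m := Nat.one_lt_pow hm.ne' (by norm_num)
  have : Nonempty (ℕ → Fin (16 ^ m)) := ⟨fun _ => ⟨0, by omega⟩⟩
  let f : X → ℝ := fun x => Real.ofDigits (Function.invFun G x)
  have hfG : ∀ ω, f (G ω) = Real.ofDigits ω := by
    intro ω
    have h1 : G (Function.invFun G (G ω)) = G ω := Function.invFun_eq ⟨ω, rfl⟩
    have := hH (Function.invFun G (G ω)) ω
    rw [h1, dist_self, zero_pow hm.ne', mul_zero] at this
    exact sub_eq_zero.1 (abs_nonpos_iff.1 this)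
  have hC : (0 : ℝ) ≤ (80 / (3 * ρ)) ^ m := by positivity
  have hold : HolderOnWith (Real.toNNReal ((80 / (3 * ρ)) ^ m)) (m : NNReal) f (Set.range G) := by
    rintro _ ⟨ω, rfl⟩ _ ⟨ω', rfl⟩
    rw [hfG, hfG, edist_dist, edist_dist, Real.dist_eq]
    have := hH ω ω'
    rw [NNReal.coe_natCast, ENNReal.rpow_natCast, ← ENNReal.ofReal_pow dist_nonneg]
    change _ ≤ ENNReal.ofReal _ * _
    rw [← ENNReal.ofReal_mul (by exact hC)]
    exact ENNReal.ofReal_le_ofReal this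
  have hdim := hold.dimH_image_le (by exact_mod_cast hm)
  have himg : Set.Icc (0 : ℝ) 1 ⊆ f '' Set.range G := by
    intro y hy
    obtain ⟨ω, -, hω⟩ := Real.ofDigits_SurjOn hb hy
    exact ⟨G ω, ⟨ω, rfl⟩, by rw [hfG, hω]⟩
  have h1 : dimH (Set.Icc (0 : ℝ) 1) = 1 := by
    rw [Real.dimH_of_nonempty_interior]
    · simp
    · rw [interior_Icc]; exact ⟨1 / 2, by norm_num, by norm_num⟩
  have h2 : (1 : ENNReal) ≤ dimH (Set.range G) / m := by
    rw [← h1]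
    exact (dimH_mono himg).trans (by simpa using hdim)
  have h3 : (m : ENNReal) ≤ dimH (Set.range G) := by
    rw [ENNReal.le_div_iff_mul_le (Or.inl (by exact_mod_cast hm.ne'))
      (Or.inl (ENNReal.natCast_ne_top m)), one_mul] at h2
    exact h2
  exact h3.trans (dimH_mono (Set.subset_univ _))

/-- A nonempty quasi-convex subset of a compact finite-dimensional geodesic space of
curvature `≥ 0` has only finitely many connected components. -/
theorem quasiConvex_finitely_many_components {X : Type*} [MetricSpace X] [CompactSpace X]
    (hdim : dimH (Set.univ : Set X) < ⊤)
    (hgeo : GeodesicSpace X) (hcurv : CurvCompGE0 X)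
    (F : Set X) (hne : F.Nonempty) (hqc : IsQuasiConvex F) :
    (connectedComponentIn F '' F).Finite := by
  have hloc : ∀ p ∈ F, ∃ ε > 0, ∀ x ∈ F, dist p x < ε → x ∈ connectedComponentIn F p := by
    intro p hp
    by_contra hcon
    push Not at hcon
    obtain ⟨m, hm⟩ := ENNReal.exists_nat_gt hdim.ne
    have hm0 : 0 < m := by
      rcases Nat.eq_zero_or_pos m with h | h
      · subst h; simp at hm
      · exact h
    obtain ⟨ρ, hρ, P, hP, hs⟩ := exists_packing hgeo hcurv (F := F) (p := p) (by
      intro ε hε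
      obtain ⟨x, hx, hxε, hxc⟩ := hcon ε hε
      obtain ⟨q, hq, hq1, hq2, hq3⟩ := exists_nearest hgeo hcurv hqc hp hx hxc
      exact ⟨q, hq, hq1, hq2.trans hxε.le, hq3⟩) (16 ^ m)
    exact absurd (dimH_ge_of_packing hgeo hcurv hm0 hρ P hP hs) (not_le.2 hm)
  choose! ε hε hεc using hloc
  obtain ⟨t, htF, ht⟩ := hqc.1.isCompact.elim_nhds_subcover (fun p => ball p (ε p))
    (fun p hp => ball_mem_nhds p (hε p hp))
  refine (t.finite_toSet.image (connectedComponentIn F)).subset ?_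
  rintro _ ⟨x, hx, rfl⟩
  obtain ⟨p, hpt, hxp⟩ := Set.mem_iUnion₂.1 (ht hx)
  refine ⟨p, hpt, ?_⟩
  exact connectedComponentIn_eq (hεc p (htF p hpt) x hx (by rw [dist_comm]; exact hxp))
end

section
/- Let X be a compact geodesic metric space of finite Hausdorff dimension whose metric has curvature ≥ 0 in the comparison sense. Then there exists ε > 0, depending only on X, such that for every quasi-convex subset F of X and any two distinct connected components F₁ and F₂ of F, the infimum distance between F₁ and F₂ is at least ε². -/
open Metric

/-- `z` lies between `x` and `y` at ratio `τ`. -/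
def BtwPt {X : Type*} [MetricSpace X] (x z y : X) (τ : ℝ) : Prop :=
  dist x z = τ * dist x y ∧ dist z y = (1 - τ) * dist x y

theorem cos_arg_mem {a b c : ℝ} (ha : 0 < a) (hb : 0 < b) 
    (h1 : c ≤ a + b) (h2 : a ≤ b + c) (h3 : b ≤ a + c) :
    (a ^ 2 + b ^ 2 - c ^ 2) / (2 * a * b) ∈ Set.Icc (-1 : ℝ) 1 := by
  have hc : 0 ≤ c := by linarith
  have hab : 0 < 2 * a * b := by positivity
  constructor
  · rw [le_div_iff₀ hab]; nlinarith
  · rw [div_le_iff₀ hab]; nlinarith [mul_nonneg (sub_nonneg.2 h2) (sub_nonneg.2 h3)]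

theorem stewart {X : Type*} [MetricSpace X] (hcurv : CurvCompGE0 X) {x z y : X} {τ : ℝ}
    (h0 : 0 ≤ τ) (h1 : τ ≤ 1) (hb : BtwPt x z y τ) (p : X) :
    (1 - τ) * dist p x ^ 2 + τ * dist p y ^ 2 - τ * (1 - τ) * dist x y ^ 2 ≤ dist p z ^ 2 := by
  obtain ⟨hx, hy⟩ := hb
  by_cases hzx : x = z
  · subst hzx
    rw [dist_self] at hx
    rcases mul_eq_zero.1 hx.symm with h | h
    · subst h; simp
    · rw [dist_eq_zero] at h; subst h; simp; nlinarith
  by_cases hzy : y = z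
  · subst hzy
    rw [dist_self] at hy
    rcases mul_eq_zero.1 hy.symm with h | h
    · have : τ = 1 := by linarith
      subst this; simp
    · rw [dist_eq_zero] at h; subst h; simp; nlinarith
  by_cases hzp : p = z
  · subst hzp
    rw [dist_comm p x, hx, hy, dist_self]
    apply le_of_eq; ring
  have hdx : 0 < dist x z := dist_pos.2 hzx
  have hdy : 0 < dist z y := dist_pos.2 (Ne.symm hzy)
  have hdp : 0 < dist z p := dist_pos.2 (Ne.symm hzp)
  have hd : 0 < dist x y := by
    apply dist_pos.2; rintro rfl; rw [dist_self, mul_zero] at hx; linarith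
  have ht0 : 0 < τ := by
    rcases h0.lt_or_eq with h | h
    · exact h
    · rw [← h, zero_mul] at hx; linarith
  have ht1 : 0 < 1 - τ := by
    by_contra hcon
    have : τ = 1 := by linarith
    rw [this] at hy; simp at hy; exact hzy hy.symm
  have key := hcurv z x y p hzx hzy hzp
  have hpi : compAngle₀ x z y = Real.pi := by
    unfold compAngle₀
    rw [← Real.arccos_neg_one]
    congr 1
    rw [dist_comm z x, hx, hy]
    field_simp
    ring
  rw [hpi] at key
  unfold compAngle₀ at key
  set α := (dist z y ^ 2 + dist z p ^ 2 - dist y p ^ 2) / (2 * dist z y * dist z p) with hα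
  set β := (dist z p ^ 2 + dist z x ^ 2 - dist p x ^ 2) / (2 * dist z p * dist z x) with hβ
  have hαm : α ∈ Set.Icc (-1 : ℝ) 1 := by
    apply cos_arg_mem hdy hdp
    · rw [dist_comm z y]; exact dist_triangle _ _ _
    · rw [dist_comm y p]; exact dist_triangle _ _ _
    · exact dist_triangle _ _ _
  have hβm : β ∈ Set.Icc (-1 : ℝ) 1 := by
    apply cos_arg_mem hdp (by rw [dist_comm]; exact hdx)
    · rw [dist_comm z p]; exact dist_triangle _ _ _
    · rw [dist_comm p x]; exact dist_triangle _ _ _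
    · exact dist_triangle _ _ _
  have hle : Real.arccos α ≤ Real.arccos (-β) := by
    rw [Real.arccos_neg]; linarith
  have hab : -β ≤ α := by
    have hβm' : -β ∈ Set.Icc (-1 : ℝ) 1 := ⟨by linarith [hβm.2], by linarith [hβm.1]⟩
    exact (Real.strictAntiOn_arccos.le_iff_ge hαm hβm').1 hle
  have e1 : α * (2 * dist z y * dist z p) = dist z y ^ 2 + dist z p ^ 2 - dist y p ^ 2 := by
    rw [hα]; field_simp
  have hdx' : 0 < dist z x := by rw [dist_comm]; exact hdx
  have e2 : β * (2 * dist z p * dist z x) = dist z p ^ 2 + dist z x ^ 2 - dist p x ^ 2 := by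
    rw [hβ]; field_simp
  rw [dist_comm z x] at e2
  rw [hx] at e2
  rw [hy] at e1
  have hm : 0 ≤ (α + β) * (2 * τ * (1 - τ) * dist x y * dist z p) := by
    apply mul_nonneg (by linarith); positivity
  rw [dist_comm p z, dist_comm p y]
  nlinarith

theorem btw_dyadic {X : Type*} [MetricSpace X] (hgeo : GeodesicSpace X) (k : ℕ) :
    ∀ (x y : X) (j : ℕ), j ≤ 2 ^ k → ∃ z, BtwPt x z y ((j : ℝ) / 2 ^ k) := by
  induction k with
  | zero =>
    intro x y j hj
    interval_cases j
    · exact ⟨x, by simp [BtwPt]⟩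
    · exact ⟨y, by simp [BtwPt]⟩
  | succ k ih =>
    intro x y j hj
    obtain ⟨m, hm1, hm2⟩ := hgeo x y
    have hpk : (0 : ℝ) < 2 ^ k := by positivity
    by_cases hjk : j ≤ 2 ^ k
    · obtain ⟨z, hz1, hz2⟩ := ih x m j hjk
      rw [hm1] at hz1 hz2
      have e1 : dist x z = (j : ℝ) / 2 ^ (k + 1) * dist x y := by rw [hz1, pow_succ]; field_simp
      have e2 : dist z y ≤ (1 - (j : ℝ) / 2 ^ (k + 1)) * dist x y := by
        calc dist z y ≤ dist z m + dist m y := dist_triangle _ _ _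
          _ = _ := by rw [hz2, hm2, pow_succ]; field_simp; ring
      refine ⟨z, e1, le_antisymm e2 ?_⟩
      linarith [dist_triangle x z y]
    · push Not at hjk
      obtain ⟨i, rfl⟩ := Nat.exists_eq_add_of_le hjk.le
      have hi : i ≤ 2 ^ k := by rw [pow_succ] at hj; omega
      obtain ⟨z, hz1, hz2⟩ := ih m y i hi
      rw [hm2] at hz1 hz2
      have e2 : dist z y = (1 - ((2 ^ k + i : ℕ) : ℝ) / 2 ^ (k + 1)) * dist x y := by
        rw [hz2, pow_succ]; push_cast; field_simp; ring
      have e1 : dist x z ≤ (((2 ^ k + i : ℕ) : ℝ) / 2 ^ (k + 1)) * dist x y := by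
        calc dist x z ≤ dist x m + dist m z := dist_triangle _ _ _
          _ = _ := by rw [hz1, hm1, pow_succ]; push_cast; field_simp
      refine ⟨z, le_antisymm e1 ?_, e2⟩
      linarith [dist_triangle x z y]

theorem exists_btw {X : Type*} [MetricSpace X] [CompactSpace X] (hgeo : GeodesicSpace X)
    (x y : X) {τ : ℝ} (h0 : 0 ≤ τ) (h1 : τ ≤ 1) : ∃ z, BtwPt x z y τ := by
  have hz : ∀ k : ℕ, ∃ z, BtwPt x z y ((⌊τ * 2 ^ k⌋₊ : ℝ) / 2 ^ k) := by
    intro k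
    apply btw_dyadic hgeo
    apply Nat.floor_le_of_le
    push_cast
    have : (0 : ℝ) < 2 ^ k := by positivity
    nlinarith
  choose z hz using hz
  have hlim : Filter.Tendsto (fun k : ℕ => (⌊τ * 2 ^ k⌋₊ : ℝ) / 2 ^ k) Filter.atTop (nhds τ) :=
    (tendsto_nat_floor_mul_div_atTop h0).comp (tendsto_pow_atTop_atTop_of_one_lt one_lt_two)
  obtain ⟨w, -, φ, hφ, hw⟩ := isCompact_univ.tendsto_subseq (x := z) (fun _ => Set.mem_univ _)
  have hl := hlim.comp hφ.tendsto_atTop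
  refine ⟨w, ?_, ?_⟩
  · refine tendsto_nhds_unique (tendsto_const_nhds.dist hw) ?_
    refine (hl.mul_const (dist x y)).congr ?_
    intro n; exact (hz (φ n)).1.symm
  · refine tendsto_nhds_unique (hw.dist tendsto_const_nhds) ?_
    refine ((hl.const_sub 1).mul_const (dist x y)).congr ?_
    intro n; exact (hz (φ n)).2.symm

theorem contract {X : Type*} [MetricSpace X] (hcurv : CurvCompGE0 X) {y u v u' v' : X} {τ : ℝ}
    (h0 : 0 ≤ τ) (h1 : τ ≤ 1) (hu : BtwPt y u' u τ) (hv : BtwPt y v' v τ) :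
    τ * dist u v ≤ dist u' v' := by
  have a1 := stewart hcurv h0 h1 hv u'
  have a2 := stewart hcurv h0 h1 hu v
  rw [dist_comm u' y, hu.1, dist_comm u' v] at a1
  rw [dist_comm v y, dist_comm v u] at a2
  apply le_of_sq_le_sq _ dist_nonneg
  nlinarith [mul_le_mul_of_nonneg_left a2 h0]

theorem bad_upper {X : Type*} [MetricSpace X] [CompactSpace X]
    (hgeo : GeodesicSpace X) (hcurv : CurvCompGE0 X) {F A B : Set X} (hF : IsQuasiConvex F)
    (hAB : F = A ∪ B) {a b : X} (ha : a ∈ A) (hb : b ∈ B) (hpos : 0 < dist a b)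
    (hmin : ∀ x ∈ A, ∀ y ∈ B, dist a b ≤ dist x y) (u : X) (hu : dist a u < dist a b / 2) :
    dist b u ^ 2 ≤ dist a b ^ 2 + 5 * dist a u ^ 2 := by
  have haF : a ∈ F := by rw [hAB]; exact Or.inl ha
  have hbF : b ∈ F := by rw [hAB]; exact Or.inr hb
  have hne : F.Nonempty := ⟨a, haF⟩
  obtain ⟨hFc, hq⟩ := hF
  obtain ⟨m, hm1, hm2⟩ := hgeo a b
  have hmle : ∀ f ∈ F, dist a b / 2 ≤ dist m f := by
    intro f hf
    rw [hAB] at hf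
    rcases hf with hf | hf
    · have h1 := hmin f hf b hb
      have h2 := dist_triangle f m b
      rw [dist_comm f m] at h2
      linarith
    · have h1 := hmin a ha f hf
      have h2 := dist_triangle a m f
      linarith
  have hmF : m ∉ F := fun h => by
    have := hmle m h
    rw [dist_self] at this; linarith
  have hma : dist m a = dist a b / 2 := by rw [dist_comm]; exact hm1
  have hinf : dist m a = infDist m F := by
    apply le_antisymm
    · rw [hma]; exact (le_infDist hne).2 (fun {y} hy => hmle y hy)
    · exact infDist_le_dist_of_mem haF
  have hm := hq m a hmF haF hinf
  -- the perpendicularity estimate for points of `F`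
  have hperp : ∀ f ∈ F, dist b f ^ 2 ≤ dist a b ^ 2 + dist a f ^ 2 := by
    intro f hf
    have h1 := hm f hf
    have h2 := stewart hcurv (x := a) (z := m) (y := b) (τ := 1 / 2) (by norm_num) (by norm_num)
      ⟨by rw [hm1]; ring, by rw [hm2]; ring⟩ f
    rw [hma] at h1
    rw [dist_comm f a, dist_comm f b, dist_comm f m] at h2
    nlinarith
  by_cases huF : u ∈ F
  · have := hperp u huF
    nlinarith [sq_nonneg (dist a u)]
  · obtain ⟨c, hcF, hc⟩ := hFc.exists_infDist_eq_dist hne u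
    have h1 := hq u c huF hcF hc.symm b hbF
    have h2 := hperp c hcF
    have h3 : dist u c ≤ dist a u := by
      rw [← hc, dist_comm a u]; exact infDist_le_dist_of_mem haF
    have h4 : dist a c ≤ 2 * dist a u := by linarith [dist_triangle a u c]
    rw [dist_comm u b, dist_comm c b] at h1
    have h5 : dist u c ^ 2 ≤ dist a u ^ 2 := pow_le_pow_left₀ dist_nonneg h3 2
    have h6 : dist a c ^ 2 ≤ (2 * dist a u) ^ 2 := pow_le_pow_left₀ dist_nonneg h4 2
    nlinarith

theorem bad_global {X : Type*} [MetricSpace X] [CompactSpace X]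
    (hgeo : GeodesicSpace X) (hcurv : CurvCompGE0 X) {a b : X} (hpos : 0 < dist a b)
    (h : ∀ u, dist a u < dist a b / 2 → dist b u ^ 2 ≤ dist a b ^ 2 + 5 * dist a u ^ 2) (q : X) :
    dist b q ^ 2 ≤ dist a b ^ 2 + dist a q ^ 2 := by
  by_contra hcon
  push Not at hcon
  set E := dist b q ^ 2 - (dist a b ^ 2 + dist a q ^ 2) with hE
  have hEpos : 0 < E := by linarith
  set L := dist a q with hL
  have hL0 : 0 ≤ L := dist_nonneg
  obtain ⟨τ, ht0, ht1, ht2, ht3⟩ : ∃ τ : ℝ, 0 < τ ∧ τ ≤ 1 ∧ τ * L < dist a b / 2 ∧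
      4 * τ * L ^ 2 < E := by
    refine ⟨min 1 (min (dist a b / (4 * (L + 1))) (E / (8 * (L ^ 2 + 1)))), by positivity,
      min_le_left _ _, ?_, ?_⟩
    · have : min 1 (min (dist a b / (4 * (L + 1))) (E / (8 * (L ^ 2 + 1)))) ≤
        dist a b / (4 * (L + 1)) := (min_le_right _ _).trans (min_le_left _ _)
      have h2 := mul_le_mul_of_nonneg_right this (by positivity : 0 ≤ L + 1)
      have h3 : dist a b / (4 * (L + 1)) * (L + 1) = dist a b / 4 := by field_simp
      have : 0 < min 1 (min (dist a b / (4 * (L + 1))) (E / (8 * (L ^ 2 + 1)))) := by positivity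
      nlinarith
    · have : min 1 (min (dist a b / (4 * (L + 1))) (E / (8 * (L ^ 2 + 1)))) ≤
        E / (8 * (L ^ 2 + 1)) := (min_le_right _ _).trans (min_le_right _ _)
      have h2 := mul_le_mul_of_nonneg_right this (by positivity : 0 ≤ L ^ 2 + 1)
      have h3 : E / (8 * (L ^ 2 + 1)) * (L ^ 2 + 1) = E / 8 := by field_simp
      have : 0 < min 1 (min (dist a b / (4 * (L + 1))) (E / (8 * (L ^ 2 + 1)))) := by positivity
      nlinarith
  obtain ⟨u, hu⟩ := exists_btw hgeo a q ht0.le ht1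
  have h1 := h u (by rw [hu.1]; exact ht2)
  have h2 := stewart hcurv ht0.le ht1 hu b
  rw [hu.1] at h1
  rw [dist_comm b a, ← hL] at h2
  rw [← hL] at h1
  have h3 : τ * E ≤ 4 * τ ^ 2 * L ^ 2 := by
    rw [hE]; nlinarith
  have h4 : τ * (4 * τ * L ^ 2) < τ * E := mul_lt_mul_of_pos_left ht3 ht0
  nlinarith

/-- A pair of points which almost all of `X` sees at a right angle. -/
structure BadPair {X : Type*} [MetricSpace X] (a b : X) : Prop where
  pos : 0 < dist a b
  upper : ∀ u, dist a u < dist a b / 2 → dist b u ^ 2 ≤ dist a b ^ 2 + 5 * dist a u ^ 2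
  glob : ∀ q, dist a q ^ 2 ≤ dist a b ^ 2 + dist b q ^ 2

theorem exists_badPair {X : Type*} [MetricSpace X] [CompactSpace X]
    (hgeo : GeodesicSpace X) (hcurv : CurvCompGE0 X) {F : Set X} (hF : IsQuasiConvex F)
    {p q : X} (hp : p ∈ F) (hq : q ∈ F)
    (hne : connectedComponentIn F p ≠ connectedComponentIn F q) {x y : X}
    (hx : x ∈ connectedComponentIn F p) (hy : y ∈ connectedComponentIn F q) :
    ∃ a b : X, BadPair a b ∧ dist a b ≤ dist x y := by
  have hxF : x ∈ F := connectedComponentIn_subset _ _ hx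
  have hyF : y ∈ F := connectedComponentIn_subset _ _ hy
  rw [connectedComponentIn_eq hx, connectedComponentIn_eq hy] at hne
  have hFc : IsCompact F := hF.1.isCompact
  have : CompactSpace F := isCompact_iff_compactSpace.1 hFc
  have hnot : (⟨y, hyF⟩ : F) ∉ connectedComponent (⟨x, hxF⟩ : F) := by
    intro hmem
    apply hne
    rw [connectedComponentIn_eq_image hxF, connectedComponentIn_eq_image hyF,
      connectedComponent_eq hmem]
  rw [connectedComponent_eq_iInter_isClopen, Set.mem_iInter] at hnot
  push Not at hnot
  obtain ⟨⟨Z, hZ, hxZ⟩, hyZ⟩ := hnot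
  set A : Set X := (↑) '' Z with hA
  set B : Set X := (↑) '' Zᶜ with hB
  have hAc : IsCompact A := hZ.1.isCompact.image continuous_subtype_val
  have hBc : IsCompact B := hZ.compl.1.isCompact.image continuous_subtype_val
  have hAB : F = A ∪ B := by
    rw [hA, hB, ← Set.image_union, Set.union_compl_self, Set.image_univ, Subtype.range_coe]
  have hxA : x ∈ A := ⟨⟨x, hxF⟩, hxZ, rfl⟩
  have hyB : y ∈ B := ⟨⟨y, hyF⟩, hyZ, rfl⟩
  obtain ⟨⟨a, b⟩, ⟨ha, hb⟩, hmin⟩ := (hAc.prod hBc).exists_isMinOn ⟨(x, y), hxA, hyB⟩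
    (continuous_dist.continuousOn (s := A ×ˢ B))
  have hmin' : ∀ x ∈ A, ∀ y ∈ B, dist a b ≤ dist x y := fun x hx y hy =>
    hmin (show (x, y) ∈ A ×ˢ B from ⟨hx, hy⟩)
  simp only at ha hb
  have hpos : 0 < dist a b := by
    apply dist_pos.2
    rintro rfl
    obtain ⟨z, hz, hza⟩ := ha
    obtain ⟨w, hw, hwa⟩ := hb
    have : z = w := Subtype.ext (hza.trans hwa.symm)
    subst this
    exact hw hz
  refine ⟨a, b, ⟨hpos, bad_upper hgeo hcurv hF hAB ha hb hpos hmin', ?_⟩, hmin' x hxA y hyB⟩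
  have hpos' : 0 < dist b a := by rw [dist_comm]; exact hpos
  have := bad_global hgeo hcurv hpos' (bad_upper hgeo hcurv hF (hAB.trans (Set.union_comm _ _))
    hb ha hpos' (fun x hx y hy => by rw [dist_comm b a, dist_comm x y]; exact hmin' y hy x hx))
  intro q
  rw [dist_comm a b]
  exact this q

/-- `M` points in the ball of radius `R` around `a`, pairwise at distance at least `σ`. -/
structure Config {X : Type*} [MetricSpace X] (M : ℕ) (a : X) (R σ : ℝ) (p : Fin M → X) : Prop where
  sigma_pos : 0 < σ
  sigma_le : σ ≤ R
  near : ∀ i, dist a (p i) ≤ R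
  sep : ∀ i j, i ≠ j → σ ≤ dist (p i) (p j)

theorem exists_levels {X : Type*} [MetricSpace X] [CompactSpace X]
    (hgeo : GeodesicSpace X) (hcurv : CurvCompGE0 X) {M : ℕ} {a : X} {R σ : ℝ} {p : Fin M → X}
    (hc : Config M a R σ p) :
    ∃ lev : ℕ → (ℕ → Fin M) → X,
      ∀ k j (ω ω' : ℕ → Fin M), j < k → (∀ i < j, ω i = ω' i) → ω j ≠ ω' j →
        (σ / (12 * R)) ^ j * (σ / 2) ≤ dist (lev k ω) (lev k ω') := by
  have hσ := hc.sigma_pos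
  have hR : 0 < R := hσ.trans_le hc.sigma_le
  set θ := σ / (12 * R) with hθ
  have hθ0 : 0 ≤ θ := by positivity
  have hθ1 : θ ≤ 1 := by
    rw [hθ, div_le_one (by positivity)]; linarith [hc.sigma_le]
  have hθR : θ * (3 * R) = σ / 4 := by rw [hθ]; field_simp; norm_num
  have hf : ∀ (i : Fin M) (x : X), ∃ z, BtwPt (p i) z x θ := fun i x =>
    exists_btw hgeo (p i) x hθ0 hθ1
  choose f hf using hf
  let lev : ℕ → (ℕ → Fin M) → X := fun k => Nat.rec (fun _ => a)
    (fun _ g ω => f (ω 0) (g (fun n => ω (n + 1)))) k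
  have hsucc : ∀ k ω, lev (k + 1) ω = f (ω 0) (lev k (fun n => ω (n + 1))) := fun k ω => rfl
  have hnear : ∀ i x, dist a x ≤ 2 * R → dist (p i) (f i x) ≤ σ / 4 := by
    intro i x hx
    rw [(hf i x).1, ← hθR]
    apply mul_le_mul_of_nonneg_left _ hθ0
    have := dist_triangle (p i) a x
    rw [dist_comm (p i) a] at this
    linarith [hc.near i]
  have hball : ∀ k ω, dist a (lev k ω) ≤ 2 * R := by
    intro k
    induction k with
    | zero => intro ω; change dist a a ≤ _; rw [dist_self]; positivity
    | succ k ih =>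
      intro ω
      rw [hsucc]
      have h1 := hnear (ω 0) _ (ih (fun n => ω (n + 1)))
      have h2 := hc.near (ω 0)
      have h3 := dist_triangle a (p (ω 0)) (f (ω 0) (lev k (fun n => ω (n + 1))))
      linarith [hc.sigma_le]
  refine ⟨lev, ?_⟩
  intro k
  induction k with
  | zero => intro j ω ω' hj; omega
  | succ k ih =>
    intro j ω ω' hj heq hne
    rw [hsucc, hsucc]
    cases j with
    | zero =>
      have h1 := hnear (ω 0) _ (hball k (fun n => ω (n + 1)))
      have h2 := hnear (ω' 0) _ (hball k (fun n => ω' (n + 1)))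
      have h3 := hc.sep _ _ hne
      have h4 := dist_triangle4 (p (ω 0)) (f (ω 0) (lev k (fun n => ω (n + 1))))
        (f (ω' 0) (lev k (fun n => ω' (n + 1)))) (p (ω' 0))
      rw [dist_comm (f (ω' 0) _) (p (ω' 0))] at h4
      simp only [pow_zero, one_mul]
      linarith
    | succ j =>
      have h1 := ih j (fun n => ω (n + 1)) (fun n => ω' (n + 1)) (by omega)
        (fun i hi => heq (i + 1) (by omega)) hne
      rw [← heq 0 (by omega)]
      have h2 := contract hcurv hθ0 hθ1 (hf (ω 0) (lev k (fun n => ω (n + 1))))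
        (hf (ω 0) (lev k (fun n => ω' (n + 1))))
      refine le_trans ?_ h2
      rw [pow_succ, mul_comm (θ ^ j) θ, mul_assoc]
      exact mul_le_mul_of_nonneg_left h1 hθ0

/-- `X` contains `N` points pairwise at distance at least `s`. -/
def SepFam (X : Type*) [MetricSpace X] (N : ℕ) (s : ℝ) : Prop :=
  ∃ p : Fin N → X, ∀ i j, i ≠ j → s ≤ dist (p i) (p j)

theorem sepFam_pow {X : Type*} [MetricSpace X] [CompactSpace X]
    (hgeo : GeodesicSpace X) (hcurv : CurvCompGE0 X) {M : ℕ} {a : X} {R σ : ℝ} {p : Fin M → X}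
    (hM : 0 < M) (hc : Config M a R σ p) (k : ℕ) :
    SepFam X (M ^ k) ((σ / (12 * R)) ^ k * (σ / 2)) := by
  obtain ⟨lev, hlev⟩ := exists_levels hgeo hcurv hc
  have hσ := hc.sigma_pos
  have hR : 0 < R := hσ.trans_le hc.sigma_le
  have hθ0 : 0 ≤ σ / (12 * R) := by positivity
  have hθ1 : σ / (12 * R) ≤ 1 := by
    rw [div_le_one (by positivity)]; linarith [hc.sigma_le]
  have hcard : Fintype.card (Fin k → Fin M) = M ^ k := by simp
  let e := (Fintype.equivFinOfCardEq hcard).symm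
  let ext : (Fin k → Fin M) → ℕ → Fin M := fun w n => if h : n < k then w ⟨n, h⟩ else ⟨0, hM⟩
  refine ⟨fun i => lev k (ext (e i)), ?_⟩
  intro i j hij
  have hw : e i ≠ e j := fun h => hij (e.injective h)
  have hex : ∃ n, ext (e i) n ≠ ext (e j) n := by
    by_contra hcon
    push Not at hcon
    apply hw
    funext n
    have := hcon n
    simpa [ext, n.2] using this
  classical
  have h1 := Nat.find_spec hex
  have h2 : ∀ m < Nat.find hex, ext (e i) m = ext (e j) m := fun m hm => by
    have := Nat.find_min hex hm
    push Not at this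
    exact this
  have h3 : Nat.find hex < k := by
    by_contra hcon
    apply h1
    simp [ext, hcon]
  refine le_trans ?_ (hlev k _ _ _ h3 h2 h1)
  apply mul_le_mul_of_nonneg_right _ (by positivity)
  exact pow_le_pow_of_le_one hθ0 hθ1 h3.le

theorem le_dimH_of_config {X : Type*} [MetricSpace X] [CompactSpace X]
    (hgeo : GeodesicSpace X) (hcurv : CurvCompGE0 X) {M : ℕ} {a : X} {R σ : ℝ} {p : Fin M → X}
    (hM : 1 < M) (hc : Config M a R σ p) (r : ℕ) (hr : 0 < r)
    (hMr : (M : ℝ)⁻¹ ≤ (σ / (12 * R)) ^ r) :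
    (r : ENNReal) ≤ dimH (Set.univ : Set X) := by
  obtain ⟨lev, hlev⟩ := exists_levels hgeo hcurv hc
  have hσ := hc.sigma_pos
  have hR : 0 < R := hσ.trans_le hc.sigma_le
  set θ := σ / (12 * R) with hθ
  have hθ0 : 0 < θ := by positivity
  have hlim : ∀ ω, ∃ x : X, Filter.Tendsto (fun k => lev k ω)
      (Filter.hyperfilter ℕ : Filter ℕ) (nhds x) := by
    intro ω
    obtain ⟨x, -, hx⟩ := isCompact_univ.ultrafilter_le_nhds
      (Ultrafilter.map (fun k => lev k ω) (Filter.hyperfilter ℕ)) (by simp)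
    exact ⟨x, hx⟩
  choose x hx using hlim
  have hsep : ∀ j (ω ω' : ℕ → Fin M), (∀ i < j, ω i = ω' i) → ω j ≠ ω' j →
      θ ^ j * (σ / 2) ≤ dist (x ω) (x ω') := by
    intro j ω ω' h1 h2
    refine ge_of_tendsto ((hx ω).dist (hx ω')) ?_
    have : ∀ᶠ k in Filter.atTop, j < k := Filter.eventually_gt_atTop j
    rw [← Nat.cofinite_eq_atTop] at this
    filter_upwards [Filter.hyperfilter_le_cofinite this] with k hk
    exact hlev k j ω ω' hk h1 h2
  have hmain : ∀ ω ω', |Real.ofDigits ω - Real.ofDigits ω'| ≤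
      (2 / σ) ^ r * dist (x ω) (x ω') ^ r := by
    intro ω ω'
    by_cases hω : ω = ω'
    · subst hω; simp; positivity
    classical
    have hex : ∃ n, ω n ≠ ω' n := by
      by_contra hcon
      push Not at hcon
      exact hω (funext hcon)
    have h1 := Nat.find_spec hex
    have h2 : ∀ m < Nat.find hex, ω m = ω' m := fun m hm => by
      have := Nat.find_min hex hm
      push Not at this
      exact this
    set j := Nat.find hex
    have h3 := hsep j ω ω' h2 h1
    have h4 : θ ^ j ≤ 2 / σ * dist (x ω) (x ω') := by
      rw [div_mul_eq_mul_div, le_div_iff₀ hσ]; linarith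
    calc |Real.ofDigits ω - Real.ofDigits ω'| ≤ ((M : ℝ) ^ j)⁻¹ :=
          Real.abs_ofDigits_sub_ofDigits_le h2
      _ = ((M : ℝ)⁻¹) ^ j := by rw [inv_pow]
      _ ≤ (θ ^ r) ^ j := pow_le_pow_left₀ (by positivity) hMr j
      _ = (θ ^ j) ^ r := by rw [← pow_mul, ← pow_mul, mul_comm]
      _ ≤ (2 / σ * dist (x ω) (x ω')) ^ r := pow_le_pow_left₀ (by positivity) h4 r
      _ = _ := by rw [mul_pow]
  have hinj : Function.Injective x := by
    intro ω ω' h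
    by_contra hω
    classical
    have hex : ∃ n, ω n ≠ ω' n := by
      by_contra hcon
      push Not at hcon
      exact hω (funext hcon)
    have h1 := Nat.find_spec hex
    have h2 : ∀ m < Nat.find hex, ω m = ω' m := fun m hm => by
      have := Nat.find_min hex hm
      push Not at this
      exact this
    have h3 := hsep _ ω ω' h2 h1
    rw [h, dist_self] at h3
    have : 0 < θ ^ (Nat.find hex) * (σ / 2) := by positivity
    linarith
  have : Nonempty (ℕ → Fin M) := ⟨fun _ => ⟨0, by omega⟩⟩
  let f : X → ℝ := fun y => Real.ofDigits (Function.invFun x y)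
  have hfx : ∀ ω, f (x ω) = Real.ofDigits ω := fun ω => by
    simp only [f, Function.leftInverse_invFun hinj ω]
  have hhol : HolderOnWith (Real.toNNReal ((2 / σ) ^ r)) (r : NNReal) f (Set.range x) := by
    rintro _ ⟨ω, rfl⟩ _ ⟨ω', rfl⟩
    rw [hfx, hfx, edist_dist, edist_dist, Real.dist_eq, NNReal.coe_natCast, ENNReal.rpow_natCast,
      ← ENNReal.ofReal_pow dist_nonneg]
    change _ ≤ ENNReal.ofReal _ * _
    rw [← ENNReal.ofReal_mul (by positivity)]
    exact ENNReal.ofReal_le_ofReal (hmain ω ω')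
  have hdim := hhol.dimH_image_le (by exact_mod_cast hr)
  have hsub : Set.Icc (0 : ℝ) 1 ⊆ f '' Set.range x := by
    intro t ht
    obtain ⟨ω, -, hω⟩ := Real.ofDigits_SurjOn hM ht
    exact ⟨x ω, ⟨ω, rfl⟩, by rw [hfx, hω]⟩
  have h1 : (1 : ENNReal) = dimH (Set.Icc (0 : ℝ) 1) := by
    rw [Real.dimH_of_nonempty_interior (by rw [interior_Icc]; exact ⟨1 / 2, by norm_num, by norm_num⟩)]
    simp
  have h2 : (1 : ENNReal) ≤ dimH (Set.univ : Set X) / (r : ENNReal) := by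
    rw [h1]
    refine (dimH_mono hsub).trans (hdim.trans ?_)
    simp only [ENNReal.coe_natCast]
    exact ENNReal.div_le_div_right (dimH_mono (Set.subset_univ _)) _
  rwa [ENNReal.le_div_iff_mul_le (Or.inl (by exact_mod_cast hr.ne')) (Or.inl (ENNReal.natCast_ne_top r)),
    one_mul] at h2

set_option maxHeartbeats 800000 in
theorem stack {X : Type*} [MetricSpace X] [CompactSpace X]
    (hgeo : GeodesicSpace X) (hcurv : CurvCompGE0 X) {D s : ℝ} (hD : 2 ≤ D)
    (hdiam : ∀ x y : X, dist x y ≤ D) (hs0 : 0 < s) (hs1 : s ≤ 1) {N : ℕ} (hN : SepFam X N s)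
    {a b : X} (hab : BadPair a b) (hsmall : 2 * dist a b / D ≤ s / (8 * D)) :
    ∃ q : Fin (N * ⌊D / s⌋₊) → X,
      Config (N * ⌊D / s⌋₊) a (3 * (s / (8 * D)) * dist a b)
        (s / (8 * D) * dist a b * s / (2 * D)) q := by
  obtain ⟨p, hp⟩ := hN
  obtain ⟨hpos, hup, hgl⟩ := hab
  set δ := dist a b with hδ
  set κ := s / (8 * D) with hκ
  have hD0 : 0 < D := by linarith
  have hκ0 : 0 < κ := by positivity
  have hκ1 : κ ≤ 1 / 16 := by
    rw [hκ, div_le_iff₀ (by positivity)]; linarith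
  have hκs : 8 * κ * D = s := by rw [hκ]; field_simp
  set μ := κ * δ / D with hμ
  have hμ0 : 0 < μ := by positivity
  have hμD : μ * D = κ * δ := by rw [hμ]; field_simp
  have hμκ : 2 * μ ≤ κ ^ 2 := by
    have : 2 * μ = κ * (2 * δ / D) := by rw [hμ]; ring
    rw [this, sq]; exact mul_le_mul_of_nonneg_left hsmall hκ0.le
  have hμ1 : μ ≤ 1 := by nlinarith
  have hu : ∀ i, ∃ u, BtwPt a u (p i) μ := fun i => exists_btw hgeo a (p i) hμ0.le hμ1
  choose u hu using hu
  have hau : ∀ i, dist a (u i) ≤ κ * δ := by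
    intro i
    rw [(hu i).1, ← hμD]
    exact mul_le_mul_of_nonneg_left (hdiam _ _) hμ0.le
  have hbu1 : ∀ i, δ * (1 - κ ^ 2) ≤ dist b (u i) := by
    intro i
    have h1 := stewart hcurv hμ0.le hμ1 (hu i) b
    have h2 := hgl (p i)
    rw [dist_comm b a, ← hδ] at h1
    apply le_of_sq_le_sq _ dist_nonneg
    have h3 : δ ^ 2 * (1 - 2 * μ) ≤ dist b (u i) ^ 2 := by
      nlinarith [mul_le_mul_of_nonneg_left h2 hμ0.le, sq_nonneg (μ * dist a (p i))]
    have h4 : δ ^ 2 * (1 - κ ^ 2) ≤ δ ^ 2 * (1 - 2 * μ) :=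
      mul_le_mul_of_nonneg_left (by linarith) (by positivity)
    have h5 : (δ * (1 - κ ^ 2)) ^ 2 ≤ δ ^ 2 * (1 - κ ^ 2) := by
      rw [mul_pow]
      apply mul_le_mul_of_nonneg_left _ (by positivity)
      have hk : κ ^ 2 ≤ 1 := by nlinarith
      nlinarith [mul_nonneg (sq_nonneg κ) (sub_nonneg.2 hk)]
    linarith
  have hbu2 : ∀ i, dist b (u i) ≤ δ * (1 + 3 * κ ^ 2) := by
    intro i
    have h1 := hup (u i) (by nlinarith [hau i])
    have h2 : dist a (u i) ^ 2 ≤ (κ * δ) ^ 2 := pow_le_pow_left₀ dist_nonneg (hau i) 2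
    apply le_of_sq_le_sq _ (by positivity)
    nlinarith [sq_nonneg (δ * κ ^ 2), sq_nonneg (δ * κ)]
  set J := ⌊D / s⌋₊ with hJ
  have hJle : (J : ℝ) * s ≤ D := by
    have := Nat.floor_le (show 0 ≤ D / s by positivity)
    rwa [le_div_iff₀ hs0] at this
  have hJκ : (J : ℝ) * (8 * κ ^ 2) ≤ κ := by
    have h1 : (J : ℝ) * (8 * κ ^ 2) * D = (J * s) * κ := by rw [← hκs]; ring
    have h2 : (J : ℝ) * (8 * κ ^ 2) * D ≤ κ * D := by
      rw [h1]; nlinarith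
    exact le_of_mul_le_mul_right h2 hD0
  have hjκ : ∀ j : Fin J, (j : ℝ) * (8 * κ ^ 2) ≤ κ := fun j => by
    refine le_trans (mul_le_mul_of_nonneg_right ?_ (by positivity)) hJκ
    exact_mod_cast j.2.le
  have hj0 : ∀ j : Fin J, 0 ≤ (j : ℝ) * (8 * κ ^ 2) := fun j => by positivity
  have hv : ∀ (i : Fin N) (j : Fin J), ∃ v, BtwPt b v (u i) (1 - j * (8 * κ ^ 2)) := fun i j =>
    exists_btw hgeo b (u i) (by linarith [hjκ j]) (by linarith [hj0 j])
  choose v hv using hv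
  have hsep1 : ∀ i i' j, i ≠ i' → κ * δ * s / (2 * D) ≤ dist (v i j) (v i' j) := by
    intro i i' j hii
    have h1 := contract hcurv hμ0.le hμ1 (hu i) (hu i')
    have h2 := contract hcurv (by linarith [hjκ j]) (by linarith [hj0 j]) (hv i j) (hv i' j)
    have h3 := hp i i' hii
    have h4 : μ * s ≤ dist (u i) (u i') := le_trans (mul_le_mul_of_nonneg_left h3 hμ0.le) h1
    have h5 : κ * δ * s / (2 * D) = μ * s / 2 := by rw [hμ]; field_simp
    rw [h5]
    have h6 : (1 / 2 : ℝ) ≤ 1 - j * (8 * κ ^ 2) := by linarith [hjκ j]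
    have h7 : 0 < μ * s := by positivity
    nlinarith
  have hsep2 : ∀ i i' (j j' : Fin J), j < j' → κ * δ * s / (2 * D) ≤ dist (v i j) (v i' j') := by
    intro i i' j j' hjj
    have h1 : (j : ℝ) + 1 ≤ j' := by exact_mod_cast hjj
    have h2 := dist_triangle b (v i' j') (v i j)
    rw [(hv i j).1, (hv i' j').1, dist_comm (v i' j')] at h2
    have h5 : κ * δ * s / (2 * D) = 4 * κ ^ 2 * δ := by
      rw [← hκs]; field_simp; ring
    rw [h5]
    have t0 : 0 ≤ 1 - (j : ℝ) * (8 * κ ^ 2) := by linarith [hjκ j]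
    have t0' : 0 ≤ 1 - (j' : ℝ) * (8 * κ ^ 2) := by linarith [hjκ j']
    have h6 := mul_le_mul_of_nonneg_left (hbu1 i) t0
    have h7 := mul_le_mul_of_nonneg_left (hbu2 i') t0'
    have h8 : ((j : ℝ) + 1) * (8 * κ ^ 2) ≤ j' * (8 * κ ^ 2) :=
      mul_le_mul_of_nonneg_right h1 (by positivity)
    set A := (j : ℝ) * (8 * κ ^ 2) with hA
    set B := (j' : ℝ) * (8 * κ ^ 2) with hB
    have hA0 : 0 ≤ A := hj0 j
    have hB0 : 0 ≤ B := hj0 j'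
    have e1 : (1 - A) * (δ * (1 - κ ^ 2)) ≥ δ * (1 - A) - δ * κ ^ 2 := by
      have : 0 ≤ A * (δ * κ ^ 2) := by positivity
      nlinarith
    have e2 : (1 - B) * (δ * (1 + 3 * κ ^ 2)) ≤ δ * (1 - B) + 3 * (δ * κ ^ 2) := by
      have : 0 ≤ B * (δ * κ ^ 2) := by positivity
      nlinarith
    have e3 : δ * (A + 8 * κ ^ 2) ≤ δ * B := mul_le_mul_of_nonneg_left (by linarith) hpos.le
    linarith
  refine ⟨fun k => v (finProdFinEquiv.symm k).1 (finProdFinEquiv.symm k).2, ?_, ?_, ?_, ?_⟩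
  · positivity
  · rw [div_le_iff₀ (by positivity)]
    have : 0 < κ * δ := by positivity
    nlinarith
  · intro k
    set i := (finProdFinEquiv.symm k).1
    set j := (finProdFinEquiv.symm k).2
    have h1 := dist_triangle a (u i) (v i j)
    rw [dist_comm (u i), (hv i j).2] at h1
    have h2 : dist b (u i) ≤ 2 * δ := by
      refine (hbu2 i).trans ?_
      nlinarith
    have h3 : (1 - (1 - (j : ℝ) * (8 * κ ^ 2))) * dist b (u i) ≤ κ * (2 * δ) :=
      mul_le_mul (by linarith [hjκ j]) h2 dist_nonneg hκ0.le
    linarith [hau i]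
  · intro k k' hkk
    by_cases hj : (finProdFinEquiv.symm k).2 = (finProdFinEquiv.symm k').2
    · have hi : (finProdFinEquiv.symm k).1 ≠ (finProdFinEquiv.symm k').1 := fun hi =>
        hkk (finProdFinEquiv.symm.injective (Prod.ext hi hj))
      simp only [← hj]
      exact hsep1 _ _ _ hi
    · rcases lt_or_gt_of_ne hj with h | h
      · exact hsep2 _ _ _ _ h
      · rw [dist_comm]; exact hsep2 _ _ _ _ h

/-- `X` contains, at arbitrarily small scales `s`, at least `s ^ (-n / 2)` points which are
`s`-separated. -/
def Growth (X : Type*) [MetricSpace X] (n : ℕ) : Prop :=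
  ∀ s₀ > (0 : ℝ), ∃ s > (0 : ℝ), s < s₀ ∧ ∃ N : ℕ, SepFam X N s ∧ 1 ≤ (N : ℝ) ^ 2 * s ^ n

theorem growth_succ {X : Type*} [MetricSpace X] [CompactSpace X]
    (hgeo : GeodesicSpace X) (hcurv : CurvCompGE0 X) {D : ℝ} (hD : 2 ≤ D)
    (hdiam : ∀ x y : X, dist x y ≤ D)
    (hbad : ∀ η > (0 : ℝ), ∃ a b : X, BadPair a b ∧ dist a b < η) {n : ℕ} (hn : Growth X n) :
    Growth X (n + 1) := by
  intro s₀ hs₀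
  have hD0 : 0 < D := by linarith
  obtain ⟨s, hs, hss, N, hN, hNs⟩ := hn (min 1 (1 / (2 * (72 * D) ^ (n + 1)))) (by positivity)
  have hs1 : s ≤ 1 := hss.le.trans (min_le_left _ _)
  have hs2 : s * (2 * (72 * D) ^ (n + 1)) ≤ 1 := by
    have := hss.le.trans (min_le_right _ _)
    rwa [le_div_iff₀ (by positivity)] at this
  obtain ⟨a, b, hab, hlt⟩ := hbad (s / 16) (by positivity)
  obtain ⟨q, hq⟩ := stack hgeo hcurv hD hdiam hs hs1 hN hab (by
    rw [div_le_div_iff₀ (by positivity) (by positivity)]; nlinarith)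
  have hpos := hab.pos
  set δ := dist a b
  set M := N * ⌊D / s⌋₊ with hM
  have hJ : 1 ≤ (⌊D / s⌋₊ : ℝ) * s := by
    have h1 := Nat.lt_floor_add_one (D / s)
    rw [div_lt_iff₀ hs] at h1
    nlinarith
  have hMs : 1 ≤ (M : ℝ) ^ 2 * s ^ (n + 2) := by
    have : (M : ℝ) ^ 2 * s ^ (n + 2) = ((N : ℝ) ^ 2 * s ^ n) * ((⌊D / s⌋₊ : ℝ) * s) ^ 2 := by
      rw [hM]; push_cast; ring
    rw [this]
    exact one_le_mul_of_one_le_of_one_le hNs (one_le_pow₀ hJ)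
  have hM0 : 0 < M := by
    rcases Nat.eq_zero_or_pos M with h | h
    · rw [h] at hMs; norm_num at hMs
    · exact h
  set R := 3 * (s / (8 * D)) * δ with hR
  set σ := s / (8 * D) * δ * s / (2 * D) with hσ
  have hσ0 : 0 < σ := hq.sigma_pos
  have hθ : σ / (12 * R) = s / (72 * D) := by
    rw [hσ, hR]; field_simp; norm_num
  set θ := s / (72 * D) with hθd
  have hθ0 : 0 < θ := by positivity
  have hθ1 : θ < 1 := by
    rw [hθd, div_lt_one (by positivity)]; linarith
  have hgrow : 2 ≤ (M : ℝ) ^ 2 * θ ^ (n + 1) := by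
    have e : θ ^ (n + 1) * (72 * D) ^ (n + 1) = s ^ (n + 1) := by
      rw [← mul_pow, hθd]; congr 1; field_simp
    have hK : 0 < (72 * D) ^ (n + 1) := by positivity
    have h1 : (2 * (72 * D) ^ (n + 1)) * s ≤ ((M : ℝ) ^ 2 * s ^ (n + 1)) * s := by
      have : (M : ℝ) ^ 2 * s ^ (n + 1) * s = (M : ℝ) ^ 2 * s ^ (n + 2) := by ring
      rw [this]; linarith
    have h2 := le_of_mul_le_mul_right h1 hs
    rw [← e, ← mul_assoc] at h2
    exact le_of_mul_le_mul_right h2 hK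
  have hc0 : 0 < (σ / 2) ^ (n + 1) := by positivity
  obtain ⟨k1, hk1⟩ := pow_unbounded_of_one_lt (1 / (σ / 2) ^ (n + 1)) (one_lt_two (α := ℝ))
  obtain ⟨k2, hk2⟩ := exists_pow_lt_of_lt_one (show 0 < s₀ / (σ / 2) by positivity) hθ1
  set k := max k1 k2
  have hsf := sepFam_pow hgeo hcurv hM0 hq k
  rw [hθ] at hsf
  refine ⟨θ ^ k * (σ / 2), by positivity, ?_, M ^ k, hsf, ?_⟩
  · rw [← lt_div_iff₀ (by positivity)]
    exact lt_of_le_of_lt (pow_le_pow_of_le_one hθ0.le hθ1.le (le_max_right _ _)) hk2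
  · have e : ((M ^ k : ℕ) : ℝ) ^ 2 * (θ ^ k * (σ / 2)) ^ (n + 1) =
        ((M : ℝ) ^ 2 * θ ^ (n + 1)) ^ k * (σ / 2) ^ (n + 1) := by
      push_cast
      rw [mul_pow, mul_pow, ← pow_mul, ← pow_mul, ← pow_mul, ← pow_mul, mul_comm k 2,
        mul_comm k (n + 1)]
      ring
    rw [e]
    have h1 : (2 : ℝ) ^ k1 ≤ ((M : ℝ) ^ 2 * θ ^ (n + 1)) ^ k :=
      (pow_le_pow_right₀ one_le_two (le_max_left _ _)).trans
        (pow_le_pow_left₀ zero_le_two hgrow k)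
    rw [div_lt_iff₀ hc0] at hk1
    nlinarith

theorem no_small_badPairs {X : Type*} [MetricSpace X] [CompactSpace X]
    (hdim : dimH (Set.univ : Set X) < ⊤)
    (hgeo : GeodesicSpace X) (hcurv : CurvCompGE0 X)
    (hbad : ∀ η > (0 : ℝ), ∃ a b : X, BadPair a b ∧ dist a b < η) : False := by
  obtain ⟨x₀, -, -, -⟩ := hbad 1 one_pos
  obtain ⟨D, hD, hdiam⟩ : ∃ D : ℝ, 2 ≤ D ∧ ∀ x y : X, dist x y ≤ D := by
    refine ⟨max 2 (Metric.diam (Set.univ : Set X)), le_max_left _ _, fun x y => ?_⟩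
    exact (Metric.dist_le_diam_of_mem isCompact_univ.isBounded (Set.mem_univ x)
      (Set.mem_univ y)).trans (le_max_right _ _)
  have hD0 : 0 < D := by linarith
  have hgr : ∀ n, Growth X n := by
    intro n
    induction n with
    | zero =>
      intro s₀ hs₀
      exact ⟨s₀ / 2, by positivity, by linarith, 1,
        ⟨fun _ => x₀, fun i j hij => (hij (Subsingleton.elim i j)).elim⟩, by norm_num⟩
    | succ n ih => exact growth_succ hgeo hcurv hD hdiam hbad ih
  obtain ⟨r, hr⟩ := ENNReal.exists_nat_gt hdim.ne
  have hr0 : 0 < r := by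
    rcases Nat.eq_zero_or_pos r with h | h
    · rw [h] at hr; simp at hr
    · exact h
  obtain ⟨s, hs, hss, N, ⟨p, hp⟩, hNs⟩ := hgr (2 * r + 2) (min (1 / 2) (1 / (12 * D) ^ r))
    (by positivity)
  have hs1 : s < 1 / 2 := lt_of_lt_of_le hss (min_le_left _ _)
  have hs2 : s * (12 * D) ^ r ≤ 1 := by
    have := hss.le.trans (min_le_right _ _)
    rwa [le_div_iff₀ (by positivity)] at this
  have hNs' : 1 ≤ (N : ℝ) * s ^ (r + 1) := by
    have e : (N : ℝ) ^ 2 * s ^ (2 * r + 2) = ((N : ℝ) * s ^ (r + 1)) ^ 2 := by ring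
    rw [e] at hNs
    by_contra hcon
    push Not at hcon
    have : ((N : ℝ) * s ^ (r + 1)) ^ 2 < 1 := pow_lt_one₀ (by positivity) hcon two_ne_zero
    linarith
  have hN1 : 1 < N := by
    by_contra hcon
    have h1 : (N : ℝ) ≤ 1 := by exact_mod_cast not_lt.1 hcon
    have h2 : s ^ (r + 1) < 1 := pow_lt_one₀ hs.le (by linarith) (by omega)
    have h3 : 0 < s ^ (r + 1) := by positivity
    nlinarith
  have hc : Config N x₀ D s p := ⟨hs, by linarith, fun i => hdiam _ _, hp⟩
  have := le_dimH_of_config hgeo hcurv hN1 hc r hr0 (by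
    have hN0 : (0 : ℝ) < N := by exact_mod_cast (by omega : 0 < N)
    rw [inv_le_iff_one_le_mul₀ hN0, div_pow, div_mul_eq_mul_div, le_div_iff₀ (by positivity), one_mul]
    have h1 : (12 * D) ^ r * s ≤ (s ^ r * N) * s := by
      have : s ^ r * N * s = N * s ^ (r + 1) := by ring
      rw [this]; linarith
    exact le_of_mul_le_mul_right h1 hs)
  exact absurd hr (not_lt.2 this)

/-- There is `ε > 0` depending only on `X` such that two distinct connected components of any
quasi-convex subset of `X` are at distance at least `ε²` from each other. -/
theorem quasiConvex_components_separated {X : Type*} [MetricSpace X] [CompactSpace X]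
    (hdim : dimH (Set.univ : Set X) < ⊤)
    (hgeo : GeodesicSpace X) (hcurv : CurvCompGE0 X) :
    ∃ ε > (0 : ℝ), ∀ F : Set X, IsQuasiConvex F →
      ∀ p ∈ F, ∀ q ∈ F, connectedComponentIn F p ≠ connectedComponentIn F q →
        ∀ x ∈ connectedComponentIn F p, ∀ y ∈ connectedComponentIn F q,
          ε ^ 2 ≤ dist x y := by
  by_contra hcon
  push Not at hcon
  apply no_small_badPairs hdim hgeo hcurv
  intro η hη
  obtain ⟨F, hF, p, hp, q, hq, hne, x, hx, y, hy, hxy⟩ := hcon (Real.sqrt η) (Real.sqrt_pos.2 hη)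
  rw [Real.sq_sqrt hη.le] at hxy
  obtain ⟨a, b, hab, hle⟩ := exists_badPair hgeo hcurv hF hp hq hne hx hy
  exact ⟨a, b, hab, hle.trans_lt hxy⟩
end

section
/- Let X be a complete, locally compact, geodesic metric space of finite Hausdorff dimension whose metric has curvature ≥ 0 in the comparison sense, and let F and G be two quasi-convex subsets of X. Then the intersection F ∩ G is also a quasi-convex subset of X. -/
open Metric

namespace QC
variable {X : Type*} [MetricSpace X]

/-- Twice the comparison inner product at `p`. -/
noncomputable def gram (p u v : X) : ℝ := dist p u ^ 2 + dist p v ^ 2 - dist u v ^ 2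

theorem gram_comm (p u v : X) : gram p u v = gram p v u := by
  unfold gram; rw [dist_comm u v]; ring

theorem gram_self_left (p v : X) : gram p p v = 0 := by
  unfold gram; simp

theorem cos_compAngle {p u v : X} (hu : u ≠ p) (hv : v ≠ p) :
    Real.cos (compAngle₀ u p v) = gram p u v / (2 * dist p u * dist p v) := by
  have h1 : 0 < dist p u := dist_pos.2 hu.symm
  have h2 : 0 < dist p v := dist_pos.2 hv.symm
  have h3 := dist_triangle_left u v p
  have h4 := dist_triangle p u v
  have h5 := dist_triangle_right p u v
  rw [dist_comm p v] at h4
  have h6 : 0 ≤ dist u v := dist_nonneg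
  unfold compAngle₀ gram
  apply Real.cos_arccos
  · rw [le_div_iff₀ (by positivity)]
    nlinarith
  · rw [div_le_iff₀ (by positivity)]
    rw [dist_comm v p] at h4
    nlinarith [abs_le.1 (abs_dist_sub_le u v p), dist_comm u p, dist_comm v p,
      sq_le_sq' (abs_le.1 (abs_dist_sub_le u v p)).1 (abs_le.1 (abs_dist_sub_le u v p)).2]

theorem cos_add_cos_ge {α β ε : ℝ} (hα : 0 ≤ α) (hβ : 0 ≤ β) 
    (hε : 0 ≤ ε) (h : α + β ≤ Real.pi + ε) :
    -ε ≤ Real.cos α + Real.cos β := by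
  have e : Real.cos β = - Real.cos (Real.pi - β) := by rw [Real.cos_pi_sub]; ring
  rcases le_total (α + β) Real.pi with h1 | h1
  · have := Real.cos_le_cos_of_nonneg_of_le_pi hα (by linarith : Real.pi - β ≤ Real.pi)
      (by linarith)
    linarith
  · have := Real.abs_cos_sub_cos_le α (Real.pi - β)
    have h2 := (abs_le.1 this).1
    rw [abs_of_nonneg (by linarith : 0 ≤ α - (Real.pi - β))] at h2
    linarith

theorem strain_ineq (hcurv : CurvCompGE0 X) {p u v y : X} (hu : u ≠ p) (hv : v ≠ p) (hy : y ≠ p)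
    {ε : ℝ} (hε : 0 ≤ ε) (h : Real.pi - ε ≤ compAngle₀ u p v) :
    -ε ≤ gram p u y / (2 * dist p u * dist p y) + gram p v y / (2 * dist p v * dist p y) := by
  rw [← cos_compAngle hu hy, ← cos_compAngle hv hy]
  have h1 := hcurv p u v y hu hv hy
  have h2 : compAngle₀ y p u = compAngle₀ u p y := by
    unfold compAngle₀; rw [dist_comm y u]; congr 1; ring
  rw [h2] at h1
  exact cos_add_cos_ge (Real.arccos_nonneg _) (Real.arccos_nonneg _)
    hε (by linarith)

/-- `m` is at fraction `t` between `x` and `y`. -/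
def Frac (t : ℝ) (x y m : X) : Prop :=
  dist x m = t * dist x y ∧ dist m y = (1 - t) * dist x y

theorem compAngle_frac {t : ℝ} (ht : 0 < t) (ht' : t < 1) {x y m : X} (hxy : x ≠ y)
    (h : Frac t x y m) : compAngle₀ x m y = Real.pi := by
  obtain ⟨h1, h2⟩ := h
  have hd : 0 < dist x y := dist_pos.2 hxy
  unfold compAngle₀
  rw [dist_comm m x, h1, h2]
  have : ((t * dist x y) ^ 2 + ((1 - t) * dist x y) ^ 2 - dist x y ^ 2) /
      (2 * (t * dist x y) * ((1 - t) * dist x y)) = -1 := by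
    have : 0 < 1 - t := by linarith
    rw [div_eq_iff (by positivity)]; ring
  rw [this, Real.arccos_neg_one]

theorem stewart (hcurv : CurvCompGE0 X) {t : ℝ} (ht : 0 < t) (ht' : t < 1) {x y m : X}
    (h : Frac t x y m) (c : X) :
    (1 - t) * dist x c ^ 2 + t * dist y c ^ 2 - t * (1 - t) * dist x y ^ 2 ≤ dist m c ^ 2 := by
  have h1 := h.1
  have h2 := h.2
  rcases eq_or_ne x y with rfl | hxy
  · simp at h1 h2
    subst h1
    simp; nlinarith
  rcases eq_or_ne c m with rfl | hc
  · rw [h1, dist_comm y c, h2]; simp; nlinarith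
  have hd : 0 < dist x y := dist_pos.2 hxy
  have ht1 : 0 < 1 - t := by linarith
  have hm1 : x ≠ m := by
    rw [← dist_pos, h1]; positivity
  have hm2 : y ≠ m := by
    rw [ne_comm, ← dist_pos, h2]; positivity
  have hc0 : 0 < dist m c := dist_pos.2 hc.symm
  have := strain_ineq hcurv hm1 hm2 hc le_rfl (by rw [compAngle_frac ht ht' hxy h]; simp)
  rw [dist_comm m x, h1, h2] at this
  unfold gram at this
  rw [dist_comm m x, h1, h2] at this
  have e : ((t * dist x y) ^ 2 + dist m c ^ 2 - dist x c ^ 2) / (2 * (t * dist x y) * dist m c) +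
      (((1 - t) * dist x y) ^ 2 + dist m c ^ 2 - dist y c ^ 2) / (2 * ((1 - t) * dist x y) * dist m c)
      = (dist m c ^ 2 - ((1 - t) * dist x c ^ 2 + t * dist y c ^ 2 - t * (1 - t) * dist x y ^ 2))
        / (2 * t * (1 - t) * dist x y * dist m c) := by
    field_simp; ring
  rw [e, neg_zero, le_div_iff₀ (by positivity)] at this
  linarith

theorem gram_frac_le (hcurv : CurvCompGE0 X) {t : ℝ} (ht : 0 < t) (ht' : t < 1) {x y m : X}
    (h : Frac t x y m) (c : X) : gram x m c ≤ t * gram x y c := by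
  have := stewart hcurv ht ht' h c
  unfold gram
  rw [h.1]
  nlinarith

theorem exists_frac (hgeo : GeodesicSpace X) (x y : X) (k : ℕ) :
    ∃ m, Frac ((1 / 2 : ℝ) ^ (k + 1)) x y m := by
  induction k with
  | zero =>
    obtain ⟨m, h1, h2⟩ := hgeo x y
    exact ⟨m, by rw [h1]; ring, by rw [h2]; ring⟩
  | succ k ih =>
    obtain ⟨m, h1, h2⟩ := ih
    obtain ⟨m', h3, h4⟩ := hgeo x m
    refine ⟨m', by rw [h3, h1]; ring, le_antisymm ?_ ?_⟩
    · have := dist_triangle m' m y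
      rw [h4, h1, h2] at this
      refine this.trans (le_of_eq (by ring))
    · have := dist_triangle x m' y
      rw [h3, h1] at this
      have e : (1 - (1 / 2 : ℝ) ^ (k + 1 + 1)) * dist x y
        = dist x y - (1 / 2 : ℝ) ^ (k + 1) * dist x y / 2 := by ring
      rw [e]; linarith

theorem half_pos_lt (k : ℕ) : 0 < (1 / 2 : ℝ) ^ (k + 1) ∧ (1 / 2 : ℝ) ^ (k + 1) < 1 :=
  ⟨by positivity, pow_lt_one₀ (by norm_num) (by norm_num) (by simp)⟩

theorem tendsto_half :
    Filter.Tendsto (fun k : ℕ => (1 / 2 : ℝ) ^ (k + 1)) Filter.atTop (nhds 0) :=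
  (tendsto_pow_atTop_nhds_zero_of_lt_one (by norm_num) (by norm_num)).comp
    (Filter.tendsto_add_atTop_nat 1)

theorem continuousAt_compAngle {x o z : X} (hx : x ≠ o) (hz : z ≠ o) :
    ContinuousAt (fun w => compAngle₀ x w z) o := by
  have h1 : dist o x ≠ 0 := dist_ne_zero.2 hx.symm
  have h2 : dist o z ≠ 0 := dist_ne_zero.2 hz.symm
  unfold compAngle₀
  apply Real.continuous_arccos.continuousAt.comp
  apply ContinuousAt.div
  · fun_prop
  · fun_prop
  · positivity

theorem compAngle_comm (x o z : X) : compAngle₀ x o z = compAngle₀ z o x := by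
  unfold compAngle₀; rw [dist_comm x z]; congr 1; ring

theorem tendsto_frac {x y : X} {m : ℕ → X} (hm : ∀ k, Frac ((1 / 2 : ℝ) ^ (k + 1)) x y (m k)) :
    Filter.Tendsto m Filter.atTop (nhds x) := by
  rw [tendsto_iff_dist_tendsto_zero]
  have := tendsto_half.mul_const (dist x y)
  rw [zero_mul] at this
  refine this.congr fun k => ?_
  rw [dist_comm (m k), (hm k).1]

theorem exists_strained (hgeo : GeodesicSpace X) {ε : ℝ} (hε : 0 < ε)
    {ι : Type*} (x : ι → X) (s : Finset ι) (p : X) (hx : ∀ i ∈ s, x i ≠ p)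
    (U : Set X) (hU : IsOpen U) (hp : p ∈ U) :
    ∃ o ∈ U, ∀ i ∈ s, x i ≠ o ∧ ∃ z, z ≠ o ∧ Real.pi - ε < compAngle₀ (x i) o z := by
  classical
  induction s using Finset.induction_on generalizing U with
  | empty => exact ⟨p, hp, by simp⟩
  | insert i s hi ih =>
    obtain ⟨o, ⟨hoU, hoi⟩, ho⟩ := ih (fun j hj => hx j (Finset.mem_insert_of_mem hj))
      (U ∩ {w | x i ≠ w}) (hU.inter (isOpen_ne_fun continuous_const continuous_id))
      ⟨hp, hx i (Finset.mem_insert_self _ _)⟩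
    have hev : ∀ᶠ w in nhds o, ∀ j ∈ s,
        x j ≠ w ∧ ∃ z, z ≠ w ∧ Real.pi - ε < compAngle₀ (x j) w z := by
      rw [Filter.eventually_all_finset]
      intro j hj
      obtain ⟨h1, z, h2, h3⟩ := ho j hj
      filter_upwards [(isOpen_ne_fun continuous_const continuous_id).mem_nhds h1,
        (isOpen_ne_fun continuous_const continuous_id).mem_nhds h2,
        (continuousAt_compAngle h1 h2).eventually (lt_mem_nhds h3)] with w w1 w2 w3
      exact ⟨w1, z, w2, w3⟩
    choose m hm using fun k => exists_frac hgeo o (x i) k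
    have hlim := tendsto_frac hm
    obtain ⟨k, hk1, hk2⟩ := ((hlim.eventually hev).and
      (hlim.eventually (hU.mem_nhds hoU))).exists
    have hd : 0 < dist o (x i) := dist_pos.2 (Ne.symm hoi)
    obtain ⟨t0, t1⟩ := half_pos_lt k
    refine ⟨m k, hk2, fun j hj => ?_⟩
    rcases Finset.mem_insert.1 hj with rfl | hj
    · refine ⟨?_, o, ?_, ?_⟩
      · rw [ne_comm, ← dist_pos, (hm k).2]
        have : 0 < 1 - (1 / 2 : ℝ) ^ (k + 1) := by linarith
        positivity
      · rw [← dist_pos, (hm k).1]; positivity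
      · rw [compAngle_comm, compAngle_frac t0 t1 (Ne.symm hoi) (hm k)]; linarith
    · exact hk1 j hj

theorem move_ineq (hcurv : CurvCompGE0 X) {o x z : X} (hx : x ≠ o) (hz : z ≠ o) {ε ε' : ℝ}
    (hε : 0 < ε) (h : Real.pi - ε < compAngle₀ x o z) (hε' : 4 * ε * dist o x < ε') :
    ∀ᶠ w in nhds o, w ≠ o → ∀ t : ℝ, 0 < t → t < 1 → ∀ w', Frac t w x w' →
      dist o w' ^ 2 ≤ dist o w ^ 2 + t * (dist o x ^ 2 - dist x w ^ 2 + ε' * dist o w)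
        + t ^ 2 * dist w x ^ 2 := by
  have hox : 0 < dist o x := dist_pos.2 hx.symm
  have hoz : 0 < dist o z := dist_pos.2 hz.symm
  have hoz' : dist o z ≠ 0 := hoz.ne'
  let E : X → ℝ := fun w => 2 * ε * dist w x
    + (dist w x / dist w z) * (2 * dist o w + 2 * ε * dist o z)
    + |(dist w x / dist w z) * (dist o z / dist o x) - 1| * (dist o x + dist w x)
    + (dist w x / dist w z) * (dist o z / dist o x) * dist o w
  have hE : ContinuousAt E o := by
    have : ContinuousAt (fun w => dist w x / dist w z) o :=
      ContinuousAt.div (by fun_prop) (by fun_prop) hoz'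
    fun_prop
  have hE0 : E o < ε' := by
    have : E o = 4 * ε * dist o x := by
      simp only [E, dist_self]
      have : dist o x / dist o z * (dist o z / dist o x) = 1 := by field_simp
      rw [this]; simp; field_simp; ring
    rw [this]; exact hε'
  filter_upwards [hE.eventually (gt_mem_nhds hE0),
    (isOpen_ne_fun continuous_const continuous_id).mem_nhds hx,
    (isOpen_ne_fun continuous_const continuous_id).mem_nhds hz,
    (continuousAt_compAngle hx hz).eventually (lt_mem_nhds h)] with w hEw (hxw : x ≠ w)
    (hzw : z ≠ w) hang hwo t t0 t1 w' hw'
  have ha : 0 < dist o w := dist_pos.2 hwo.symm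
  have hwx : 0 < dist w x := dist_pos.2 hxw.symm
  have hwz : 0 < dist w z := dist_pos.2 hzw.symm
  have hww' : w' ≠ w := by rw [ne_comm, ← dist_pos, hw'.1]; positivity
  have hang' : Real.pi - ε ≤ compAngle₀ w' w z := by
    refine hang.le.trans ?_
    apply Real.arccos_le_arccos
    have := gram_frac_le hcurv t0 t1 hw' z
    change gram w w' z / _ ≤ gram w x z / _
    rw [hw'.1, div_le_div_iff₀ (by positivity) (by positivity)]
    have := mul_le_mul_of_nonneg_right this (by positivity : 0 ≤ 2 * dist w x * dist w z)
    linarith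
  have h1 := strain_ineq hcurv hx hz hwo hε.le h.le
  have h2 := strain_ineq hcurv hww' hzw hwo.symm hε.le hang'
  rw [hw'.1, dist_comm w o] at h2
  set a := dist o w with hadef
  set κ := dist w x / dist w z with hκ
  set ρ := κ * (dist o z / dist o x) with hρ
  have hκ0 : 0 < κ := by positivity
  have hρ0 : 0 < ρ := by positivity
  have h1' : -(2 * ε * a * dist o z) - dist o z / dist o x * gram o x w ≤ gram o z w := by
    have := mul_le_mul_of_nonneg_right h1 (by positivity : 0 ≤ 2 * a * dist o z)
    have e : (gram o x w / (2 * dist o x * a) + gram o z w / (2 * dist o z * a)) *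
      (2 * a * dist o z) = dist o z / dist o x * gram o x w + gram o z w := by
      field_simp
    rw [e] at this; linarith
  have h2' : -(2 * ε * t * dist w x * a) - t * κ * gram w z o ≤ gram w w' o := by
    have := mul_le_mul_of_nonneg_right h2 (by positivity : 0 ≤ 2 * (t * dist w x) * a)
    have e : (gram w w' o / (2 * (t * dist w x) * a) + gram w z o / (2 * dist w z * a)) *
      (2 * (t * dist w x) * a) = gram w w' o + t * κ * gram w z o := by
      rw [hκ]; field_simp
    rw [e] at this; linarith
  have g1 : gram w z o = 2 * a ^ 2 - gram o z w := by
    unfold gram; rw [dist_comm w o, dist_comm z o, dist_comm z w, ← hadef]; ring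
  have g2 : gram o x w = a ^ 2 + (dist o x ^ 2 - dist x w ^ 2) := by
    unfold gram; rw [← hadef]; ring
  have g3 : gram w w' o = t ^ 2 * dist w x ^ 2 + a ^ 2 - dist o w' ^ 2 := by
    unfold gram; rw [hw'.1, dist_comm w o, dist_comm w' o, ← hadef]; ring
  set H := dist o x ^ 2 - dist x w ^ 2 with hH
  have hHa : |H| ≤ a * (dist o x + dist w x) := by
    rw [hH, dist_comm x w, sq_sub_sq, abs_mul, abs_of_pos (by positivity), mul_comm]
    exact mul_le_mul_of_nonneg_right (abs_dist_sub_le o w x) (by positivity)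
  have hρH : ρ * H ≤ H + |ρ - 1| * (a * (dist o x + dist w x)) := by
    have : (ρ - 1) * H ≤ |ρ - 1| * (a * (dist o x + dist w x)) := by
      refine (le_abs_self _).trans ?_
      rw [abs_mul]
      exact mul_le_mul_of_nonneg_left hHa (abs_nonneg _)
    linarith
  have hEa : E w * a ≤ ε' * a := mul_le_mul_of_nonneg_right hEw.le ha.le
  have hEw' : E w = 2 * ε * dist w x + κ * (2 * a + 2 * ε * dist o z)
    + |ρ - 1| * (dist o x + dist w x) + ρ * a := rfl
  rw [hEw'] at hEa
  rw [g2] at h1'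
  rw [g1, g3] at h2'
  have h3 := mul_le_mul_of_nonneg_left h1' hκ0.le
  have h4 : κ * (-(2 * ε * a * dist o z) - dist o z / dist o x * (a ^ 2 + H))
    = -(κ * (2 * ε * a * dist o z)) - ρ * a ^ 2 - ρ * H := by rw [hρ]; ring
  rw [h4] at h3
  have h5 : 2 * ε * dist w x * a + κ * (2 * a ^ 2 - gram o z w) ≤ H + ε' * a := by
    nlinarith
  have h6 := mul_le_mul_of_nonneg_left h5 t0.le
  linarith

set_option maxHeartbeats 1000000 in
theorem lss_aux [LocallyCompactSpace X] (hgeo : GeodesicSpace X) (hcurv : CurvCompGE0 X)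
    {ι : Type*} [Fintype ι] (x : ι → X) (a : ι → ℝ) (ha : ∀ i, 0 ≤ a i) (p : X)
    (hx : ∀ i, x i ≠ p) : 0 ≤ ∑ i, ∑ j, a i * a j * gram p (x i) (x j) := by
  by_contra hneg
  push Not at hneg
  set S : X → ℝ := fun w => ∑ i, ∑ j, a i * a j * gram w (x i) (x j) with hS
  have hScont : Continuous S := by
    simp only [hS, gram]; fun_prop
  obtain ⟨c, hc, hSc⟩ : ∃ c > 0, S p < -c := ⟨-S p / 2, by change S p < 0 at hneg; linarith,
    by change S p < 0 at hneg; linarith⟩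
  set D : ℝ := ∑ i, dist p (x i) + 1 with hD
  have hD0 : 0 < D := by positivity
  have hDi : ∀ i, dist p (x i) < D := fun i => by
    have := Finset.single_le_sum (f := fun i => dist p (x i)) (fun i _ => dist_nonneg)
      (Finset.mem_univ i)
    linarith
  set A : ℝ := ∑ i, a i with hA
  have hA0 : 0 ≤ A := Finset.sum_nonneg fun i _ => ha i
  set B : ℝ := 2 * D * A with hB
  have hB0 : 0 ≤ B := by positivity
  obtain ⟨ε', hε'0, hε'⟩ : ∃ ε' > 0, ε' * B * A < c := by
    refine ⟨c / (B * A + 1), by positivity, ?_⟩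
    rw [mul_assoc, div_mul_eq_mul_div, div_lt_iff₀ (by positivity)]
    nlinarith
  have hUo : IsOpen ({w | S w < -c} ∩ {w | ∀ i, dist w (x i) < D}) := by
    refine (isOpen_lt hScont continuous_const).inter ?_
    rw [Set.ofPred_forall]
    exact isOpen_iInter_of_finite fun i =>
      isOpen_lt (continuous_id.dist continuous_const) continuous_const
  obtain ⟨o, hoU, ho⟩ := exists_strained hgeo (ε := ε' / (8 * D)) (by positivity) x Finset.univ p
    (fun i _ => hx i) _ hUo ⟨hSc, hDi⟩
  have hmv : ∀ᶠ w in nhds o, ∀ i, w ≠ o → ∀ t : ℝ, 0 < t → t < 1 → ∀ w', Frac t w (x i) w' →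
      dist o w' ^ 2 ≤ dist o w ^ 2 + t * (dist o (x i) ^ 2 - dist (x i) w ^ 2 + ε' * dist o w)
        + t ^ 2 * dist w (x i) ^ 2 := by
    rw [Filter.eventually_all]
    intro i
    obtain ⟨h1, z, h2, h3⟩ := ho i (Finset.mem_univ i)
    refine move_ineq hcurv h1 h2 (by positivity) h3 ?_
    have h4 := hoU.2 i
    have : 4 * (ε' / (8 * D)) * dist o (x i) ≤ 4 * (ε' / (8 * D)) * D := by gcongr
    have e : 4 * (ε' / (8 * D)) * D = ε' / 2 := by field_simp; ring
    linarith
  obtain ⟨δ, hδ, hball⟩ := Metric.eventually_nhds_iff_ball.1 (hmv.and (hUo.mem_nhds hoU))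
  obtain ⟨r, hr, hcomp⟩ := exists_isCompact_closedBall o
  set τ := min r (δ / 2) with hτ
  have hτ0 : 0 < τ := lt_min hr (by positivity)
  have hcτ : IsCompact (closedBall o τ) :=
    hcomp.of_isClosed_subset isClosed_closedBall (closedBall_subset_closedBall (min_le_left _ _))
  have hsub : ∀ w ∈ closedBall o τ, w ∈ ball o δ := fun w hw => by
    rw [mem_closedBall] at hw
    rw [mem_ball]
    have := min_le_right r (δ / 2)
    linarith
  obtain ⟨L, hL0, hL⟩ : ∃ L > 0, L * B < τ := by
    refine ⟨τ / (B + 1), by positivity, ?_⟩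
    rw [div_mul_eq_mul_div, div_lt_iff₀ (by positivity)]
    nlinarith
  set Ψ : X → ℝ := fun w => ∑ i, a i * (dist o (x i) ^ 2 - dist (x i) w ^ 2) with hΨ
  have hVc : Continuous fun w => dist o w ^ 2 + L * Ψ w := by
    simp only [hΨ]; fun_prop
  obtain ⟨w, hw, hmin⟩ := hcτ.exists_isMinOn ⟨o, mem_closedBall_self hτ0.le⟩ hVc.continuousOn
  obtain ⟨hmvw, hSw, hDw⟩ := hball w (hsub w hw)
  have hΨo : Ψ o = 0 := by
    simp only [hΨ]
    exact Finset.sum_eq_zero fun i _ => by rw [dist_comm]; ring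
  have hVw : dist o w ^ 2 + L * Ψ w ≤ 0 := by
    have := hmin (mem_closedBall_self hτ0.le)
    simp only [Set.mem_ofPred_eq, hΨo, dist_self] at this
    linarith
  have hΨB : -(B * dist o w) ≤ Ψ w := by
    have : -(B * dist o w) = ∑ i, a i * (-(2 * D * dist o w)) := by
      rw [← Finset.sum_mul]; ring
    rw [this]
    apply Finset.sum_le_sum
    intro i _
    apply mul_le_mul_of_nonneg_left _ (ha i)
    have h1 := hoU.2 i
    have h2 : dist w (x i) < D := hDw i
    have h3 := abs_le.1 (abs_dist_sub_le o w (x i))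
    rw [dist_comm (x i) w]
    have h4 : 0 ≤ dist o (x i) := dist_nonneg
    have h5 : 0 ≤ dist w (x i) := dist_nonneg
    have h6 : 0 ≤ dist o w := dist_nonneg
    nlinarith
  have hΨ0 : Ψ w ≤ 0 := by
    by_contra hcon
    push Not at hcon
    have := mul_pos hL0 hcon
    nlinarith [sq_nonneg (dist o w)]
  have haw : dist o w ≤ L * B := by
    rcases (dist_nonneg : 0 ≤ dist o w).eq_or_lt with h0 | h0
    · rw [← h0]; positivity
    · have := mul_le_mul_of_nonneg_left hΨB hL0.le
      by_contra hcon
      push Not at hcon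
      nlinarith
  have hint : closedBall o τ ∈ nhds w :=
    Filter.mem_of_superset (isOpen_ball.mem_nhds (by
      rw [mem_ball, dist_comm]; linarith : w ∈ ball o τ)) ball_subset_closedBall
  have key : ∀ i, 0 ≤ dist o (x i) ^ 2 - dist (x i) w ^ 2 + ε' * dist o w
      + L * ∑ j, a j * gram w (x i) (x j) := by
    intro i
    choose m hm using fun k => exists_frac hgeo w (x i) k
    have hlim := tendsto_frac hm
    set Q := dist o (x i) ^ 2 - dist (x i) w ^ 2 + ε' * dist o w
      + L * ∑ j, a j * gram w (x i) (x j) with hQ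
    have hT : Filter.Tendsto (fun k : ℕ => Q + (1 / 2 : ℝ) ^ (k + 1) * dist w (x i) ^ 2)
        Filter.atTop (nhds Q) := by
      have := (tendsto_half.mul_const (dist w (x i) ^ 2)).const_add Q
      simpa using this
    refine ge_of_tendsto hT ?_
    filter_upwards [hlim.eventually hint] with k hk
    obtain ⟨t0, t1⟩ := half_pos_lt k
    have hmk := hm k
    set t := (1 / 2 : ℝ) ^ (k + 1) with ht
    have h1 := hmin hk
    simp only [Set.mem_ofPred_eq] at h1
    have h2 : dist o (m k) ^ 2 ≤ dist o w ^ 2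
        + t * (dist o (x i) ^ 2 - dist (x i) w ^ 2 + ε' * dist o w)
        + t ^ 2 * dist w (x i) ^ 2 := by
      rcases eq_or_ne w o with rfl | hwo
      · rw [hmk.1, dist_comm (x i)]; simp; nlinarith
      · exact hmvw i hwo t t0 t1 _ hmk
    have h3 : Ψ (m k) - Ψ w ≤ t * ∑ j, a j * gram w (x i) (x j) := by
      simp only [hΨ]
      rw [← Finset.sum_sub_distrib, Finset.mul_sum]
      apply Finset.sum_le_sum
      intro j _
      have h4 := stewart hcurv t0 t1 hmk (x j)
      have : a j * (dist o (x j) ^ 2 - dist (x j) (m k) ^ 2) - a j * (dist o (x j) ^ 2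
        - dist (x j) w ^ 2) = a j * (dist w (x j) ^ 2 - dist (m k) (x j) ^ 2) := by
        rw [dist_comm (x j), dist_comm (x j)]; ring
      rw [this, mul_left_comm]
      apply mul_le_mul_of_nonneg_left _ (ha j)
      unfold gram
      nlinarith [mul_nonneg (mul_nonneg t0.le t0.le) (sq_nonneg (dist w (x i)))]
    have h5 := mul_le_mul_of_nonneg_left h3 hL0.le
    have h6 : 0 ≤ t * (Q + t * dist w (x i) ^ 2) := by
      have e : t * (Q + t * dist w (x i) ^ 2)
          = t * (dist o (x i) ^ 2 - dist (x i) w ^ 2 + ε' * dist o w)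
            + L * (t * ∑ j, a j * gram w (x i) (x j)) + t ^ 2 * dist w (x i) ^ 2 := by
        rw [hQ]; ring
      rw [e]; linarith
    exact nonneg_of_mul_nonneg_right h6 t0
  have hsum : 0 ≤ ∑ i, a i * (dist o (x i) ^ 2 - dist (x i) w ^ 2 + ε' * dist o w
      + L * ∑ j, a j * gram w (x i) (x j)) :=
    Finset.sum_nonneg fun i _ => mul_nonneg (ha i) (key i)
  have hsum' : ∑ i, a i * (dist o (x i) ^ 2 - dist (x i) w ^ 2 + ε' * dist o w
      + L * ∑ j, a j * gram w (x i) (x j)) = Ψ w + ε' * dist o w * A + L * S w := by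
    simp only [hΨ, hA, hS, Finset.mul_sum, ← Finset.sum_add_distrib]
    apply Finset.sum_congr rfl
    intro i _
    rw [mul_add, mul_add, Finset.mul_sum]
    congr 1
    · ring
    · exact Finset.sum_congr rfl fun j _ => by ring
  rw [hsum'] at hsum
  have h7 : ε' * dist o w * A ≤ ε' * (L * B) * A := by gcongr
  have h8 : L * S w < L * (-c) := mul_lt_mul_of_pos_left hSw hL0
  have h9 : L * (ε' * B * A) < L * c := mul_lt_mul_of_pos_left hε' hL0
  linarith

/-- The Lang–Schroeder–Sturm inequality. -/
theorem lss [LocallyCompactSpace X] (hgeo : GeodesicSpace X) (hcurv : CurvCompGE0 X)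
    {ι : Type*} [Fintype ι] (x : ι → X) (a : ι → ℝ) (ha : ∀ i, 0 ≤ a i) (p : X) :
    0 ≤ ∑ i, ∑ j, a i * a j * gram p (x i) (x j) := by
  classical
  have h := lss_aux hgeo hcurv (fun i : {i // x i ≠ p} => x i) (fun i => a i)
    (fun i => ha i) p (fun i => i.2)
  have e : ∀ f : ι → ℝ, (∀ i, x i = p → f i = 0) → ∑ i : {i // x i ≠ p}, f i = ∑ i, f i := by
    intro f hf
    rw [← Finset.sum_subtype (Finset.univ.filter fun i => x i ≠ p) (by simp) f]
    exact Finset.sum_filter_of_ne fun i _ hi hxi => hi (hf i hxi)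
  have e1 : ∀ i, ∑ j : {i // x i ≠ p}, a i * a j * gram p (x i) (x j)
      = ∑ j, a i * a j * gram p (x i) (x j) := fun i =>
    e (fun j => a i * a j * gram p (x i) (x j)) fun j hj => by
      simp only [hj]; rw [gram_comm, gram_self_left, mul_zero]
  simp only [e1] at h
  rwa [e (fun i => ∑ j, a i * a j * gram p (x i) (x j)) fun i hi => by
    simp only [hi, gram_self_left, mul_zero, Finset.sum_const_zero]] at h

theorem bary [LocallyCompactSpace X] (hgeo : GeodesicSpace X) (hcurv : CurvCompGE0 X)
    {ι : Type*} [Fintype ι] (q : ι → X) (a : ι → ℝ) (ha : ∀ i, 0 ≤ a i) (x r : X)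
    (hmin : ∀ᶠ z in nhds x, ∑ i, a i * dist x (q i) ^ 2 ≤ ∑ i, a i * dist z (q i) ^ 2) :
    0 ≤ ∑ i, a i * gram x (q i) r := by
  by_contra hneg
  push Not at hneg
  set Z := ∑ i, a i * gram x (q i) r with hZ
  set A := ∑ i, a i with hA
  set C := A * ∑ i, a i * dist x (q i) ^ 2 with hC
  set R := dist x r ^ 2 with hR
  have hR0 : 0 ≤ R := by positivity
  obtain ⟨κ, hκ0, hκ⟩ : ∃ κ > 0, κ * R < -Z := by
    refine ⟨-Z / (R + 1), div_pos (by linarith) (by positivity), ?_⟩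
    rw [div_mul_eq_mul_div, div_lt_iff₀ (by positivity)]
    nlinarith
  choose m hm using fun k i => exists_frac hgeo x (q i) k
  have hlim : ∀ i, Filter.Tendsto (fun k => m k i) Filter.atTop (nhds x) := fun i =>
    tendsto_frac (fun k => hm k i)
  have hT : Filter.Tendsto (fun k : ℕ => (1 / 2 : ℝ) ^ (k + 1) * C + 2 * κ * (Z + κ * R))
      Filter.atTop (nhds (2 * κ * (Z + κ * R))) := by
    have := (tendsto_half.mul_const C).add_const (2 * κ * (Z + κ * R))
    simpa using this
  have hfin : 0 ≤ 2 * κ * (Z + κ * R) := by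
    refine ge_of_tendsto hT ?_
    filter_upwards [Filter.eventually_all.2 fun i => (hlim i).eventually hmin] with k hk
    obtain ⟨s0, s1⟩ := half_pos_lt k
    have hmk := hm k
    set s := (1 / 2 : ℝ) ^ (k + 1) with hs
    have h := lss hgeo hcurv (fun o : Option ι => o.elim r (m k))
      (fun o => o.elim (κ * s) a)
      (by rintro (_ | i); exacts [by simp only [Option.elim]; positivity, ha i]) x
    simp only [Fintype.sum_option, Option.elim] at h
    have h1 : ∑ i, a i * gram x (m k i) r ≤ s * Z := by
      rw [hZ, Finset.mul_sum]
      apply Finset.sum_le_sum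
      intro i _
      have := mul_le_mul_of_nonneg_left (gram_frac_le hcurv s0 s1 (hmk i) r) (ha i)
      linarith
    have h2 : ∀ j, ∑ i, a i * gram x (m k i) (m k j) ≤ s ^ 3 * A * dist x (q j) ^ 2 := by
      intro j
      have h3 : ∑ i, a i * gram x (m k i) (m k j) ≤ ∑ i, a i * (s * gram x (q i) (m k j)) := by
        apply Finset.sum_le_sum
        intro i _
        exact mul_le_mul_of_nonneg_left (gram_frac_le hcurv s0 s1 (hmk i) _) (ha i)
      have h4 : ∑ i, a i * (s * gram x (q i) (m k j)) = s * (∑ i, a i * dist x (q i) ^ 2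
          - ∑ i, a i * dist (m k j) (q i) ^ 2) + s ^ 3 * A * dist x (q j) ^ 2 := by
        rw [hA, ← Finset.sum_sub_distrib, Finset.mul_sum, Finset.mul_sum, Finset.sum_mul,
          ← Finset.sum_add_distrib]
        apply Finset.sum_congr rfl
        intro i _
        unfold gram
        rw [(hmk j).1, dist_comm (q i)]; ring
      have h5 := hk j
      rw [h4] at h3
      nlinarith
    have h3 : ∑ i, ∑ j, a i * a j * gram x (m k i) (m k j) ≤ s ^ 3 * C := by
      rw [Finset.sum_comm]
      have : s ^ 3 * C = ∑ j, a j * (s ^ 3 * A * dist x (q j) ^ 2) := by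
        rw [hC, Finset.mul_sum, Finset.mul_sum]
        exact Finset.sum_congr rfl fun j _ => by ring
      rw [this]
      apply Finset.sum_le_sum
      intro j _
      refine le_trans (le_of_eq ?_) (mul_le_mul_of_nonneg_left (h2 j) (ha j))
      rw [Finset.mul_sum]
      exact Finset.sum_congr rfl fun i _ => by ring
    have h4 : ∑ i, κ * s * a i * gram x r (m k i) = κ * s * ∑ i, a i * gram x (m k i) r := by
      rw [Finset.mul_sum]
      exact Finset.sum_congr rfl fun i _ => by rw [gram_comm]; ring
    have h5 : ∑ i, a i * (κ * s) * gram x (m k i) r = κ * s * ∑ i, a i * gram x (m k i) r := by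
      rw [Finset.mul_sum]
      exact Finset.sum_congr rfl fun i _ => by ring
    have h6 : gram x r r = 2 * R := by unfold gram; simp; ring
    rw [Finset.sum_add_distrib, h4, h5, h6] at h
    have h7 := mul_le_mul_of_nonneg_left h1 (by positivity : 0 ≤ κ * s)
    have h8 : 0 ≤ s ^ 2 * (s * C + 2 * κ * (Z + κ * R)) := by nlinarith
    exact nonneg_of_mul_nonneg_right h8 (by positivity)
  have : Z + κ * R < 0 := by linarith
  nlinarith

theorem exists_nearest {F : Set X} (hF : IsClosed F) {p x : X} (hp : p ∈ F) {ρ : ℝ}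
    (hK : IsCompact (closedBall p ρ)) (hx : dist x p < ρ / 4) :
    ∃ y ∈ F, infDist x F = dist x y := by
  have hρ : 0 ≤ dist x p := dist_nonneg
  have hc : IsCompact (F ∩ closedBall p ρ) := hK.inter_left hF
  have hpK : p ∈ F ∩ closedBall p ρ := ⟨hp, mem_closedBall_self (by linarith)⟩
  obtain ⟨y, hy, hxy⟩ := hc.exists_infDist_eq_dist ⟨p, hpK⟩ x
  refine ⟨y, hy.1, le_antisymm (infDist_le_dist_of_mem hy.1) ?_⟩
  rw [le_infDist ⟨p, hp⟩]
  intro z hz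
  rw [← hxy]
  by_cases hzK : z ∈ closedBall p ρ
  · exact infDist_le_dist_of_mem ⟨hz, hzK⟩
  · rw [mem_closedBall, not_le] at hzK
    have h1 := infDist_le_dist_of_mem (x := x) hpK
    have h2 := dist_triangle_left z p x
    linarith

theorem qc_ineq {F : Set X} (hF : IsQuasiConvex F) {x y r : X} (hy : y ∈ F) (hr : r ∈ F)
    (h : infDist x F = dist x y) : dist x r ^ 2 ≤ dist x y ^ 2 + dist y r ^ 2 := by
  by_cases hx : x ∈ F
  · rw [infDist_zero_of_mem hx] at h
    have : x = y := dist_eq_zero.1 h.symm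
    subst this; simp
  · exact hF.2 x y hx hy h.symm r hr

theorem main_ineq [LocallyCompactSpace X] (hgeo : GeodesicSpace X) (hcurv : CurvCompGE0 X)
    {F G : Set X} (hF : IsQuasiConvex F) (hG : IsQuasiConvex G) {p q r x : X}
    (hp : p ∈ F ∩ G) (hr : r ∈ F ∩ G) {ρ : ℝ} (hK : IsCompact (closedBall p ρ))
    (hx : dist x p < ρ / 4) {N : ℝ} (hN : 0 ≤ N)
    (hmin : ∀ z ∈ closedBall p ρ,
      dist x q ^ 2 + dist x p ^ 2 + N * (infDist x F ^ 2 + infDist x G ^ 2)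
      ≤ dist z q ^ 2 + dist z p ^ 2 + N * (infDist z F ^ 2 + infDist z G ^ 2)) :
    dist q r ^ 2 ≤ 2 * dist p q ^ 2 - dist x q ^ 2 + 2 * dist x r ^ 2 + dist x p ^ 2
      - dist p r ^ 2 := by
  have hρ : 0 ≤ dist x p := dist_nonneg
  obtain ⟨y, hy, hxy⟩ := exists_nearest hF.1 hp.1 hK hx
  obtain ⟨y', hy', hxy'⟩ := exists_nearest hG.1 hp.2 hK hx
  have h1 := qc_ineq hF hy hr.1 hxy
  have h2 := qc_ineq hG hy' hr.2 hxy'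
  have hb := bary hgeo hcurv ![q, p, y, y'] ![1, 1, N, N]
    (by intro i; fin_cases i <;> simp [hN]) x r (by
      have hn : closedBall p ρ ∈ nhds x :=
        Filter.mem_of_superset (isOpen_ball.mem_nhds (by
          rw [mem_ball]; linarith : x ∈ ball p ρ)) ball_subset_closedBall
      filter_upwards [hn] with z hz
      have h3 := hmin z hz
      have h4 : infDist z F ^ 2 ≤ dist z y ^ 2 :=
        pow_le_pow_left₀ infDist_nonneg (infDist_le_dist_of_mem hy) 2
      have h5 : infDist z G ^ 2 ≤ dist z y' ^ 2 :=
        pow_le_pow_left₀ infDist_nonneg (infDist_le_dist_of_mem hy') 2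
      have h6 := mul_le_mul_of_nonneg_left (add_le_add h4 h5) hN
      rw [hxy, hxy'] at h3
      simp [Fin.sum_univ_four]
      linarith)
  simp [Fin.sum_univ_four] at hb
  have h3 := hmin p (mem_closedBall_self (by linarith))
  rw [infDist_zero_of_mem hp.1, infDist_zero_of_mem hp.2, hxy, hxy'] at h3
  simp at h3
  unfold gram at hb
  have h4 := mul_le_mul_of_nonneg_left h1 hN
  have h5 := mul_le_mul_of_nonneg_left h2 hN
  have h6 := sq_nonneg (dist x p)
  linarith

end QC

/-- The intersection of two quasi-convex subsets is quasi-convex. -/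
theorem quasiConvex_inter {X : Type*} [MetricSpace X] [CompleteSpace X] [LocallyCompactSpace X]
    (hdim : dimH (Set.univ : Set X) < ⊤)
    (hgeo : GeodesicSpace X) (hcurv : CurvCompGE0 X)
    (F G : Set X) (hF : IsQuasiConvex F) (hG : IsQuasiConvex G) :
    IsQuasiConvex (F ∩ G) := by
  refine ⟨hF.1.inter hG.1, fun q p _ hp hqp r hr => ?_⟩
  obtain ⟨ρ, hρ, hK⟩ := exists_isCompact_closedBall p
  have hpK : p ∈ closedBall p ρ := mem_closedBall_self hρ.le
  have hex : ∀ n : ℕ, ∃ x ∈ closedBall p ρ, ∀ z ∈ closedBall p ρ,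
      dist x q ^ 2 + dist x p ^ 2 + (n : ℝ) * (infDist x F ^ 2 + infDist x G ^ 2)
      ≤ dist z q ^ 2 + dist z p ^ 2 + (n : ℝ) * (infDist z F ^ 2 + infDist z G ^ 2) := by
    intro n
    have hc : Continuous fun z => dist z q ^ 2 + dist z p ^ 2
        + (n : ℝ) * (infDist z F ^ 2 + infDist z G ^ 2) := by
      have := continuous_infDist_pt F
      have := continuous_infDist_pt G
      fun_prop
    obtain ⟨x, hx, hmin⟩ := hK.exists_isMinOn ⟨p, hpK⟩ hc.continuousOn
    exact ⟨x, hx, fun z hz => hmin hz⟩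
  choose x hxK hx using hex
  obtain ⟨w, hwK, φ, hφ, hlim⟩ := hK.tendsto_subseq hxK
  have hbd : ∀ n, dist (x n) q ^ 2 + dist (x n) p ^ 2
      + (n : ℝ) * (infDist (x n) F ^ 2 + infDist (x n) G ^ 2) ≤ dist p q ^ 2 := by
    intro n
    have := hx n p hpK
    rw [infDist_zero_of_mem hp.1, infDist_zero_of_mem hp.2] at this
    simpa using this
  have hsum : infDist w F ^ 2 + infDist w G ^ 2 ≤ 0 := by
    have h1 : Filter.Tendsto (fun n => infDist (x (φ n)) F ^ 2 + infDist (x (φ n)) G ^ 2)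
        Filter.atTop (nhds (infDist w F ^ 2 + infDist w G ^ 2)) :=
      ((((continuous_infDist_pt F).tendsto w).comp hlim).pow 2).add
        ((((continuous_infDist_pt G).tendsto w).comp hlim).pow 2)
    have h2 : Filter.Tendsto (fun n => dist p q ^ 2 / ((φ n : ℕ) : ℝ)) Filter.atTop (nhds 0) :=
      (tendsto_const_div_atTop_nhds_zero_nat _).comp hφ.tendsto_atTop
    refine le_of_tendsto_of_tendsto h1 h2 ?_
    filter_upwards [hφ.tendsto_atTop.eventually (Filter.eventually_gt_atTop 0)] with n hn
    have hn' : (0 : ℝ) < (φ n : ℕ) := by exact_mod_cast hn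
    rw [le_div_iff₀ hn']
    have := hbd (φ n)
    nlinarith [sq_nonneg (dist (x (φ n)) q), sq_nonneg (dist (x (φ n)) p)]
  have hwF : w ∈ F := by
    rw [hF.1.mem_iff_infDist_zero ⟨p, hp.1⟩]
    nlinarith [sq_nonneg (infDist w F), sq_nonneg (infDist w G)]
  have hwG : w ∈ G := by
    rw [hG.1.mem_iff_infDist_zero ⟨p, hp.2⟩]
    nlinarith [sq_nonneg (infDist w F), sq_nonneg (infDist w G)]
  have hwb : dist w q ^ 2 + dist w p ^ 2 ≤ dist p q ^ 2 := by
    have h1 : Filter.Tendsto (fun n => dist (x (φ n)) q ^ 2 + dist (x (φ n)) p ^ 2)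
        Filter.atTop (nhds (dist w q ^ 2 + dist w p ^ 2)) :=
      ((hlim.dist tendsto_const_nhds).pow 2).add ((hlim.dist tendsto_const_nhds).pow 2)
    refine le_of_tendsto h1 (Filter.Eventually.of_forall fun n => ?_)
    have := hbd (φ n)
    have h2 : 0 ≤ ((φ n : ℕ) : ℝ) * (infDist (x (φ n)) F ^ 2 + infDist (x (φ n)) G ^ 2) := by
      positivity
    linarith
  have hwp : w = p := by
    have h1 : dist q p ≤ dist q w := by
      rw [hqp]; exact infDist_le_dist_of_mem ⟨hwF, hwG⟩
    rw [dist_comm q p, dist_comm q w] at h1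
    have h2 := pow_le_pow_left₀ dist_nonneg h1 2
    have h3 : dist w p ^ 2 ≤ 0 := by linarith
    exact dist_eq_zero.1 (pow_eq_zero_iff (two_ne_zero) |>.1 (le_antisymm h3 (sq_nonneg _)))
  subst hwp
  have hT : Filter.Tendsto (fun n => 2 * dist w q ^ 2 - dist (x (φ n)) q ^ 2
      + 2 * dist (x (φ n)) r ^ 2 + dist (x (φ n)) w ^ 2 - dist w r ^ 2) Filter.atTop
      (nhds (2 * dist w q ^ 2 - dist w q ^ 2 + 2 * dist w r ^ 2 + dist w w ^ 2
        - dist w r ^ 2)) := by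
    have hq : Filter.Tendsto (fun n => dist (x (φ n)) q) Filter.atTop (nhds (dist w q)) :=
      hlim.dist tendsto_const_nhds
    have hr : Filter.Tendsto (fun n => dist (x (φ n)) r) Filter.atTop (nhds (dist w r)) :=
      hlim.dist tendsto_const_nhds
    have hw : Filter.Tendsto (fun n => dist (x (φ n)) w) Filter.atTop (nhds (dist w w)) :=
      hlim.dist tendsto_const_nhds
    exact ((((hq.pow 2).const_sub _).add ((hr.pow 2).const_mul 2)).add (hw.pow 2)).sub_const _
  have hfin := ge_of_tendsto hT (b := dist q r ^ 2) (by
    filter_upwards [hlim.eventually (ball_mem_nhds w (by positivity : 0 < ρ / 4))] with n hn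
    exact QC.main_ineq hgeo hcurv hF hG hp hr hK hn (Nat.cast_nonneg (φ n)) (hx (φ n)))
  rw [dist_self] at hfin
  rw [dist_comm q w]
  linarith
end

section
/- Let X be a complete, locally compact, geodesic metric space of finite Hausdorff dimension whose metric has curvature ≥ 0 in the comparison sense, let γ : X → X be a surjective isometry of X onto itself, and let F = {x ∈ X : γ(x) = x} be its fixed point set. Then F is a quasi-convex subset of X; that is, F is closed, and whenever q ∈ X \ F and p ∈ F satisfy d(q,p) = infDist(q,F), then for every r ∈ F one has d(q,r)² ≤ d(q,p)² + d(p,r)². -/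
open Metric

/-- Comparison inner product at `x`. -/
noncomputable def ipAt {X : Type*} [MetricSpace X] (x a b : X) : ℝ :=
  (dist x a ^ 2 + dist x b ^ 2 - dist a b ^ 2) / 2

def IsMid {X : Type*} [MetricSpace X] (a b m : X) : Prop :=
  dist a m = dist a b / 2 ∧ dist m b = dist a b / 2

def MedianIneq (X : Type*) [MetricSpace X] : Prop :=
  ∀ a b m z : X, IsMid a b m →
    dist a z ^ 2 + dist b z ^ 2 ≤ 2 * dist m z ^ 2 + dist a b ^ 2 / 2

lemma arg_mem {l w t : ℝ} (hl : 0 < l) (hw : 0 < w) (h1 : t ≤ l + w) (h2 : l ≤ t + w)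
    (h3 : w ≤ t + l) :
    -1 ≤ (l ^ 2 + w ^ 2 - t ^ 2) / (2 * l * w) ∧ (l ^ 2 + w ^ 2 - t ^ 2) / (2 * l * w) ≤ 1 := by
  have hp : 0 < 2 * l * w := by positivity
  constructor
  · rw [le_div_iff₀ hp]; nlinarith
  · rw [div_le_iff₀ hp]; nlinarith

lemma median_of_curv {X : Type*} [MetricSpace X] (hcurv : CurvCompGE0 X) : MedianIneq X := by
  intro a b m z ⟨h1, h2⟩
  by_cases hab : a = b
  · subst hab
    have : a = m := by
      rw [← dist_eq_zero]; simpa using h1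
    subst this
    simp; linarith
  have hL : 0 < dist a b := dist_pos.2 hab
  by_cases hz : z = m
  · subst hz
    rw [h1, dist_comm b z, h2]; simp; nlinarith
  have ham : a ≠ m := by intro h; subst h; simp at h1; linarith
  have hbm : b ≠ m := by intro h; subst h; simp at h2; linarith
  have H := hcurv m a b z ham hbm hz
  have hw : 0 < dist m z := dist_pos.2 (Ne.symm hz)
  have hl : 0 < dist a b / 2 := by linarith
  unfold compAngle₀ at H
  have hma : dist m a = dist a b / 2 := by rw [dist_comm, h1]
  rw [hma, h2] at H
  set l := dist a b / 2 with hldef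
  have hab2 : dist a b = 2 * l := by rw [hldef]; ring
  have e1 : (l ^ 2 + l ^ 2 - dist a b ^ 2) / (2 * l * l) = -1 := by
    rw [hab2]; field_simp; ring
  rw [e1, Real.arccos_neg_one] at H
  have t1 := dist_triangle b m z
  have t2 := dist_triangle m b z
  have t3 := dist_triangle m z b
  have t4 := dist_triangle a m z
  have t5 := dist_triangle m a z
  have t6 := dist_triangle m z a
  rw [dist_comm b m] at t1
  rw [dist_comm z b] at t3
  rw [dist_comm z a] at t6
  obtain ⟨u1, u2⟩ := arg_mem (t := dist b z) hl hw (by linarith) (by linarith) (by linarith)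
  obtain ⟨v1, v2⟩ := arg_mem (t := dist z a) hw hl (by rw [dist_comm z a]; linarith)
    (by rw [dist_comm z a]; linarith) (by rw [dist_comm z a]; linarith)
  set u := (l ^ 2 + dist m z ^ 2 - dist b z ^ 2) / (2 * l * dist m z) with hu
  set v := (dist m z ^ 2 + l ^ 2 - dist z a ^ 2) / (2 * dist m z * l) with hv
  have H2 : Real.arccos u ≤ Real.arccos (-v) := by rw [Real.arccos_neg]; linarith
  have H3 : -v ≤ u := (Real.strictAntiOn_arccos.le_iff_ge ⟨u1, u2⟩ ⟨by linarith, by linarith⟩).1 H2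
  have H4 : 0 ≤ (u + v) * (2 * l * dist m z) :=
    mul_nonneg (by linarith) (by positivity)
  have H5 : (u + v) * (2 * l * dist m z) =
      (l ^ 2 + dist m z ^ 2 - dist b z ^ 2) + (dist m z ^ 2 + l ^ 2 - dist z a ^ 2) := by
    rw [hu, hv]; field_simp
  rw [H5, dist_comm z a] at H4
  rw [hab2]; nlinarith

section
variable {X : Type*} [MetricSpace X]

lemma ipAt_comm (x a b : X) : ipAt x a b = ipAt x b a := by
  unfold ipAt; rw [dist_comm a b]; ring

lemma ipAt_ge (x a b : X) : -(dist x a * dist x b) ≤ ipAt x a b := by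
  unfold ipAt
  have h := dist_triangle a x b
  rw [dist_comm a x] at h
  nlinarith [dist_nonneg (x := a) (y := b), dist_nonneg (x := x) (y := b),
    dist_nonneg (x := x) (y := a)]

lemma ipAt_half (hM : MedianIneq X) {x b m : X} (a : X) (h : IsMid x b m) :
    ipAt x a m ≤ ipAt x a b / 2 := by
  have := hM x b m a h
  unfold ipAt
  rw [h.1, dist_comm a m, dist_comm a b]
  nlinarith

lemma core_mid (hM : MedianIneq X) {x A' A B m : X} (h : IsMid x A' A) (h' : IsMid A B m) :
    dist x m ^ 2 ≤ 3 / 4 * dist A B ^ 2 + 3 / 2 * dist x A ^ 2 - dist A' B ^ 2 / 2 := by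
  have h1 := hM x A' A m h
  have h2 := hM A B m A' h'
  rw [h'.1] at h1
  rw [h.2, dist_comm B A', dist_comm m A'] at h2
  rw [h.1]
  nlinarith

lemma ipAt_mid (hM : MedianIneq X) {A B m : X} (x r : X) (h' : IsMid A B m) :
    ipAt x r m ≤ ipAt x r A / 2 + ipAt x r B / 2 + (dist x m ^ 2 + dist A B ^ 2 / 4) / 2 := by
  have h2 := hM A B m r h'
  unfold ipAt
  rw [dist_comm r m, dist_comm r A, dist_comm r B]
  nlinarith [sq_nonneg (dist x A), sq_nonneg (dist x B)]

def IsChain' (x : X) (A : ℕ → X) : Prop := ∀ n, IsMid x (A n) (A (n + 1))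

lemma chain_exists (hgeo : GeodesicSpace X) (x y : X) : ∃ A : ℕ → X, A 0 = y ∧ IsChain' x A := by
  choose mid hmid using hgeo
  refine ⟨fun n => (mid x)^[n] y, rfl, fun n => ?_⟩
  show IsMid _ _ ((mid x)^[n+1] y)
  rw [Function.iterate_succ_apply']
  exact hmid _ _

lemma chain_dist {x : X} {A : ℕ → X} (h : IsChain' x A) (n : ℕ) :
    dist x (A n) = dist x (A 0) / 2 ^ n := by
  induction n with
  | zero => simp
  | succ k ih => rw [(h k).1, ih, pow_succ]; field_simp

lemma chain_shift {x : X} {A : ℕ → X} (h : IsChain' x A) (j : ℕ) :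
    IsChain' x (fun n => A (n + j)) := by
  intro n
  have := h (n + j)
  rwa [show n + j + 1 = n + 1 + j by ring] at this

lemma chain_ip (hM : MedianIneq X) {x : X} {A : ℕ → X} (h : IsChain' x A) (r : X) :
    Antitone (fun n => 2 ^ n * ipAt x r (A n)) := by
  apply antitone_nat_of_succ_le
  intro n
  have := ipAt_half hM r (h n)
  have h2 : (0:ℝ) < 2 ^ n := by positivity
  rw [pow_succ]
  nlinarith

lemma chain_ip' (hM : MedianIneq X) {x : X} {A : ℕ → X} (h : IsChain' x A) (r : X) (n : ℕ) :
    2 ^ n * ipAt x r (A n) ≤ ipAt x r (A 0) := by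
  have := chain_ip hM h r (Nat.zero_le n)
  simpa using this

lemma G_anti (hM : MedianIneq X) {x : X} {A B : ℕ → X} (hA : IsChain' x A) (hB : IsChain' x B)
    {i i' k k' : ℕ} (hi : i ≤ i') (hk : k ≤ k') :
    2 ^ i' * (2 ^ k' * ipAt x (A i') (B k')) ≤ (2 ^ i * (2 ^ k * ipAt x (A i) (B k)) : ℝ) := by
  have h1 := chain_ip hM hB (A i') hk
  have h2 := chain_ip hM hA (B k) hi
  simp only at h1 h2
  rw [ipAt_comm x (B k), ipAt_comm x (B k)] at h2
  have p1 : (0:ℝ) ≤ 2 ^ i' := by positivity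
  have p2 : (0:ℝ) ≤ 2 ^ k := by positivity
  have := mul_le_mul_of_nonneg_left h1 p1
  have := mul_le_mul_of_nonneg_left h2 p2
  nlinarith

lemma J_exists (hM : MedianIneq X) {x : X} {A B : ℕ → X} (hA : IsChain' x A) (hB : IsChain' x B) :
    ∃ J : ℝ, (∀ i k, J ≤ 2 ^ i * (2 ^ k * ipAt x (A i) (B k))) ∧
      ∀ j, Filter.Tendsto (fun n => (2 ^ n * (2 ^ (n + j) * ipAt x (A n) (B (n + j))) : ℝ))
        Filter.atTop (nhds J) := by
  have hanti : Antitone (fun n => (2 ^ n * (2 ^ n * ipAt x (A n) (B n)) : ℝ)) :=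
    fun i k h => G_anti hM hA hB h h
  have hbdd : BddBelow (Set.range (fun n => (2 ^ n * (2 ^ n * ipAt x (A n) (B n)) : ℝ))) := by
    refine ⟨-(dist x (A 0) * dist x (B 0)), ?_⟩
    rintro _ ⟨n, rfl⟩
    have h1 := ipAt_ge x (A n) (B n)
    rw [chain_dist hA n, chain_dist hB n] at h1
    have p1 : (0:ℝ) < 2 ^ n := by positivity
    have h2 := mul_le_mul_of_nonneg_left h1 (mul_pos p1 p1).le
    have e : (2 ^ n * 2 ^ n : ℝ) * -(dist x (A 0) / 2 ^ n * (dist x (B 0) / 2 ^ n)) =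
      -(dist x (A 0) * dist x (B 0)) := by field_simp
    simp only
    rw [e] at h2
    linarith
  have ht := tendsto_atTop_ciInf hanti hbdd
  set J := ⨅ n, (2 ^ n * (2 ^ n * ipAt x (A n) (B n)) : ℝ) with hJ
  have hle : ∀ i k, J ≤ 2 ^ i * (2 ^ k * ipAt x (A i) (B k)) := by
    intro i k
    exact (ciInf_le hbdd (max i k)).trans
      (G_anti hM hA hB (le_max_left i k) (le_max_right i k))
  refine ⟨J, hle, fun j => ?_⟩
  refine tendsto_of_tendsto_of_tendsto_of_le_of_le tendsto_const_nhds ht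
    (fun n => hle _ _) (fun n => G_anti hM hA hB le_rfl (Nat.le_add_right n j))

set_option maxHeartbeats 1000000 in
lemma key_ineq (hgeo : GeodesicSpace X) (hM : MedianIneq X) {x r : X} {A B : ℕ → X}
    (hA : IsChain' x A) (hB : IsChain' x B) {J a s d : ℝ} (ha : 0 ≤ a)
    (hslope : ∀ y, -ipAt x r y ≤ a * dist x y)
    (hJ : ∀ i k, J ≤ 2 ^ i * (2 ^ k * ipAt x (A i) (B k)))
    (hlim : Filter.Tendsto (fun n => (2 ^ n * (2 ^ n * ipAt x (A n) (B n)) : ℝ))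
        Filter.atTop (nhds J)) (hs : s = dist x (A 0)) (hd : d = dist x (B 0)) (hs0 : 0 < s) :
    (-ipAt x r (A 0) - ipAt x r (B 0)) * s ≤ a * (s ^ 2 + d ^ 2 / 2 + J) := by
  set g : ℕ → ℝ := fun n => 2 ^ n * (2 ^ n * ipAt x (A n) (B n)) with hg
  have hd0 : 0 ≤ d := hd ▸ dist_nonneg
  have hstep : ∀ n, (-ipAt x r (A 0) - ipAt x r (B 0)) * s ≤
      a * (s ^ 2 + d ^ 2 / 2 - 3 * J + 4 * g n) +
        s * ((s ^ 2 + d ^ 2 - 6 * J + 8 * g 0 + (s + d) ^ 2) * (1 / 2) ^ n) := by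
    intro n
    obtain ⟨m, hm1, hm2⟩ := hgeo (A (n+1)) (B (n+1))
    have hm : IsMid (A (n+1)) (B (n+1)) m := ⟨hm1, hm2⟩
    have c1 := core_mid hM (hA n) hm
    have c2 := ipAt_mid hM x r hm
    have c3 := hslope m
    have c4 := chain_ip' hM hA r (n+1)
    have c5 := chain_ip' hM hB r (n+1)
    have j1 := hJ (n+1) (n+1)
    have j2 : (2 ^ n * (2 ^ (n+1) * ipAt x (A n) (B (n+1))) : ℝ) ≤ g n :=
      G_anti hM hA hB le_rfl (Nat.le_succ n)
    have j3 : g n ≤ g 0 := G_anti hM hA hB (Nat.zero_le n) (Nat.zero_le n)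
    have dA := chain_dist hA (n+1)
    have dA' := chain_dist hA n
    have dB := chain_dist hB (n+1)
    rw [← hs] at dA dA'
    rw [← hd] at dB
    have tri : dist (A (n+1)) (B (n+1)) ≤ (s + d) / 2 ^ (n+1) := by
      have := dist_triangle (A (n+1)) x (B (n+1))
      rw [dist_comm (A (n+1)) x, dA, dB] at this
      rw [add_div]; exact this
    have tri0 := dist_nonneg (x := A (n+1)) (y := B (n+1))
    unfold ipAt at j1 j2
    rw [dA, dB] at j1
    rw [dA', dB] at j2
    rw [dA] at c1
    have hP : (0:ℝ) < 2 ^ n := by positivity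
    have hhalf : ((1:ℝ) / 2) ^ n = 1 / 2 ^ n := by rw [div_pow, one_pow]
    rw [hhalf]
    have hps : (2:ℝ) ^ (n + 1) = 2 ^ n * 2 := pow_succ _ _
    rw [hps] at c1 c4 c5 j1 j2 tri
    set P : ℝ := 2 ^ n with hPdef
    -- normalised variables
    obtain ⟨M, hMd⟩ : ∃ M, dist x m = M / (4 * P) := ⟨dist x m * (4 * P), by field_simp⟩
    obtain ⟨E, hE⟩ : ∃ E, dist (A (n+1)) (B (n+1)) = E / (2 * P) :=
      ⟨dist (A (n+1)) (B (n+1)) * (2 * P), by field_simp⟩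
    obtain ⟨E', hE'⟩ : ∃ E', dist (A n) (B (n+1)) = E' / (2 * P) :=
      ⟨dist (A n) (B (n+1)) * (2 * P), by field_simp⟩
    rw [hMd] at c1 c2 c3
    rw [hE] at c1 c2 j1 tri tri0
    rw [hE'] at c1 j2
    have k1 : J ≤ (s ^ 2 + d ^ 2 - E ^ 2) / 2 := by
      convert j1 using 1; field_simp
    have k2 : (4 * s ^ 2 + d ^ 2 - E' ^ 2) / 4 ≤ g n := by
      convert j2 using 1; field_simp; ring
    have k3 : M ^ 2 ≤ 3 * E ^ 2 + 6 * s ^ 2 - 2 * E' ^ 2 := by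
      have := mul_le_mul_of_nonneg_right c1 (by positivity : 0 ≤ 16 * P ^ 2)
      have w1 : (M / (4 * P)) ^ 2 * (16 * P ^ 2) = M ^ 2 := by
        rw [div_pow]; field_simp; try ring
      have w2 : (E / (2 * P)) ^ 2 * (16 * P ^ 2) = 4 * E ^ 2 := by
        rw [div_pow]; field_simp; try ring
      have w3 : (E' / (2 * P)) ^ 2 * (16 * P ^ 2) = 4 * E' ^ 2 := by
        rw [div_pow]; field_simp; try ring
      have w4 : (s / (P * 2)) ^ 2 * (16 * P ^ 2) = 4 * s ^ 2 := by
        rw [div_pow]; field_simp; try ring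
      rw [w1, sub_mul, add_mul, mul_assoc, mul_assoc, w2, w4] at this
      have w5 : (E' / (2 * P)) ^ 2 / 2 * (16 * P ^ 2) = 2 * E' ^ 2 := by linarith
      linarith
    have hM2 : M ^ 2 ≤ s ^ 2 + d ^ 2 - 6 * J + 8 * g n := by linarith
    have hE2 : E ≤ s + d := by
      rw [mul_comm P 2] at tri
      exact (div_le_div_iff_of_pos_right (by positivity)).1 tri
    have hE0 : 0 ≤ E := by
      have := mul_nonneg tri0 (by positivity : 0 ≤ 2 * P)
      rwa [div_mul_cancel₀] at this; positivity
    have hEsq : E ^ 2 ≤ (s + d) ^ 2 := by nlinarith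
    have k4 : -ipAt x r (A 0) - ipAt x r (B 0) ≤ a * M + (M ^ 2 + E ^ 2) / (8 * P) := by
      have e1 := mul_le_mul_of_nonneg_right c3 (by positivity : 0 ≤ 4 * P)
      have e2 := mul_le_mul_of_nonneg_right c2 (by positivity : 0 ≤ 4 * P)
      have e3 : a * (M / (4 * P)) * (4 * P) = a * M := by field_simp
      have e4 : ((M / (4 * P)) ^ 2 + (E / (2 * P)) ^ 2 / 4) / 2 * (4 * P) =
        (M ^ 2 + E ^ 2) / (8 * P) := by field_simp; ring
      rw [e3] at e1
      rw [add_mul, e4] at e2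
      linarith
    have k5 : (M ^ 2 + E ^ 2) / (8 * P) ≤
        (s ^ 2 + d ^ 2 - 6 * J + 8 * g 0 + (s + d) ^ 2) * (1 / P) := by
      rw [div_le_iff₀ (by positivity)]
      have : (s ^ 2 + d ^ 2 - 6 * J + 8 * g 0 + (s + d) ^ 2) * (1 / P) * (8 * P) =
        8 * (s ^ 2 + d ^ 2 - 6 * J + 8 * g 0 + (s + d) ^ 2) := by field_simp
      rw [this]
      have z1 := sq_nonneg M
      have z2 := sq_nonneg E
      linarith
    have k6 : M * s ≤ s ^ 2 + d ^ 2 / 2 - 3 * J + 4 * g n := by nlinarith [sq_nonneg (M - s)]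
    have k7 := mul_le_mul_of_nonneg_left k6 ha
    have k8 := mul_le_mul_of_nonneg_right (k4.trans (add_le_add_right k5 _)) hs0.le
    linarith
  have hpow : Filter.Tendsto (fun n : ℕ => ((1:ℝ) / 2) ^ n) Filter.atTop (nhds 0) :=
    tendsto_pow_atTop_nhds_zero_of_lt_one (by norm_num) (by norm_num)
  have T := ((hlim.const_mul 4).const_add (s ^ 2 + d ^ 2 / 2 - 3 * J)).const_mul a |>.add
    ((hpow.const_mul (s ^ 2 + d ^ 2 - 6 * J + 8 * g 0 + (s + d) ^ 2)).const_mul s)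
  have := ge_of_tendsto' T hstep
  linarith

set_option maxHeartbeats 1000000 in
lemma step_lemma (hgeo : GeodesicSpace X) (hM : MedianIneq X) {x r y₀ : X}
    (hy₀ : ipAt x r y₀ < 0) {D η : ℝ} (hD : 0 < D) (hη : 0 < η) :
    ∃ (A : ℕ → X) (a h : ℝ), 0 < a ∧ a ≤ dist x r ∧ 0 < h ∧ ∀ n : ℕ,
      dist x (A n) = a * (h / 2 ^ n) ∧ ∀ y, dist x y ≤ D →
        dist (A n) y ^ 2 ≤ dist x y ^ 2 - 2 * (h / 2 ^ n) * (-ipAt x r y - η)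
          + a ^ 2 * (h / 2 ^ n) ^ 2 := by
  have hxx : ipAt x r x = 0 := by unfold ipAt; rw [dist_comm r x]; simp
  have hy₀x : 0 < dist x y₀ := by
    rw [dist_pos]; rintro rfl; rw [hxx] at hy₀; exact lt_irrefl _ hy₀
  set S : Set ℝ := {t | ∃ y, 0 < dist x y ∧ t = -ipAt x r y / dist x y} with hS
  have hub : ∀ t ∈ S, t ≤ dist x r := by
    rintro t ⟨y, hy, rfl⟩
    rw [div_le_iff₀ hy]
    have := ipAt_ge x r y
    linarith
  have hbdd : BddAbove S := ⟨_, hub⟩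
  have hmem : -ipAt x r y₀ / dist x y₀ ∈ S := ⟨y₀, hy₀x, rfl⟩
  set a := sSup S with haS
  have ha : 0 < a := lt_of_lt_of_le (div_pos (by linarith) hy₀x) (le_csSup hbdd hmem)
  have har : a ≤ dist x r := csSup_le ⟨_, hmem⟩ hub
  have hslope : ∀ y, -ipAt x r y ≤ a * dist x y := by
    intro y
    rcases (dist_nonneg (x := x) (y := y)).eq_or_lt with h | h
    · have : x = y := dist_eq_zero.1 h.symm
      subst this; rw [hxx]; simp
    · rw [← div_le_iff₀ h]
      exact le_csSup hbdd ⟨y, h, rfl⟩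
  set ε := η ^ 2 / (4 * a * D ^ 2) with hε
  have hε0 : 0 < ε := by positivity
  obtain ⟨t, ⟨x₀, hx₀, rfl⟩, ht⟩ := exists_lt_of_lt_csSup ⟨_, hmem⟩ (show a - ε < a by linarith)
  rw [lt_div_iff₀ hx₀] at ht
  obtain ⟨C, hC0, hC⟩ := chain_exists hgeo x x₀
  obtain ⟨N, hN⟩ : ∃ N : ℕ, dist x x₀ / 2 ^ N ≤ a * D ^ 2 / η := by
    obtain ⟨N, hN⟩ := pow_unbounded_of_one_lt (dist x x₀ / (a * D ^ 2 / η)) (one_lt_two)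
    refine ⟨N, ?_⟩
    rw [div_lt_iff₀ (by positivity)] at hN
    rw [div_le_iff₀ (by positivity)]
    linarith
  set A : ℕ → X := fun n => C (n + N) with hAdef
  have hA : IsChain' x A := chain_shift hC N
  have hA0 : A 0 = C N := by simp [hAdef]
  set s := dist x (A 0) with hsdef
  have hs : s = dist x x₀ / 2 ^ N := by rw [hsdef, hA0, chain_dist hC N, hC0]
  have hs0 : 0 < s := by rw [hs]; positivity
  have hsl : (a - ε) * s ≤ -ipAt x r (A 0) := by
    have h1 := chain_ip' hM hC r N
    rw [hC0] at h1
    rw [hA0, hs, ← mul_div_assoc, div_le_iff₀ (by positivity)]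
    linarith
  refine ⟨A, a, s / a, ha, har, by positivity, fun n => ⟨?_, fun y hy => ?_⟩⟩
  · rw [chain_dist hA n, ← hsdef]; field_simp
  obtain ⟨B, hB0, hB⟩ := chain_exists hgeo x y
  obtain ⟨J, hJ, hlim⟩ := J_exists hM hA hB
  obtain ⟨j, hj1, hj2⟩ : ∃ j : ℕ, a * D ^ 2 / (s * η) ≤ 2 ^ j ∧
      (2:ℝ) ^ j ≤ 2 * (a * D ^ 2 / (s * η)) := by
    have h1 : 1 ≤ a * D ^ 2 / (s * η) := by
      rw [← hs, le_div_iff₀ hη] at hN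
      rw [le_div_iff₀ (by positivity)]; linarith
    obtain ⟨j, hja, hjb⟩ := exists_nat_pow_near h1 (one_lt_two)
    refine ⟨j + 1, hjb.le, ?_⟩
    rw [pow_succ]; linarith
  have hQ : (0:ℝ) < 2 ^ j := by positivity
  set Q : ℝ := 2 ^ j with hQdef
  have K := key_ineq hgeo hM (J := J / Q) hA (chain_shift hB j) ha.le hslope
    (by
      intro i k
      rw [div_le_iff₀ hQ]
      have := hJ i (k + j)
      rw [pow_add] at this
      linarith)
    (by
      have := (hlim j).div_const Q
      refine this.congr (fun n => ?_)
      rw [pow_add, ← hQdef]; field_simp)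
    hsdef rfl hs0
  simp only [zero_add] at K
  have hBj := chain_ip' hM hB r j
  rw [hB0, ← hQdef] at hBj
  rw [chain_dist hB j, hB0, ← hQdef] at K
  set d := dist x y with hd
  have hd0 : 0 ≤ d := dist_nonneg
  have hJlow : (-ipAt x r y - η) * s ≤ a * J := by
    have K2 : (Q * ((a - ε) * s) - ipAt x r y) * s ≤ a * (Q * s ^ 2 + d ^ 2 / Q / 2 + J) := by
      have h1 := mul_le_mul_of_nonneg_left K hQ.le
      have h2 : Q * (a * (s ^ 2 + (d / Q) ^ 2 / 2 + J / Q)) =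
        a * (Q * s ^ 2 + d ^ 2 / Q / 2 + J) := by field_simp
      rw [h2] at h1
      refine le_trans ?_ h1
      rw [← mul_assoc Q (-ipAt x r (A 0) - ipAt x r (B j))]
      apply mul_le_mul_of_nonneg_right _ hs0.le
      have := mul_le_mul_of_nonneg_left hsl hQ.le
      nlinarith
    have b1 : Q * ε * s ≤ η / 2 := by
      have : Q * ε * s ≤ 2 * (a * D ^ 2 / (s * η)) * ε * s := by gcongr
      refine this.trans (le_of_eq ?_)
      rw [hε]; field_simp; ring
    have b2 : a * (d ^ 2 / Q / 2) ≤ η / 2 * s := by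
      rw [div_le_iff₀ (by positivity)] at hj1
      have : d ^ 2 ≤ D ^ 2 := by gcongr
      have h3 : a * d ^ 2 ≤ Q * (s * η) := (mul_le_mul_of_nonneg_left this ha.le).trans hj1
      have h4 : a * (d ^ 2 / Q / 2) = a * d ^ 2 / (2 * Q) := by field_simp
      rw [h4, div_le_iff₀ (by positivity)]
      linarith
    nlinarith
  have hJ1 := hJ n 0
  rw [hB0] at hJ1
  simp only [pow_zero, one_mul] at hJ1
  unfold ipAt at hJ1
  rw [chain_dist hA n, ← hsdef, ← hd] at hJ1
  have hP : (0:ℝ) < 2 ^ n := by positivity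
  set P : ℝ := 2 ^ n with hPdef
  have f1 : J / P ≤ ((s / P) ^ 2 + d ^ 2 - dist (A n) y ^ 2) / 2 := by
    rw [div_le_iff₀ hP]; linarith
  have f2 : (s / a / P) * (-ipAt x r y - η) ≤ J / P := by
    rw [le_div_iff₀ hP]
    have : s / a / P * (-ipAt x r y - η) * P = ((-ipAt x r y - η) * s) / a := by field_simp
    rw [this, div_le_iff₀ ha]; linarith
  have f3 : a ^ 2 * (s / a / P) ^ 2 = (s / P) ^ 2 := by field_simp
  rw [f3]
  nlinarith

end

set_option maxHeartbeats 1000000 in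
/-- Near-minimisers of the penalised functional must lie on the boundary sphere. -/
lemma not_interior {X : Type*} [MetricSpace X] (hgeo : GeodesicSpace X) (hM : MedianIneq X)
    {γ : X → X} (hiso : Isometry γ) (hsurj : Function.Surjective γ) {p q r x : X}
    (hr : γ r = r) {c ρ θ K : ℝ} (hc : 0 < c) (hK : 0 ≤ K) (hθ : 0 ≤ θ)
    (hip : ipAt x r q ≤ -c) (hKδ : K * dist x (γ x) ^ 2 ≤ c / 4) (hθr : θ * dist x r ≤ c / 2)
    (hint : dist x p < ρ) :
    ∃ x', dist x' p ≤ ρ ∧ dist x' q ^ 2 + K * dist x' (γ x') ^ 2 + θ * dist x' p <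
      dist x q ^ 2 + K * dist x (γ x) ^ 2 + θ * dist x p := by
  set δ := dist x (γ x) with hδ
  have hδ0 : 0 ≤ δ := dist_nonneg
  have hη : 0 < c / (4 + 16 * K) := by positivity
  set η := c / (4 + 16 * K) with hηd
  have hη2 : 2 * η + 8 * K * η = c / 2 := by rw [hηd]; field_simp; ring
  have hDpos : 0 < dist x q + δ + 1 := by positivity
  obtain ⟨A, a, h₀, ha, har, hh₀, H⟩ := step_lemma hgeo hM (x := x) (r := r) (y₀ := q)
    (by linarith) hDpos hη
  have hpow : Filter.Tendsto (fun n : ℕ => h₀ / (2:ℝ) ^ n) Filter.atTop (nhds 0) := by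
    have := (tendsto_pow_atTop_nhds_zero_of_lt_one (r := (1:ℝ)/2) (by norm_num) (by norm_num)).const_mul h₀
    rw [mul_zero] at this
    refine this.congr (fun n => ?_)
    rw [div_pow, one_pow]; ring
  have e1 : ∀ᶠ n : ℕ in Filter.atTop, h₀ / (2:ℝ) ^ n < (ρ - dist x p) / a :=
    hpow.eventually_lt_const (div_pos (by linarith) ha)
  have e2 : ∀ᶠ n : ℕ in Filter.atTop, h₀ / (2:ℝ) ^ n < c / 2 / (a ^ 2 * (1 + 4 * K)) :=
    hpow.eventually_lt_const (by positivity)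
  obtain ⟨n, hn1, hn2⟩ := (e1.and e2).exists
  obtain ⟨hd, Hy⟩ := H n
  have hh : 0 < h₀ / (2:ℝ) ^ n := by positivity
  set h := h₀ / (2:ℝ) ^ n with hhd
  set x' := A n with hx'
  rw [lt_div_iff₀ ha] at hn1
  rw [lt_div_iff₀ (by positivity)] at hn2
  have hxp : dist x' p ≤ dist x p + a * h := by
    have := dist_triangle x' x p
    rw [dist_comm x' x, hd] at this
    linarith
  refine ⟨x', by linarith, ?_⟩
  have Hq := Hy q (by linarith)
  obtain ⟨m, hm1, hm2⟩ := hgeo x (γ x)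
  have hm : IsMid x (γ x) m := ⟨hm1, hm2⟩
  obtain ⟨m', rfl⟩ := hsurj m
  have hrγ : ∀ z, dist r (γ z) = dist r z := by
    intro z; rw [← hiso.dist_eq r z, hr]
  have hfm := hM _ _ _ r hm
  rw [dist_comm x r, dist_comm (γ x) r, dist_comm (γ m') r, hrγ x, ← hδ] at hfm
  have hxm' : dist x m' = δ / 2 := by
    rw [← hiso.dist_eq, dist_comm, hm2]
  have i1 : -(δ ^ 2 / 4) ≤ -ipAt x r (γ m') := by
    unfold ipAt
    rw [hm1, ← hδ, dist_comm x r]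
    nlinarith
  have i2 : -(δ ^ 2 / 4) ≤ -ipAt x r m' := by
    unfold ipAt
    rw [hxm', dist_comm x r]
    rw [hrγ m'] at hfm
    nlinarith
  have H1 := Hy (γ m') (by rw [hm1]; linarith [dist_nonneg (x := x) (y := q)])
  have H2 := Hy m' (by rw [hxm']; linarith [dist_nonneg (x := x) (y := q)])
  rw [hm1, ← hδ] at H1
  rw [hxm'] at H2
  have tri : dist x' (γ x') ≤ dist x' (γ m') + dist x' m' := by
    have := dist_triangle x' (γ m') (γ x')
    rwa [hiso.dist_eq m' x', dist_comm m' x'] at this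
  have hsq : dist x' (γ x') ^ 2 ≤ δ ^ 2 + 2 * h * δ ^ 2 + 8 * h * η + 4 * (a ^ 2 * h ^ 2) := by
    have t1 : dist x' (γ x') ^ 2 ≤ (dist x' (γ m') + dist x' m') ^ 2 := by gcongr
    have t2 := sq_nonneg (dist x' (γ m') - dist x' m')
    have t3 := mul_le_mul_of_nonneg_left i1 hh.le
    have t4 := mul_le_mul_of_nonneg_left i2 hh.le
    linarith
  have s1 := mul_le_mul_of_nonneg_left hsq hK
  have s2 := mul_le_mul_of_nonneg_left hxp hθ
  have s3 : θ * a ≤ c / 2 := (mul_le_mul_of_nonneg_left har hθ).trans hθr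
  have s4 := mul_le_mul_of_nonneg_left s3 hh.le
  have s5 := mul_le_mul_of_nonneg_left hip hh.le
  have s6 := mul_le_mul_of_nonneg_left hKδ hh.le
  have s7 := mul_lt_mul_of_pos_left hn2 hh
  have s8 : h * (2 * η + 8 * K * η) = h * (c / 2) := by rw [hη2]
  have s9 := mul_pos hh hc
  linarith

/-- The fixed point set of a (surjective) isometry of `X` is quasi-convex. -/
theorem fixedPointSet_isQuasiConvex {X : Type*} [MetricSpace X] [CompleteSpace X]
    [LocallyCompactSpace X]
    (hdim : dimH (Set.univ : Set X) < ⊤)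
    (hgeo : GeodesicSpace X) (hcurv : CurvCompGE0 X)
    (γ : X → X) (hiso : Isometry γ) (hsurj : Function.Surjective γ) :
    IsQuasiConvex {x : X | γ x = x} := by
  have hM := median_of_curv hcurv
  have hγc : Continuous γ := hiso.continuous
  refine ⟨isClosed_eq hγc continuous_id, ?_⟩
  intro q p hq hp hinf r hr
  simp only [Set.mem_ofPred_eq] at hp hr
  by_contra hcon
  push Not at hcon
  have hpos : ipAt p r q < 0 := by
    unfold ipAt
    rw [dist_comm r q, dist_comm p q]; linarith
  obtain ⟨c, hc, hcp⟩ : ∃ c, 0 < c ∧ ipAt p r q < -c :=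
    ⟨-ipAt p r q / 2, by linarith, by linarith⟩
  have hcont : Continuous (fun x => ipAt x r q) := by unfold ipAt; fun_prop
  have ev1 : ∀ᶠ x in nhds p, ipAt x r q < -c := hcont.continuousAt.eventually_lt_const hcp
  have hcont2 : Continuous (fun x => dist x q ^ 2) := by fun_prop
  have ev2 : ∀ᶠ x in nhds p, dist p q ^ 2 - c / 4 < dist x q ^ 2 :=
    hcont2.continuousAt.eventually_const_lt (by linarith)
  obtain ⟨U, hU, hUn⟩ := exists_compact_mem_nhds p
  obtain ⟨ρ, hρ, hball⟩ := Metric.nhds_basis_closedBall.mem_iff.1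
    (Filter.inter_mem hUn (ev1.and ev2))
  have hcpt : IsCompact (closedBall p ρ) :=
    hU.of_isClosed_subset isClosed_closedBall (fun z hz => (hball hz).1)
  set R := dist p r + ρ with hR
  have hR0 : 0 < R := by positivity
  set θ := c / 2 / R with hθd
  have hθ : 0 < θ := by positivity
  have hpF : p ∈ closedBall p ρ := mem_closedBall_self hρ.le
  have claim : ∀ K : ℝ, 0 ≤ K → ∃ x ∈ closedBall p ρ, dist x q ^ 2 + θ * ρ ≤ dist p q ^ 2 ∧
      K * dist x (γ x) ^ 2 ≤ dist p q ^ 2 := by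
    intro K hK
    obtain ⟨x, hx, hmin⟩ := hcpt.exists_isMinOn ⟨p, hpF⟩
      (f := fun x => dist x q ^ 2 + K * dist x (γ x) ^ 2 + θ * dist x p)
      (by fun_prop)
    have hxp : dist x p ≤ ρ := hx
    have hle := hmin hpF
    simp only [Set.mem_ofPred_eq, hp, dist_self] at hle
    have hx2 := hball hx
    have hn1 : 0 ≤ K * dist x (γ x) ^ 2 := by positivity
    have hn2 : 0 ≤ θ * dist x p := by positivity
    have hn3 : 0 ≤ dist x q ^ 2 := by positivity
    rcases hxp.lt_or_eq with hlt | heq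
    · exfalso
      have hx3 : dist p q ^ 2 - c / 4 < dist x q ^ 2 := hx2.2.2
      have hxr : dist x r ≤ R := by linarith [dist_triangle x p r]
      obtain ⟨x', hx'1, hx'2⟩ := not_interior hgeo hM hiso hsurj (p := p) (q := q) (r := r)
        (x := x) hr hc hK hθ.le (le_of_lt hx2.2.1) (by linarith)
        (by
          have := mul_le_mul_of_nonneg_left hxr hθ.le
          have e : θ * R = c / 2 := by rw [hθd]; field_simp
          linarith) hlt
      have := hmin (show x' ∈ closedBall p ρ from hx'1)
      simp only [Set.mem_ofPred_eq] at this
      linarith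
    · refine ⟨x, hx, ?_, ?_⟩
      · rw [heq] at hle; linarith
      · linarith
  set T := closedBall p ρ ∩ {x | dist x q ^ 2 + θ * ρ ≤ dist p q ^ 2} with hT
  have hTc : IsCompact T := hcpt.inter_right (isClosed_le (by fun_prop) continuous_const)
  obtain ⟨x₀, hx₀, hx₀', -⟩ := claim 0 le_rfl
  obtain ⟨z, hz, hzmin⟩ := hTc.exists_isMinOn ⟨x₀, hx₀, hx₀'⟩
    (f := fun x => dist x (γ x) ^ 2) (by fun_prop)
  have hz0 : γ z = z := by
    by_contra hne
    have hzp : 0 < dist z (γ z) := dist_pos.2 (Ne.symm hne)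
    obtain ⟨x, hx1, hx2, hx3⟩ := claim ((dist p q ^ 2 + 1) / dist z (γ z) ^ 2) (by positivity)
    have h1 := hzmin (show x ∈ T from ⟨hx1, hx2⟩)
    simp only [Set.mem_ofPred_eq] at h1
    have h2 := mul_le_mul_of_nonneg_left h1
      (show 0 ≤ (dist p q ^ 2 + 1) / dist z (γ z) ^ 2 by positivity)
    rw [div_mul_cancel₀ _ (by positivity)] at h2
    linarith
  have hz2 : dist z q ^ 2 + θ * ρ ≤ dist p q ^ 2 := hz.2
  have h3 : infDist q {x : X | γ x = x} ≤ dist q z := infDist_le_dist_of_mem hz0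
  rw [← hinf, dist_comm q p, dist_comm q z] at h3
  have h4 : dist p q ^ 2 ≤ dist z q ^ 2 := by gcongr
  have : 0 < θ * ρ := by positivity
  linarith
end

section
/- Let X be a complete, locally compact, geodesic metric space of finite Hausdorff dimension with diameter ≤ π whose metric has curvature ≥ 1 in the comparison sense, and suppose there exist z₁, z₂ ∈ X with d(z₁,z₂) = π (so X is a spherical suspension with poles z₁, z₂). Let F be a quasi-convex subset of X containing at least two points. Then either every x ∈ F satisfies d(x,z₁) = π/2, or there exist z̄₁, z̄₂ ∈ F with d(z̄₁,z̄₂) = π such that for every r ∈ F with 0 < d(z̄₁,r) < π and every x ∈ X satisfying d(z̄₁,x) + d(x,z̄₂) = π and d(x,r) = |d(z̄₁,x) − d(z̄₁,r)|, one has x ∈ F (that is, F is the spherical join of {z̄₁,z̄₂} with its intersection with the equator of the poles z̄₁, z̄₂). -/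
open Metric

/-- Spherical comparison angle at `p` between `x` and `y`. -/
noncomputable def compAngle₁ {X : Type*} [MetricSpace X] (x p y : X) : ℝ :=
  Real.arccos ((Real.cos (dist x y) - Real.cos (dist p x) * Real.cos (dist p y)) /
    (Real.sin (dist p x) * Real.sin (dist p y)))

/-- `X` has curvature `≥ 1` in the comparison sense. -/
def CurvCompGE1 (X : Type*) [MetricSpace X] : Prop :=
  (∀ x y : X, dist x y ≤ Real.pi) ∧
    ∀ p a b c : X, 0 < dist p a → dist p a < Real.pi → 0 < dist p b → dist p b < Real.pi →
      0 < dist p c → dist p c < Real.pi →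
      compAngle₁ a p b + compAngle₁ b p c + compAngle₁ c p a ≤ 2 * Real.pi

/-- `F` is a quasi-convex subset of `X` (comparison-angle formulation, curvature `≥ 1`). -/
def IsQuasiConvex₁ {X : Type*} [MetricSpace X] (F : Set X) : Prop :=
  IsClosed F ∧
    ∀ q p : X, q ∉ F → p ∈ F → dist q p = infDist q F →
      ∀ r ∈ F, Real.cos (dist q p) * Real.cos (dist p r) ≤ Real.cos (dist q r)


theorem qc_ang_pi {X : Type*} [MetricSpace X] {x p y : X}
    (h1 : 0 < dist p x) (h2 : dist p x < Real.pi) (h3 : 0 < dist p y) (h4 : dist p y < Real.pi)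
    (h : Real.cos (dist x y) ≤ Real.cos (dist p x + dist p y)) : compAngle₁ x p y = Real.pi := by
  have s1 := Real.sin_pos_of_pos_of_lt_pi h1 h2
  have s2 := Real.sin_pos_of_pos_of_lt_pi h3 h4
  unfold compAngle₁
  rw [Real.arccos_eq_pi, div_le_iff₀ (mul_pos s1 s2)]
  rw [Real.cos_add] at h
  linarith

theorem qc_ang_zero {X : Type*} [MetricSpace X] {x p y : X}
    (h1 : 0 < dist p x) (h2 : dist p x < Real.pi) (h3 : 0 < dist p y) (h4 : dist p y < Real.pi)
    (hd : dist x y ≤ Real.pi)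
    (h : compAngle₁ x p y ≤ 0) : dist x y ≤ |dist p x - dist p y| := by
  have s1 := Real.sin_pos_of_pos_of_lt_pi h1 h2
  have s2 := Real.sin_pos_of_pos_of_lt_pi h3 h4
  have h' : compAngle₁ x p y = 0 := le_antisymm h (Real.arccos_nonneg _)
  unfold compAngle₁ at h'
  rw [Real.arccos_eq_zero, le_div_iff₀ (mul_pos s1 s2)] at h'
  have h5 : Real.cos |dist p x - dist p y| ≤ Real.cos (dist x y) := by
    rw [Real.cos_abs, Real.cos_sub]; linarith
  by_contra hlt
  push Not at hlt
  have := Real.cos_lt_cos_of_nonneg_of_le_pi (abs_nonneg _) hd hlt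
  linarith

/-- Base `b`, two straight angles force the third comparison angle to vanish. -/
theorem qc_two {X : Type*} [MetricSpace X] (hc : CurvCompGE1 X) {b x y z : X}
    (hx : 0 < dist b x) (hx' : dist b x < Real.pi) (hy : 0 < dist b y) (hy' : dist b y < Real.pi)
    (hz : 0 < dist b z) (hz' : dist b z < Real.pi)
    (h1 : Real.cos (dist x y) ≤ Real.cos (dist b x + dist b y))
    (h2 : Real.cos (dist y z) ≤ Real.cos (dist b y + dist b z)) :
    dist x z ≤ |dist b x - dist b z| := by
  have := hc.2 b x y z hx hx' hy hy' hz hz'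
  rw [qc_ang_pi hx hx' hy hy' h1, qc_ang_pi hy hy' hz hz' h2] at this
  have h3 := qc_ang_zero hz hz' hx hx' (hc.1 _ _) (by linarith)
  rw [dist_comm x z, abs_sub_comm]
  exact h3

theorem qc_cos_pi {a : ℝ} (b : ℝ) (h : a = Real.pi) : Real.cos a ≤ Real.cos b := by
  rw [h, Real.cos_pi]; exact Real.neg_one_le_cos b

theorem qc_halve {X : Type*} [MetricSpace X] (hc : CurvCompGE1 X)
    {z₁ z₂ m k : X} (hz : dist z₁ z₂ = Real.pi) (hm : dist m z₂ = Real.pi)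
    (hne : 0 < dist m z₁) (hk1 : dist m k = dist m z₁ / 2) (hk2 : dist k z₁ = dist m z₁ / 2) :
    dist k z₂ = Real.pi := by
  have hpi := Real.pi_pos
  have hs := hc.1 m z₁
  by_contra hne'
  have hlt : dist k z₂ < Real.pi := lt_of_le_of_ne (hc.1 _ _) hne'
  have hkm : dist k m = dist m z₁ / 2 := by rw [dist_comm]; exact hk1
  have hpos : 0 < dist k z₂ := by
    have := dist_triangle z₁ k z₂
    rw [dist_comm z₁ k] at this
    linarith
  have := qc_two hc (b := k) (x := m) (y := z₁) (z := z₂) (by linarith) (by linarith)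
    (by linarith) (by linarith) hpos hlt
    (by rw [hkm, hk2]; apply le_of_eq; congr 1; ring) (qc_cos_pi _ hz)
  rw [hm, hkm] at this
  rcases abs_cases (dist m z₁ / 2 - dist k z₂) with h | h <;> linarith

theorem qc_unique0 {X : Type*} [MetricSpace X] (hc : CurvCompGE1 X) (hg : GeodesicSpace X)
    {z₁ z₂ m : X} (hz : dist z₁ z₂ = Real.pi) (hm : dist m z₂ = Real.pi)
    (hne : 0 < dist m z₁) (hlt : dist m z₁ < Real.pi) : False := by
  have hpi := Real.pi_pos
  obtain ⟨k, hk1, hk2⟩ := hg m z₁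
  have hkz := qc_halve hc hz hm hne hk1 hk2
  have hkm : dist k m = dist m z₁ / 2 := by rw [dist_comm]; exact hk1
  obtain ⟨y, hy1, hy2⟩ := hg k z₂
  rw [hkz] at hy1 hy2
  have hyk : dist y k = Real.pi / 2 := by rw [dist_comm]; exact hy1
  have key : ∀ a : X, dist a z₂ = Real.pi → dist k a = dist m z₁ / 2 →
      dist a y = dist m z₁ / 2 + Real.pi / 2 := by
    intro a ha hka
    have t1 := dist_triangle a y z₂
    have t2 := dist_triangle y k a
    rw [dist_comm a y] at t1
    have := qc_two hc (b := y) (x := k) (y := z₂) (z := a) (by linarith) (by linarith)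
      (by linarith) (by linarith) (by linarith) (by linarith) (qc_cos_pi _ hkz)
      (qc_cos_pi _ (by rw [dist_comm]; exact ha))
    rw [hka, hyk] at this
    rw [dist_comm a y]
    rcases abs_cases (Real.pi / 2 - dist y a) with h | h <;> linarith
  have e1 := key m hm hkm
  have e2 := key z₁ hz hk2
  have := qc_two hc (b := k) (x := m) (y := y) (z := z₁) (by linarith) (by linarith)
      (by linarith) (by linarith) (by linarith) (by linarith)
      (by rw [e1, hkm, hy1]) (by rw [dist_comm, e2, hk2, hy1, add_comm])
  rw [hkm, hk2, sub_self, abs_zero] at this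
  linarith

theorem qc_unique {X : Type*} [MetricSpace X] (hc : CurvCompGE1 X) (hg : GeodesicSpace X)
    {z₁ z₂ m : X} (hz : dist z₁ z₂ = Real.pi) (hm : dist m z₂ = Real.pi) : m = z₁ := by
  have hpi := Real.pi_pos
  by_contra hne
  have hpos : 0 < dist m z₁ := dist_pos.2 hne
  obtain ⟨k, hk1, hk2⟩ := hg m z₁
  have hs := hc.1 m z₁
  exact qc_unique0 hc hg hz (qc_halve hc hz hm hpos hk1 hk2) (by linarith) (by linarith)

theorem qc_sum_aux {X : Type*} [MetricSpace X] (hc : CurvCompGE1 X) (hg : GeodesicSpace X)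
    {z₁ z₂ : X} (hz : dist z₁ z₂ = Real.pi) (n : ℕ) :
    ∀ r, dist z₁ r + dist r z₂ - Real.pi ≤ dist z₁ r / 2 ^ n := by
  have hpi := Real.pi_pos
  induction n with
  | zero => intro r; have := hc.1 r z₂; simp; linarith
  | succ n ih =>
    intro r
    rcases eq_or_ne r z₁ with h | h
    · subst h; simp [hz]
    rcases eq_or_ne r z₂ with h' | h'
    · subst h'; simp [hz]; positivity
    have b2 : dist r z₂ < Real.pi :=
      lt_of_le_of_ne (hc.1 _ _) (fun e => h (qc_unique hc hg hz e))
    have b1 : dist z₁ r < Real.pi :=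
      lt_of_le_of_ne (hc.1 _ _) (fun e => h' (qc_unique hc hg (by rw [dist_comm]; exact hz)
        (by rw [dist_comm]; exact e)))
    have b3 : 0 < dist z₁ r := dist_pos.2 h.symm
    have b4 : 0 < dist r z₂ := dist_pos.2 h'
    obtain ⟨m, m1, m2⟩ := hg z₁ r
    have m1' : dist m z₁ = dist z₁ r / 2 := by rw [dist_comm]; exact m1
    have t := dist_triangle z₁ m z₂
    have b5 : dist m z₂ < Real.pi := by
      refine lt_of_le_of_ne (hc.1 _ _) (fun e => ?_)
      have := qc_unique hc hg hz e
      rw [this, dist_self] at m1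
      linarith
    have := qc_two hc (b := m) (x := r) (y := z₁) (z := z₂) (by linarith) (by linarith)
      (by linarith) (by linarith) (by linarith) b5
      (by rw [m2, m1', dist_comm]; apply le_of_eq; congr 1; ring) (qc_cos_pi _ hz)
    have ihm := ih m
    rw [m2] at this
    have e : dist z₁ r / 2 ^ (n + 1) = dist z₁ r / 2 / 2 ^ n := by
      rw [pow_succ]; field_simp
    rw [e, ← m1]
    rcases abs_cases (dist z₁ r / 2 - dist m z₂) with h | h <;> linarith

/-- In the presence of an antipodal pair, distances to it add up to `π`. -/
theorem qc_sum {X : Type*} [MetricSpace X] (hc : CurvCompGE1 X) (hg : GeodesicSpace X)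
    {z₁ z₂ : X} (hz : dist z₁ z₂ = Real.pi) (r : X) : dist z₁ r + dist r z₂ = Real.pi := by
  apply le_antisymm
  · have lim : Filter.Tendsto (fun n : ℕ => dist z₁ r / 2 ^ n) Filter.atTop (nhds 0) :=
      tendsto_const_nhds.div_atTop (tendsto_pow_atTop_atTop_of_one_lt (by norm_num))
    have := ge_of_tendsto' lim (fun n => qc_sum_aux hc hg hz n r)
    linarith
  · rw [← hz]; exact dist_triangle _ _ _

theorem qc_interp_le {X : Type*} [MetricSpace X] (hc : CurvCompGE1 X) (hg : GeodesicSpace X)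
    {w₁ w₂ : X} (hw : dist w₁ w₂ = Real.pi) {y x : X} (p : X)
    (hy : 0 < dist w₁ y) (hyx : dist w₁ y < dist w₁ x) (hx : dist w₁ x < Real.pi)
    (hd : dist y x = dist w₁ x - dist w₁ y) :
    Real.cos (dist p y) * Real.sin (dist w₁ x) ≤
      Real.cos (dist w₁ p) * Real.sin (dist w₁ x - dist w₁ y)
        + Real.cos (dist p x) * Real.sin (dist w₁ y) := by
  have hpi := Real.pi_pos
  have hsum := qc_sum hc hg hw
  have split : Real.sin (dist w₁ x) = Real.sin (dist w₁ y) * Real.cos (dist w₁ x - dist w₁ y)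
      + Real.cos (dist w₁ y) * Real.sin (dist w₁ x - dist w₁ y) := by
    rw [← Real.sin_add]; congr 1; ring
  rcases eq_or_ne p y with h | h
  · subst h
    rw [dist_self, Real.cos_zero, hd, split]
    linarith
  rcases eq_or_ne (dist p y) Real.pi with h' | h'
  · have s := qc_sum hc hg h'
    have s1 := s w₁
    have s2 := s x
    rw [dist_comm x y, hd] at s2
    rw [dist_comm p w₁] at s1
    have e1 : dist w₁ p = Real.pi - dist w₁ y := by linarith
    have e2 : dist p x = Real.pi - (dist w₁ x - dist w₁ y) := by linarith
    rw [h', e1, e2, Real.cos_pi, Real.cos_pi_sub, Real.cos_pi_sub, split]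
    linarith
  have p0 : 0 < dist y p := by rw [dist_comm]; exact dist_pos.2 h
  have p1 : dist y p < Real.pi := by rw [dist_comm]; exact lt_of_le_of_ne (hc.1 _ _) h'
  have C := hc.2 y w₁ x p (by rwa [dist_comm]) (by rw [dist_comm]; linarith) (by linarith)
    (by linarith) p0 p1
  rw [qc_ang_pi (by rwa [dist_comm]) (by rw [dist_comm]; linarith) (by linarith)
    (by linarith) (by rw [hd, dist_comm y w₁]; apply le_of_eq; congr 1; ring)] at C
  have C2 : compAngle₁ x y p ≤ Real.pi - compAngle₁ p y w₁ := by linarith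
  unfold compAngle₁ at C2
  rw [← Real.arccos_neg, dist_comm y w₁, hd, dist_comm x p, dist_comm p w₁, dist_comm y p] at C2
  rw [dist_comm y p] at p0 p1
  have g1 := Real.sin_pos_of_pos_of_lt_pi p0 p1
  have g2 := Real.sin_pos_of_pos_of_lt_pi hy (by linarith)
  have g3 := Real.sin_pos_of_pos_of_lt_pi (x := dist w₁ x - dist w₁ y) (by linarith) (by linarith)
  -- lower bound from perimeter
  have sp := hsum p
  have sx := hsum x
  have sy := hsum y
  have t1 := dist_triangle p w₁ y
  have t2 := dist_triangle p w₂ x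
  have t3 := dist_triangle p w₂ y
  have t4 := dist_triangle p y x
  have t5 := dist_triangle w₁ p y
  have t6 := dist_triangle w₁ y p
  have t7 := dist_triangle y p x
  have t8 := dist_triangle p x y
  have cosle : ∀ a b : ℝ, 0 ≤ a → a ≤ Real.pi → 0 ≤ b → a ≤ b → a + b ≤ 2 * Real.pi →
      Real.cos b ≤ Real.cos a := by
    intro a b ha hap hb hab hs
    rcases le_total b Real.pi with hbp | hbp
    · exact Real.cos_le_cos_of_nonneg_of_le_pi ha hbp hab
    · rw [← Real.cos_two_pi_sub b]
      exact Real.cos_le_cos_of_nonneg_of_le_pi ha (by linarith) (by linarith)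
  rw [dist_comm p w₁] at t1
  rw [dist_comm w₂ x, dist_comm] at t2
  rw [dist_comm w₂ y] at t3
  rw [dist_comm y p] at t6 t7
  rw [dist_comm x y] at t8
  rw [dist_comm x p] at t2
  have c1 := cosle (dist w₁ p) (dist p y + dist w₁ y) (dist_nonneg) (hc.1 _ _)
    (by positivity) (by linarith) (by linarith)
  have c2 := cosle (dist p x) (dist p y + (dist w₁ x - dist w₁ y)) (dist_nonneg) (hc.1 _ _)
    (by linarith) (by linarith) (by linarith)
  rw [Real.cos_add] at c1 c2
  have c3 : Real.cos (dist w₁ p) ≤ Real.cos (dist p y - dist w₁ y) := by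
    rw [← Real.cos_abs (dist p y - dist w₁ y)]
    apply Real.cos_le_cos_of_nonneg_of_le_pi (abs_nonneg _) (hc.1 _ _)
    rw [abs_le]; constructor <;> linarith
  have c4 : Real.cos (dist p x) ≤ Real.cos (dist p y - (dist w₁ x - dist w₁ y)) := by
    rw [← Real.cos_abs (dist p y - (dist w₁ x - dist w₁ y))]
    apply Real.cos_le_cos_of_nonneg_of_le_pi (abs_nonneg _) (hc.1 _ _)
    rw [abs_le]; constructor <;> linarith
  rw [Real.cos_sub] at c3 c4
  have C3 := (Real.strictAntiOn_arccos.le_iff_ge (by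
      constructor
      · rw [le_div_iff₀ (mul_pos g3 g1)]; linarith
      · rw [div_le_iff₀ (mul_pos g3 g1)]; linarith) (by
      constructor
      · rw [neg_le_neg_iff, div_le_iff₀ (mul_pos g1 g2)]; linarith
      · rw [neg_le, le_div_iff₀ (mul_pos g1 g2)]; linarith)).1 C2
  rw [← neg_div, div_le_div_iff₀ (mul_pos g1 g2) (mul_pos g3 g1)] at C3
  have C4 : 0 ≤ Real.sin (dist p y) * (Real.cos (dist w₁ p) * Real.sin (dist w₁ x - dist w₁ y)
        + Real.cos (dist p x) * Real.sin (dist w₁ y)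
        - Real.cos (dist p y) * Real.sin (dist w₁ x)) := by
    rw [split]; linarith
  have := nonneg_of_mul_nonneg_right C4 g1
  linarith

theorem qc_interp_lt {X : Type*} [MetricSpace X] (hc : CurvCompGE1 X) (hg : GeodesicSpace X)
    {w₁ w₂ : X} (hw : dist w₁ w₂ = Real.pi) {y x : X} (p : X)
    (hy : 0 < dist w₁ y) (hyx : dist w₁ y < dist w₁ x) (hx : dist w₁ x < Real.pi)
    (hd : dist y x = dist w₁ x - dist w₁ y) :
    Real.cos (dist p y) * Real.sin (dist w₁ x) =
      Real.cos (dist w₁ p) * Real.sin (dist w₁ x - dist w₁ y)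
        + Real.cos (dist p x) * Real.sin (dist w₁ y) := by
  apply le_antisymm (qc_interp_le hc hg hw p hy hyx hx hd)
  have ex : dist w₂ x = Real.pi - dist w₁ x := by
    have := qc_sum hc hg hw x; rw [dist_comm w₂]; linarith
  have ey : dist w₂ y = Real.pi - dist w₁ y := by
    have := qc_sum hc hg hw y; rw [dist_comm w₂]; linarith
  have ep : dist w₂ p = Real.pi - dist w₁ p := by
    have := qc_sum hc hg hw p; rw [dist_comm w₂]; linarith
  have := qc_interp_le hc hg (w₁ := w₂) (w₂ := w₁) (by rw [dist_comm]; exact hw) (y := x) (x := y) p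
    (by linarith) (by linarith) (by linarith) (by rw [dist_comm, hd, ex, ey]; ring)
  rw [ex, ey, ep, Real.sin_pi_sub, Real.sin_pi_sub, Real.cos_pi_sub,
    show Real.pi - dist w₁ y - (Real.pi - dist w₁ x) = dist w₁ x - dist w₁ y by ring] at this
  linarith

/-- Distances from `p` to points of a meridian interpolate as in the spherical suspension. -/
theorem qc_interp {X : Type*} [MetricSpace X] (hc : CurvCompGE1 X) (hg : GeodesicSpace X)
    {w₁ w₂ : X} (hw : dist w₁ w₂ = Real.pi) {y x : X} (p : X)
    (hy : 0 < dist w₁ y) (hy' : dist w₁ y < Real.pi)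
    (hx : 0 < dist w₁ x) (hx' : dist w₁ x < Real.pi)
    (hd : dist y x = |dist w₁ x - dist w₁ y|) :
    Real.cos (dist p y) * Real.sin (dist w₁ x) =
      Real.cos (dist w₁ p) * Real.sin (dist w₁ x - dist w₁ y)
        + Real.cos (dist p x) * Real.sin (dist w₁ y) := by
  rcases lt_trichotomy (dist w₁ y) (dist w₁ x) with h | h | h
  · rw [abs_of_pos (by linarith)] at hd
    exact qc_interp_lt hc hg hw p hy h hx' hd
  · rw [h, sub_self, abs_zero, dist_eq_zero] at hd
    subst hd; simp
  · rw [abs_of_neg (by linarith), dist_comm] at hd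
    have := qc_interp_lt hc hg hw p hx h hy' (by linarith)
    rw [show dist w₁ x - dist w₁ y = -(dist w₁ y - dist w₁ x) by ring, Real.sin_neg]
    linarith

theorem qc_near {X : Type*} [MetricSpace X] (hg : GeodesicSpace X) (o y : X) (n : ℕ) :
    ∃ m, dist m y = dist o y / 2 ^ n ∧ dist o m ≤ dist o y - dist o y / 2 ^ n := by
  induction n with
  | zero => exact ⟨o, by simp, by simp⟩
  | succ n ih =>
    obtain ⟨m, h1, h2⟩ := ih
    obtain ⟨k, k1, k2⟩ := hg m y
    have e : dist o y / 2 ^ (n + 1) = dist o y / 2 ^ n / 2 := by rw [pow_succ]; field_simp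
    refine ⟨k, by rw [k2, h1, e], ?_⟩
    have := dist_triangle o m k
    rw [e]; rw [h1] at k1; linarith

/-- Hopf-Rinow, bounded case. -/
theorem qc_compact {X : Type*} [MetricSpace X] [CompleteSpace X] [LocallyCompactSpace X]
    (hg : GeodesicSpace X) (hd : ∀ x y : X, dist x y ≤ Real.pi) : CompactSpace X := by
  rcases isEmpty_or_nonempty X with hX | ⟨⟨o⟩⟩
  · infer_instance
  by_contra hcon
  have hpi := Real.pi_pos
  set S : Set ℝ := {r | IsCompact (closedBall o r)} with hS
  have hlt : ∀ r ∈ S, r < Real.pi := by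
    intro r hr
    by_contra hge
    push Not at hge
    apply hcon
    have : closedBall o r = Set.univ := by
      ext x; simp only [mem_closedBall, Set.mem_univ, iff_true]; exact (hd x o).trans hge
    exact isCompact_univ_iff.1 (this ▸ hr)
  have hbdd : BddAbove S := ⟨Real.pi, fun r hr => (hlt r hr).le⟩
  obtain ⟨r0, r0pos, hr0⟩ := exists_isCompact_closedBall o
  have hr0S : r0 ∈ S := hr0
  set R := sSup S with hR
  have hR0 : r0 ≤ R := le_csSup hbdd hr0S
  have hRpi : R ≤ Real.pi := csSup_le ⟨r0, hr0S⟩ (fun r hr => (hlt r hr).le)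
  have hbelow : ∀ r < R, IsCompact (closedBall o r) := by
    intro r hr
    obtain ⟨s, hs, hrs⟩ := exists_lt_of_lt_csSup ⟨r0, hr0S⟩ hr
    exact IsCompact.of_isClosed_subset hs isClosed_closedBall (closedBall_subset_closedBall hrs.le)
  have hsmall : ∀ ε : ℝ, 0 < ε → ∃ n : ℕ, Real.pi / 2 ^ n < ε := by
    intro ε hε
    have lim : Filter.Tendsto (fun n : ℕ => Real.pi / 2 ^ n) Filter.atTop (nhds 0) :=
      tendsto_const_nhds.div_atTop (tendsto_pow_atTop_atTop_of_one_lt (by norm_num))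
    exact (lim.eventually (gt_mem_nhds hε)).exists
  have hRc : IsCompact (closedBall o R) := by
    refine isCompact_iff_totallyBounded_isComplete.2 ⟨?_, isClosed_closedBall.isComplete⟩
    rw [Metric.totallyBounded_iff]
    intro ε hε
    obtain ⟨n, hn⟩ := hsmall (ε / 2) (by linarith)
    have hp : (0 : ℝ) < R / 2 ^ n := div_pos (by linarith) (by positivity)
    have hcpt := hbelow (R - R / 2 ^ n) (by linarith)
    obtain ⟨t, tf, ht⟩ := Metric.totallyBounded_iff.1 hcpt.totallyBounded (ε / 2) (by linarith)
    refine ⟨t, tf, fun y hy => ?_⟩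
    obtain ⟨m, m1, m2⟩ := qc_near hg o y n
    have hy' : dist o y ≤ R := by rw [dist_comm]; exact hy
    have h2 : (1 : ℝ) ≤ 2 ^ n := one_le_pow₀ (by norm_num)
    have hm : m ∈ closedBall o (R - R / 2 ^ n) := by
      rw [mem_closedBall, dist_comm]
      have h3 : (0 : ℝ) ≤ 1 - 1 / 2 ^ n := by
        rw [sub_nonneg, div_le_one (by positivity)]; exact h2
      have := mul_le_mul_of_nonneg_right hy' h3
      have e1 : dist o y * (1 - 1 / 2 ^ n) = dist o y - dist o y / 2 ^ n := by ring
      have e2 : R * (1 - 1 / 2 ^ n) = R - R / 2 ^ n := by ring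
      linarith
    have := ht hm
    simp only [Set.mem_iUnion, mem_ball] at this ⊢
    obtain ⟨c, hct, hc⟩ := this
    refine ⟨c, hct, ?_⟩
    have t1 := dist_triangle y m c
    rw [dist_comm y m, m1] at t1
    have : dist o y / 2 ^ n ≤ Real.pi / 2 ^ n := by gcongr; exact hd _ _
    linarith
  obtain ⟨δ, δpos, hδ⟩ := hRc.exists_isCompact_cthickening
  obtain ⟨n, hn⟩ := hsmall (min δ Real.pi) (lt_min δpos hpi)
  have hn1 := lt_of_lt_of_le hn (min_le_left _ _)
  have hn2 := lt_of_lt_of_le hn (min_le_right _ _)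
  have h2 : (1 : ℝ) / 2 ^ n < 1 := by
    have e : Real.pi / 2 ^ n = Real.pi * (1 / 2 ^ n) := by ring
    rw [e] at hn2
    by_contra hge
    push Not at hge
    nlinarith
  have h2' : (0 : ℝ) < 1 / 2 ^ n := by positivity
  have hR' : R / (1 - 1 / 2 ^ n) ∈ S := by
    refine IsCompact.of_isClosed_subset hδ isClosed_closedBall (fun y hy => ?_)
    rw [mem_closedBall, dist_comm, le_div_iff₀ (by linarith)] at hy
    obtain ⟨m, m1, m2⟩ := qc_near hg o y n
    have : dist o y / 2 ^ n ≤ Real.pi / 2 ^ n := by gcongr; exact hd _ _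
    apply mem_cthickening_of_dist_le y m δ
    · rw [mem_closedBall, dist_comm]
      have e1 : dist o y * (1 - 1 / 2 ^ n) = dist o y - dist o y / 2 ^ n := by ring
      linarith
    · rw [dist_comm, m1]; linarith
  have := le_csSup hbdd hR'
  rw [← hR, div_le_iff₀ (by linarith)] at this
  nlinarith

/-- Existence of nearest points with the quasi-convexity inequality. -/
theorem qc_proj {X : Type*} [MetricSpace X] [CompactSpace X] {F : Set X} (hF : IsQuasiConvex₁ F)
    (hne : F.Nonempty) (q : X) : ∃ p ∈ F, dist q p = infDist q F ∧
      ∀ r ∈ F, dist q p ≤ dist q r ∧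
        Real.cos (dist q p) * Real.cos (dist p r) ≤ Real.cos (dist q r) := by
  obtain ⟨p, hp, e⟩ := hF.1.isCompact.exists_infDist_eq_dist hne q
  refine ⟨p, hp, e.symm, fun r hr => ⟨e ▸ infDist_le_dist_of_mem hr, ?_⟩⟩
  by_cases hq : q ∈ F
  · have : dist q p = 0 := by rw [← e]; exact infDist_zero_of_mem hq
    rw [dist_eq_zero] at this
    subst this; simp
  · exact hF.2 q p hq hp e.symm r hr

theorem qc_poles {X : Type*} [MetricSpace X] [CompactSpace X]
    (hg : GeodesicSpace X) (hc : CurvCompGE1 X)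
    {z₁ z₂ : X} (hz : dist z₁ z₂ = Real.pi) {F : Set X} (hF : IsQuasiConvex₁ F)
    (htwo : ∃ a ∈ F, ∃ b ∈ F, a ≠ b) {x : X} (hx : x ∈ F) (hxz : dist x z₁ < Real.pi / 2) :
    ∃ w₁ ∈ F, ∃ w₂ ∈ F, dist w₁ w₂ = Real.pi := by
  have hpi := Real.pi_pos
  obtain ⟨p, hp, -, Hp⟩ := qc_proj hF ⟨x, hx⟩ z₁
  obtain ⟨p', hp', -, Hp'⟩ := qc_proj hF ⟨x, hx⟩ z₂
  have cz : ∀ r, Real.cos (dist z₂ r) = - Real.cos (dist z₁ r) := by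
    intro r
    have := qc_sum hc hg hz r
    rw [dist_comm z₂ r, show dist r z₂ = Real.pi - dist z₁ r by linarith, Real.cos_pi_sub]
  have cos1 : ∀ u v : X, 1 ≤ Real.cos (dist u v) → u = v := by
    intro u v h
    have h' := le_antisymm (Real.cos_le_one _) h
    have := Real.injOn_cos ⟨dist_nonneg, hc.1 u v⟩ ⟨le_rfl, hpi.le⟩ (by rw [h', Real.cos_zero])
    exact dist_eq_zero.1 this
  have A : 0 < Real.cos (dist z₁ p) := by
    apply Real.cos_pos_of_mem_Ioo
    have := (Hp x hx).1
    rw [dist_comm z₁ x] at this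
    exact ⟨by linarith [dist_nonneg (x := z₁) (y := p)], by linarith⟩
  have i1 := (Hp p' hp').2
  have i2 := (Hp' p hp).2
  rw [cz, cz, dist_comm p' p] at i2
  set c := Real.cos (dist p p')
  set a := Real.cos (dist z₁ p)
  set b := Real.cos (dist z₁ p')
  have hc1 : -1 ≤ c := Real.neg_one_le_cos _
  have hc2 : c ≤ 1 := Real.cos_le_one _
  rcases lt_or_ge b 0 with hb | hb
  · refine ⟨p, hp, p', hp', ?_⟩
    have : c = -1 := by
      by_contra hne
      have h3 : -1 < c := lt_of_le_of_ne hc1 (Ne.symm hne)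
      nlinarith
    exact Real.injOn_cos ⟨dist_nonneg, hc.1 _ _⟩ ⟨hpi.le, le_rfl⟩ (by rw [Real.cos_pi]; exact this)
  · exfalso
    have hmono : ∀ r ∈ F, b ≤ Real.cos (dist z₁ r) ∧ Real.cos (dist z₁ r) ≤ a := by
      intro r hr
      have h1 := (Hp r hr).1
      have h2 := (Hp' r hr).1
      constructor
      · have := Real.cos_le_cos_of_nonneg_of_le_pi dist_nonneg (hc.1 z₂ r) h2
        rw [cz, cz] at this
        linarith
      · exact Real.cos_le_cos_of_nonneg_of_le_pi dist_nonneg (hc.1 _ _) h1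
    have hba := (hmono p hp).1
    have hb' : 0 < b := by
      rcases eq_or_lt_of_le hb with h | h
      · rw [← h] at i2; linarith
      · exact h
    have hc' : 1 ≤ c := by
      by_contra h
      push Not at h
      nlinarith
    have hpp := cos1 p p' hc'
    have hall : ∀ r ∈ F, p' = r := by
      intro r hr
      have h1 := hmono r hr
      have h2 := (Hp' r hr).2
      rw [cz, cz] at h2
      have hab : a = b := by simp only [a, b, hpp]
      have e : Real.cos (dist z₁ r) = b := le_antisymm (by linarith) h1.1
      rw [e] at h2
      apply cos1
      change -b * _ ≤ -b at h2
      by_contra h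
      push Not at h
      nlinarith
    obtain ⟨u, hu, v, hv, huv⟩ := htwo
    exact huv ((hall u hu).symm.trans (hall v hv))

theorem qc_alg {H D S c e f : ℝ} (hH : 0 < H) (hH1 : H ≤ 1)
    (hef : e ^ 2 + f ^ 2 = 1)
    (h : H * (D * S) = - (c * f) + H ^ 2 * (S * e + c * f)) :
    (1 - D ^ 2) * S ^ 2 ≤ (1 - H ^ 2) * (S * e + c * f) ^ 2 + f ^ 2 * S ^ 2 := by
  have h1 : H ^ 2 * (D ^ 2 * S ^ 2) = (H ^ 2 * S * e - (1 - H ^ 2) * c * f) ^ 2 := by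
    have : (H * (D * S)) ^ 2 = (H ^ 2 * S * e - (1 - H ^ 2) * c * f) ^ 2 := by rw [h]; ring
    rw [← this]; ring
  have h2 : H ^ 2 * (H ^ 2 * S ^ 2 * e ^ 2 - 2 * (1 - H ^ 2) * S * c * e * f)
      ≤ H ^ 2 * (D ^ 2 * S ^ 2) := by
    rw [h1]; nlinarith [sq_nonneg ((1 - H ^ 2) * c * f)]
  have h3 := le_of_mul_le_mul_left h2 (by positivity)
  have e2 : S ^ 2 = S ^ 2 * e ^ 2 + S ^ 2 * f ^ 2 := by rw [← mul_add, hef, mul_one]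
  have h4 : 0 ≤ (1 - H ^ 2) * (c * f) ^ 2 := mul_nonneg (by nlinarith) (sq_nonneg _)
  nlinarith

theorem qc_sin_le {X : Type*} [MetricSpace X] (hc : CurvCompGE1 X) (hg : GeodesicSpace X)
    {w₁ w₂ : X} (hw : dist w₁ w₂ = Real.pi) {F : Set X} (h1 : w₁ ∈ F) (h2 : w₂ ∈ F) (y : X) :
    infDist y F ≤ Real.pi / 2 ∧ Real.sin (infDist y F) ≤ Real.sin (dist w₁ y) := by
  have i1 := infDist_le_dist_of_mem (x := y) h1
  have i2 := infDist_le_dist_of_mem (x := y) h2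
  have i0 : 0 ≤ infDist y F := infDist_nonneg
  have s := qc_sum hc hg hw y
  have hpi := Real.pi_pos
  rw [dist_comm y w₁] at i1
  refine ⟨by linarith, ?_⟩
  rcases le_total (dist w₁ y) (Real.pi / 2) with h | h
  · exact Real.sin_le_sin_of_le_of_le_pi_div_two (by linarith) h i1
  · rw [← Real.sin_pi_sub (dist w₁ y)]
    exact Real.sin_le_sin_of_le_of_le_pi_div_two (by linarith) (by linarith) (by linarith)

theorem qc_step {X : Type*} [MetricSpace X] [CompactSpace X]
    (hc : CurvCompGE1 X) (hg : GeodesicSpace X)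
    {w₁ w₂ : X} (hw : dist w₁ w₂ = Real.pi) {F : Set X} (hF : IsQuasiConvex₁ F)
    (h1 : w₁ ∈ F) (h2 : w₂ ∈ F) {y x : X}
    (hy : 0 < dist w₁ y) (hy' : dist w₁ y < Real.pi)
    (hx : 0 < dist w₁ x) (hx' : dist w₁ x < Real.pi)
    (hd : dist y x = |dist w₁ x - dist w₁ y|) :
    Real.sin (infDist y F) ^ 2 / Real.sin (dist w₁ y) ^ 2 ≤
      Real.sin (infDist x F) ^ 2 / Real.sin (dist w₁ x) ^ 2
        + dist y x ^ 2 / Real.sin (dist w₁ y) ^ 2 := by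
  have hpi := Real.pi_pos
  have gy := Real.sin_pos_of_pos_of_lt_pi hy hy'
  have gx := Real.sin_pos_of_pos_of_lt_pi hx hx'
  obtain ⟨ly, sy⟩ := qc_sin_le hc hg hw h1 h2 y
  obtain ⟨lx, sx⟩ := qc_sin_le hc hg hw h1 h2 x
  have ny : 0 ≤ infDist y F := infDist_nonneg
  have nx : 0 ≤ infDist x F := infDist_nonneg
  have ny' : 0 ≤ Real.sin (infDist y F) := Real.sin_nonneg_of_nonneg_of_le_pi ny (by linarith)
  have nx' : 0 ≤ Real.sin (infDist x F) := Real.sin_nonneg_of_nonneg_of_le_pi nx (by linarith)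
  have f1 : Real.sin (dist w₁ y - dist w₁ x) ^ 2 ≤ dist y x ^ 2 := by
    rw [hd, sq_abs, ← neg_sub, Real.sin_neg, neg_sq]
    exact sq_le_sq.2 Real.abs_sin_le_abs
  have wy : Real.sin (infDist y F) ^ 2 / Real.sin (dist w₁ y) ^ 2 ≤ 1 := by
    rw [div_le_one (by positivity)]
    exact pow_le_pow_left₀ ny' sy 2
  have gx1 : Real.sin (dist w₁ x) ^ 2 ≤ 1 := Real.sin_sq_le_one _
  have gy1 : Real.sin (dist w₁ y) ^ 2 ≤ 1 := Real.sin_sq_le_one _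
  have dd : dist y x ^ 2 ≤ dist y x ^ 2 / Real.sin (dist w₁ y) ^ 2 :=
    le_div_self (sq_nonneg _) (by positivity) gy1
  have ww : Real.sin (infDist x F) ^ 2 ≤ Real.sin (infDist x F) ^ 2 / Real.sin (dist w₁ x) ^ 2 :=
    le_div_self (sq_nonneg _) (by positivity) gx1
  obtain ⟨p, hp, hpe, Hp⟩ := qc_proj hF ⟨w₁, h1⟩ x
  have E := qc_interp hc hg hw p hy hy' hx hx' hd
  have q1 := (Hp w₁ h1).2
  have q2 := (Hp w₂ h2).2
  rw [show dist p w₂ = Real.pi - dist w₁ p by linarith [qc_sum hc hg hw p],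
    show dist x w₂ = Real.pi - dist w₁ x by linarith [qc_sum hc hg hw x],
    Real.cos_pi_sub, Real.cos_pi_sub] at q2
  rw [dist_comm p w₁, dist_comm x w₁] at q1
  have q : Real.cos (infDist x F) * Real.cos (dist w₁ p) = Real.cos (dist w₁ x) := by
    rw [← hpe]; linarith
  have hyp : infDist y F ≤ dist p y := by rw [dist_comm]; exact infDist_le_dist_of_mem hp
  rw [dist_comm p x, hpe] at E
  rcases lt_or_ge (Real.pi / 2) (dist p y) with hbig | hsm
  · -- the far case
    have t := dist_triangle p x y
    rw [dist_comm p x, hpe, dist_comm x y] at t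
    have hcd : Real.cos (infDist x F) ≤ dist y x := by
      rw [← Real.sin_pi_div_two_sub]
      refine (Real.sin_le (by linarith)).trans (by linarith)
    have hc0 : 0 ≤ Real.cos (infDist x F) := Real.cos_nonneg_of_mem_Icc ⟨by linarith, lx⟩
    have := Real.sin_sq_add_cos_sq (infDist x F)
    have := pow_le_pow_left₀ hc0 hcd 2
    linarith
  rcases eq_or_lt_of_le lx with hh | hh
  · -- `x` is at distance `π / 2` from `F`
    rw [hh, Real.sin_pi_div_two, one_pow] at ww ⊢
    have := sq_nonneg (dist y x)
    linarith
  have hH : 0 < Real.cos (infDist x F) := Real.cos_pos_of_mem_Ioo ⟨by linarith, hh⟩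
  have hsinc : Real.sin (dist w₁ y) = Real.sin (dist w₁ x) * Real.cos (dist w₁ y - dist w₁ x)
      + Real.cos (dist w₁ x) * Real.sin (dist w₁ y - dist w₁ x) := by
    rw [← Real.sin_add]; congr 1; ring
  have A := qc_alg (D := Real.cos (dist p y)) (S := Real.sin (dist w₁ x))
    (c := Real.cos (dist w₁ x)) (e := Real.cos (dist w₁ y - dist w₁ x))
    (f := Real.sin (dist w₁ y - dist w₁ x)) hH (Real.cos_le_one _)
    (by rw [add_comm]; exact Real.sin_sq_add_cos_sq _) (by
      rw [← hsinc, E, show dist w₁ x - dist w₁ y = -(dist w₁ y - dist w₁ x) by ring, Real.sin_neg,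
        ← q]
      ring)
  rw [← hsinc, ← Real.sin_sq, ← Real.sin_sq] at A
  have B : Real.sin (infDist y F) ^ 2 ≤ Real.sin (dist p y) ^ 2 :=
    pow_le_pow_left₀ ny' (Real.sin_le_sin_of_le_of_le_pi_div_two (by linarith) hsm hyp) 2
  have px : 0 < Real.sin (dist w₁ x) ^ 2 := by positivity
  have py : 0 < Real.sin (dist w₁ y) ^ 2 := by positivity
  rw [div_add_div _ _ px.ne' py.ne', div_le_div_iff₀ py (by positivity)]
  have C : Real.sin (infDist y F) ^ 2 * Real.sin (dist w₁ x) ^ 2 ≤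
      Real.sin (infDist x F) ^ 2 * Real.sin (dist w₁ y) ^ 2
        + Real.sin (dist w₁ x) ^ 2 * dist y x ^ 2 := by
    have := mul_le_mul_of_nonneg_right B px.le
    have := mul_le_mul_of_nonneg_right f1 px.le
    linarith
  have := mul_le_mul_of_nonneg_right C py.le
  linarith

theorem qc_iter {X : Type*} [MetricSpace X] [CompactSpace X]
    (hc : CurvCompGE1 X) (hg : GeodesicSpace X)
    {w₁ w₂ : X} (hw : dist w₁ w₂ = Real.pi) {F : Set X} (hF : IsQuasiConvex₁ F)
    (h1 : w₁ ∈ F) (h2 : w₂ ∈ F) {α β C : ℝ} (hα : 0 < α) (hβ : β < Real.pi)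
    (hC : ∀ t, α ≤ t → t ≤ β → 1 / Real.sin t ^ 2 ≤ C) (n : ℕ) :
    ∀ y x : X, α ≤ dist w₁ y → dist w₁ y ≤ β → α ≤ dist w₁ x → dist w₁ x ≤ β →
      dist y x = |dist w₁ x - dist w₁ y| →
    Real.sin (infDist y F) ^ 2 / Real.sin (dist w₁ y) ^ 2 ≤
      Real.sin (infDist x F) ^ 2 / Real.sin (dist w₁ x) ^ 2 + C * dist y x ^ 2 / 2 ^ n := by
  induction n with
  | zero =>
    intro y x a1 a2 a3 a4 hd
    have := qc_step hc hg hw hF h1 h2 (by linarith) (by linarith) (by linarith) (by linarith) hd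
    have h3 := mul_le_mul_of_nonneg_right (hC _ a1 a2) (sq_nonneg (dist y x))
    rw [div_mul_eq_mul_div, one_mul] at h3
    simp only [pow_zero, div_one]
    linarith
  | succ n ih =>
    intro y x a1 a2 a3 a4 hd
    obtain ⟨m, m1, m2⟩ := hg y x
    have t1 := dist_triangle w₁ y m
    have t2 := dist_triangle w₁ m y
    have t3 := dist_triangle w₁ x m
    have t4 := dist_triangle w₁ m x
    rw [dist_comm m y] at t2
    rw [dist_comm x m] at t3
    have hm : dist w₁ m = (dist w₁ y + dist w₁ x) / 2 := by
      rcases abs_cases (dist w₁ x - dist w₁ y) with ⟨h, -⟩ | ⟨h, -⟩ <;> rw [h] at hd <;> linarith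
    have e1 : dist y m = |dist w₁ m - dist w₁ y| := by
      rw [m1, hd, hm, show (dist w₁ y + dist w₁ x) / 2 - dist w₁ y
        = (dist w₁ x - dist w₁ y) / 2 by ring, abs_div, abs_two]
    have e2 : dist m x = |dist w₁ x - dist w₁ m| := by
      rw [m2, hd, hm, show dist w₁ x - (dist w₁ y + dist w₁ x) / 2
        = (dist w₁ x - dist w₁ y) / 2 by ring, abs_div, abs_two]
    have i1 := ih y m a1 a2 (by linarith) (by linarith) e1
    have i2 := ih m x (by linarith) (by linarith) a3 a4 e2
    rw [m1] at i1
    rw [m2] at i2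
    have e : C * dist y x ^ 2 / 2 ^ (n + 1) = 2 * (C * (dist y x / 2) ^ 2 / 2 ^ n) := by
      rw [pow_succ]; field_simp; ring
    linarith

theorem qc_join {X : Type*} [MetricSpace X] [CompactSpace X]
    (hc : CurvCompGE1 X) (hg : GeodesicSpace X)
    {w₁ w₂ : X} (hw : dist w₁ w₂ = Real.pi) {F : Set X} (hF : IsQuasiConvex₁ F)
    (h1 : w₁ ∈ F) (h2 : w₂ ∈ F) {r x : X} (hr : r ∈ F)
    (hr0 : 0 < dist w₁ r) (hr1 : dist w₁ r < Real.pi)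
    (hd : dist x r = |dist w₁ x - dist w₁ r|) : x ∈ F := by
  have hpi := Real.pi_pos
  rcases eq_or_ne w₁ x with h | h
  · exact h ▸ h1
  rcases eq_or_ne x w₂ with h' | h'
  · exact h' ▸ h2
  have hx0 : 0 < dist w₁ x := dist_pos.2 h
  have hx1 : dist w₁ x < Real.pi := by
    have := qc_sum hc hg hw x
    have := dist_pos.2 h'
    linarith
  set α := min (dist w₁ r) (dist w₁ x) with hα
  set β := max (dist w₁ r) (dist w₁ x) with hβ
  have a0 : 0 < α := lt_min hr0 hx0
  have b1 : β < Real.pi := max_lt hr1 hx1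
  have hab : α ≤ β := min_le_max
  have sa := Real.sin_pos_of_pos_of_lt_pi a0 (by linarith)
  have sb := Real.sin_pos_of_pos_of_lt_pi (x := β) (by linarith) b1
  have hC : ∀ t, α ≤ t → t ≤ β →
      1 / Real.sin t ^ 2 ≤ 1 / (min (Real.sin α) (Real.sin β)) ^ 2 := by
    intro t t1 t2
    have h0 : 0 < min (Real.sin α) (Real.sin β) := lt_min sa sb
    apply one_div_le_one_div_of_le (by positivity)
    apply pow_le_pow_left₀ h0.le
    rcases le_total t (Real.pi / 2) with ht | ht
    · exact (min_le_left _ _).trans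
        (Real.sin_le_sin_of_le_of_le_pi_div_two (by linarith) ht t1)
    · refine (min_le_right _ _).trans ?_
      rw [← Real.sin_pi_sub β, ← Real.sin_pi_sub t]
      exact Real.sin_le_sin_of_le_of_le_pi_div_two (by linarith) (by linarith) (by linarith)
  have key := fun n => qc_iter hc hg hw hF h1 h2 a0 b1 hC n x r (min_le_right _ _)
    (le_max_right _ _) (min_le_left _ _) (le_max_left _ _) (by rw [hd, abs_sub_comm])
  have lim : Filter.Tendsto (fun n : ℕ => 1 / (min (Real.sin α) (Real.sin β)) ^ 2
      * dist x r ^ 2 / 2 ^ n) Filter.atTop (nhds 0) :=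
    tendsto_const_nhds.div_atTop (tendsto_pow_atTop_atTop_of_one_lt (by norm_num))
  have fin := ge_of_tendsto' lim (fun n => by
    have := key n
    rw [infDist_zero_of_mem hr, Real.sin_zero, zero_pow two_ne_zero, zero_div, zero_add] at this
    exact this)
  have sx := Real.sin_pos_of_pos_of_lt_pi hx0 hx1
  rw [div_le_iff₀ (by positivity), zero_mul] at fin
  have hs : Real.sin (infDist x F) = 0 := by
    have := le_antisymm fin (sq_nonneg _)
    exact pow_eq_zero_iff two_ne_zero |>.1 this
  have hle := (qc_sin_le hc hg hw h1 h2 x).1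
  have hi : infDist x F = 0 := by
    by_contra hne
    have hp : 0 < infDist x F := lt_of_le_of_ne infDist_nonneg (Ne.symm hne)
    have := Real.sin_pos_of_pos_of_lt_pi hp (by linarith)
    linarith
  exact (hF.1.mem_iff_infDist_zero ⟨w₁, h1⟩).2 hi

/-- In a spherical suspension with poles `z₁, z₂`, a quasi-convex subset with at least two points
either lies in the equator, or is the spherical join of a pair of antipodal points `w₁, w₂ ∈ F`
with its intersection with their equator. -/
theorem quasiConvex_in_spherical_suspension {X : Type*} [MetricSpace X] [CompleteSpace X]
    [LocallyCompactSpace X]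
    (hdim : dimH (Set.univ : Set X) < ⊤)
    (hgeo : GeodesicSpace X)
    (hdiam : ∀ x y : X, dist x y ≤ Real.pi)
    (hcurv : CurvCompGE1 X)
    (z₁ z₂ : X) (hz : dist z₁ z₂ = Real.pi)
    (F : Set X) (hqc : IsQuasiConvex₁ F)
    (htwo : ∃ a ∈ F, ∃ b ∈ F, a ≠ b) :
    (∀ x ∈ F, dist x z₁ = Real.pi / 2) ∨
      ∃ w₁ ∈ F, ∃ w₂ ∈ F, dist w₁ w₂ = Real.pi ∧
        ∀ r ∈ F, 0 < dist w₁ r → dist w₁ r < Real.pi →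
          ∀ x : X, dist w₁ x + dist x w₂ = Real.pi →
            dist x r = |dist w₁ x - dist w₁ r| → x ∈ F := by
  haveI : CompactSpace X := qc_compact hgeo hdiam
  by_cases hall : ∀ x ∈ F, dist x z₁ = Real.pi / 2
  · exact Or.inl hall
  right
  push Not at hall
  obtain ⟨x, hx, hne⟩ := hall
  have hex : ∃ w₁ ∈ F, ∃ w₂ ∈ F, dist w₁ w₂ = Real.pi := by
    rcases lt_or_gt_of_ne hne with h | h
    · exact qc_poles hgeo hcurv hz hqc htwo hx h
    · refine qc_poles hgeo hcurv (z₁ := z₂) (z₂ := z₁) (by rw [dist_comm]; exact hz) hqc htwo hx ?_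
      have := qc_sum hcurv hgeo hz x
      rw [dist_comm z₁ x] at this
      linarith
  obtain ⟨w₁, h1, w₂, h2, hw⟩ := hex
  refine ⟨w₁, h1, w₂, h2, hw, ?_⟩
  intro r hr hr0 hr1 x _ hd
  exact qc_join hcurv hgeo hw hqc h1 h2 hr hr0 hr1 hd
end
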